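/- Let G ↷ (X, μ) be an aperiodic pmp action of a countable group, let ξ be a countable collection of Borel subsets of X, let F be a countably generated G-invariant sub-σ-algebra, and suppose x ↦ π_x is an ergodic decomposition map for μ with τ = π_*μ. If ν ↦ p^ν = (p_i^ν)_{i∈ℕ} is a Borel map assigning to each G-invariant ergodic Borel probability measure ν a probability vector with rh_{G,ν}(ξ | F) < H(p^ν), where H(p) = ∑_i −p_i·log p_i, then there is a Borel partition α = {A_i : i ∈ ℕ} of X such that ξ ⊆ σ_G(α) ∨ F modulo μ-null sets and ν(A_i) = p_i^ν for every i ∈ ℕ and τ-almost-every ν. -/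

import Mathlib

open MeasureTheory Set Function
open scoped ENNReal symmDiff

/-- A set in a measurable space is *analytic* if it is the image of a Borel subset of a
standard Borel space under a Borel (measurable) map. -/
def IsAnalyticS {W : Type*} [MeasurableSpace W] (A : Set W) : Prop :=
  ∃ (Z : Type) (mZ : MeasurableSpace Z), @StandardBorelSpace Z mZ ∧
    ∃ (B : Set Z) (f : Z → W), MeasurableSet[mZ] B ∧ @Measurable Z W mZ _ f ∧ f '' B = A

/-- The smallest `G`-invariant sub-σ-algebra containing the collection `ξ`. -/
def sigmaG (G : Type*) {X : Type*} [Group G] [MulAction G X] (ξ : Set (Set X)) :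
    MeasurableSpace X :=
  MeasurableSpace.generateFrom {B | ∃ (g : G), ∃ A ∈ ξ, B = (fun x => g • x) ⁻¹' A}

/-- The σ-algebra of `G`-invariant measurable sets. -/
def invSigma (G X : Type*) [Group G] [MulAction G X] [MeasurableSpace X] :
    MeasurableSpace X :=
  MeasurableSpace.generateFrom {A | MeasurableSet A ∧ ∀ g : G, (fun x => g • x) ⁻¹' A = A}

/-- Conditional Shannon entropy `H_μ(α | m)` of a countable partition `α` given a
sub-σ-algebra `m`, valued in `[0,∞]`. -/
noncomputable def condEnt {X : Type*} (m : MeasurableSpace X) [mX : MeasurableSpace X]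
    (μ : Measure X) {ι : Type*} (α : ι → Set X) : ℝ≥0∞ :=
  ∫⁻ x, ∑' i, ENNReal.ofReal
    (Real.negMulLog ((μ[(α i).indicator (fun _ => (1 : ℝ)) | m]) x)) ∂μ

/-- Shannon entropy `H_μ(α)` of a countable partition. -/
noncomputable def shEnt {X : Type*} [MeasurableSpace X] (μ : Measure X)
    {ι : Type*} (α : ι → Set X) : ℝ≥0∞ :=
  ∑' i, ENNReal.ofReal (Real.negMulLog (μ (α i)).toReal)

/-- `α` is a countable Borel partition of `X` (indexed by `ℕ`, cells may be empty). -/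
def IsPartition {X : Type*} [MeasurableSpace X] (α : ℕ → Set X) : Prop :=
  (∀ i, MeasurableSet (α i)) ∧ Pairwise (Function.onFun Disjoint α) ∧ (⋃ i, α i) = univ

/-- Every set of `ξ` agrees with an `m`-measurable set modulo `μ`-null sets. -/
def SubsetMod {X : Type*} (m : MeasurableSpace X) [mX : MeasurableSpace X] (μ : Measure X)
    (ξ : Set (Set X)) : Prop :=
  ∀ A ∈ ξ, ∃ B, MeasurableSet[m] B ∧ μ (A ∆ B) = 0

/-- Outer Rokhlin entropy `rh_{G,μ}(ξ | F)`. -/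
noncomputable def outerRokhlin (G : Type*) {X : Type*} (ξ : Set (Set X))
    (F : MeasurableSpace X) [Group G] [MulAction G X] [mX : MeasurableSpace X]
    (μ : Measure X) : ℝ≥0∞ :=
  sInf { h | ∃ α : ℕ → Set X, IsPartition α ∧
      SubsetMod (sigmaG G (Set.range α) ⊔ F ⊔ invSigma G X) μ ξ ∧
      h = condEnt (F ⊔ invSigma G X) μ α }

/-- Rokhlin entropy `rh_G(X, μ | F)`. -/
noncomputable def rokhlin (G : Type*) {X : Type*} (F : MeasurableSpace X) [Group G]
    [MulAction G X] [mX : MeasurableSpace X] (μ : Measure X) : ℝ≥0∞ :=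
  outerRokhlin G {A | MeasurableSet A} F μ

/-- Outer Rokhlin entropy `rh_{G,μ}(S | F)` of a sub-σ-algebra `S`. -/
noncomputable def outerRokhlinAlg (G : Type*) {X : Type*} (S F : MeasurableSpace X) [Group G]
    [MulAction G X] [mX : MeasurableSpace X] (μ : Measure X) : ℝ≥0∞ :=
  outerRokhlin G {A | MeasurableSet[S] A} F μ

/-- The action of `G` on `(X, μ)` is probability-measure-preserving. -/
def IsPmp (G : Type*) {X : Type*} [Group G] [MulAction G X] [MeasurableSpace X]
    (μ : Measure X) : Prop :=
  ∀ g : G, MeasurePreserving (fun x => g • x) μ μ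

/-- Aperiodicity: μ-almost-every `G`-orbit is infinite. -/
def Aperiodic (G : Type*) {X : Type*} [Group G] [MulAction G X] [MeasurableSpace X]
    (μ : Measure X) : Prop :=
  ∀ᵐ x ∂μ, (MulAction.orbit G x).Infinite

/-- Ergodicity of a measure: every invariant Borel set is null or conull. -/
def IsErgodicInv (G : Type*) {X : Type*} [Group G] [MulAction G X] [MeasurableSpace X]
    (ν : Measure X) : Prop :=
  ∀ A : Set X, MeasurableSet A → (∀ g : G, (fun x => g • x) ⁻¹' A = A) → ν A = 0 ∨ ν A = 1

/-- `F` is a `G`-invariant σ-algebra. -/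
def InvariantAlg (G : Type*) {X : Type*} (F : MeasurableSpace X) [Group G] [MulAction G X] :
    Prop :=
  ∀ (g : G) (A : Set X), MeasurableSet[F] A → MeasurableSet[F] ((fun x => g • x) ⁻¹' A)

/-- `F` is countably generated. -/
def CountablyGen {X : Type*} (F : MeasurableSpace X) : Prop :=
  ∃ S : Set (Set X), S.Countable ∧ F = MeasurableSpace.generateFrom S

/-- `π` is an ergodic decomposition map for `μ`. -/
def IsErgDecomp (G : Type*) {X : Type*} [Group G] [MulAction G X] [MeasurableSpace X]
    (μ : Measure X) (π : X → Measure X) : Prop :=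
  Measurable π ∧
  (∀ x, IsProbabilityMeasure (π x) ∧ IsPmp G (π x) ∧ IsErgodicInv G (π x)) ∧
  (∀ (g : G) (x : X), π (g • x) = π x) ∧
  (∀ ν : Measure X, IsProbabilityMeasure ν → IsPmp G ν → IsErgodicInv G ν →
      ν {x | π x = ν} = 1) ∧
  (∀ B : Set X, MeasurableSet B → μ B = ∫⁻ x, π x B ∂μ)


open MeasureTheory Set Function
open scoped ENNReal symmDiff

section Basics
variable {G X : Type*} [Group G] [MulAction G X]

lemma InvariantAlg.pre {m : MeasurableSpace X} (hm : InvariantAlg G m) (k : G) {A : Set X}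
    (hA : MeasurableSet[m] A) : MeasurableSet[m] ((fun x => k • x) ⁻¹' A) := hm k A hA

lemma InvariantAlg.measurable_smul {m : MeasurableSpace X} (hm : InvariantAlg G m) (k : G) :
    Measurable[m, m] (fun x : X => k • x) := fun _ hA => hm k _ hA

lemma IsPmp.inv [mX : MeasurableSpace X] {ν : Measure X} (h : IsPmp G ν) :
    InvariantAlg G mX := fun k _ hA => (h k).measurable hA

lemma IsPmp.meas [mX : MeasurableSpace X] {ν : Measure X} (h : IsPmp G ν) (k : G) :
    Measurable (fun x : X => k • x) := (h k).measurable

lemma IsPmp.measure_pre [mX : MeasurableSpace X] {ν : Measure X} (h : IsPmp G ν) (k : G)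
    {A : Set X} (hA : MeasurableSet A) : ν ((fun x => k • x) ⁻¹' A) = ν A :=
  (h k).measure_preimage hA.nullMeasurableSet

/-- an invariant σ-algebra stays invariant after completion -/
lemma InvariantAlg.ev {m : MeasurableSpace X} [mX : MeasurableSpace X] {ν : Measure X}
    (h : IsPmp G ν) (hm : InvariantAlg G m) :
    InvariantAlg G (eventuallyMeasurableSpace m (ae ν)) := by
  intro k A hA
  obtain ⟨B, hB, hAB⟩ := hA
  exact ⟨_, hm k B hB, (h k).quasiMeasurePreserving.preimage_ae_eq hAB⟩

lemma InvariantAlg.sup {m₁ m₂ : MeasurableSpace X} (h₁ : InvariantAlg G m₁)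
    (h₂ : InvariantAlg G m₂) : InvariantAlg G (m₁ ⊔ m₂) := by
  intro k A hA
  have : m₁ ⊔ m₂ ≤ (m₁ ⊔ m₂).map (fun x => k • x) := by
    apply sup_le
    · intro B hB
      exact (le_sup_left : m₁ ≤ m₁ ⊔ m₂) _ (h₁ k B hB)
    · intro B hB
      exact (le_sup_right : m₂ ≤ m₁ ⊔ m₂) _ (h₂ k B hB)
  exact this A hA

lemma InvariantAlg.sigmaG (ξ : Set (Set X)) : InvariantAlg G (sigmaG G ξ) := by
  intro k A hA
  have : _root_.sigmaG G ξ ≤ (_root_.sigmaG G ξ).map (fun x => k • x) := by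
    refine MeasurableSpace.generateFrom_le ?_
    rintro B ⟨l, C, hC, rfl⟩
    refine MeasurableSpace.measurableSet_generateFrom ⟨l * k, C, hC, ?_⟩
    ext x; simp [mul_smul]
  exact this A hA

lemma InvariantAlg.invSigma [mX : MeasurableSpace X] : InvariantAlg G (invSigma G X) := by
  intro k A hA
  have : _root_.invSigma G X ≤ (_root_.invSigma G X).map (fun x => k • x) := by
    refine MeasurableSpace.generateFrom_le ?_
    rintro B ⟨hB, hB'⟩
    refine MeasurableSpace.measurableSet_generateFrom ?_
    rw [hB' k]; exact ⟨hB, hB'⟩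
  exact this A hA

lemma invSigma_le [mX : MeasurableSpace X] : invSigma G X ≤ mX :=
  MeasurableSpace.generateFrom_le fun _ h => h.1

/-- ergodicity: the translates of a positive set cover almost everything -/
lemma erg_cover [mX : MeasurableSpace X] {ν : Measure X} [IsProbabilityMeasure ν]
    (hp : IsPmp G ν) (he : IsErgodicInv G ν) {g : ℕ → G} (hg : Surjective g) {A : Set X}
    (hA : MeasurableSet A) (hA0 : ν A ≠ 0) : ν {x | ∀ n, g n • x ∉ A} = 0 := by
  have hm : MeasurableSet {x : X | ∀ n, g n • x ∉ A} := by
    have : {x : X | ∀ n, g n • x ∉ A} = ⋂ n, ((fun x => g n • x) ⁻¹' A)ᶜ := by ext; simp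
    rw [this]
    exact MeasurableSet.iInter fun n => (hp.meas _ hA).compl
  have hinv : ∀ k : G, (fun x => k • x) ⁻¹' {x : X | ∀ n, g n • x ∉ A}
      = {x : X | ∀ n, g n • x ∉ A} := by
    intro k
    ext x
    simp only [mem_preimage, mem_setOf_eq]
    constructor
    · intro h n
      obtain ⟨l, hl⟩ := hg (g n * k⁻¹)
      have := h l
      rwa [hl, smul_smul, inv_mul_cancel_right] at this
    · intro h n
      obtain ⟨l, hl⟩ := hg (g n * k)
      have := h l
      rwa [hl, mul_smul] at this
  rcases he _ hm hinv with h | h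
  · exact h
  · exfalso
    apply hA0
    have h2 : ν {x : X | ∀ n, g n • x ∉ A}ᶜ = 0 := by
      rw [measure_compl hm (by simp), h]; simp
    refine measure_mono_null ?_ h2
    intro x hx hx'
    obtain ⟨n, hn⟩ := hg 1
    exact hx' n (by simpa [hn] using hx)

end Basics

section Greedy
variable {G X : Type*} [Group G] [MulAction G X] (g : ℕ → G) (A B : Set X)

/-- remaining unmatched parts -/
def gRem : ℕ → Set X × Set X
  | 0 => (A, B)
  | n + 1 =>
    ((gRem n).1 \ (fun x => g n • x) ⁻¹' (gRem n).2,
      (gRem n).2 \ (fun x => (g n)⁻¹ • x) ⁻¹' (gRem n).1)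

def gC (n : ℕ) : Set X := (gRem g A B n).1 ∩ (fun x => g n • x) ⁻¹' (gRem g A B n).2

def gDom : Set X := ⋃ n, gC g A B n

open Classical in
noncomputable def gMap (x : X) : X :=
  if h : ∃ n, x ∈ gC g A B n then g (Nat.find h) • x else x

open Classical in
noncomputable def gInv (y : X) : X :=
  if h : ∃ n, (g n)⁻¹ • y ∈ gC g A B n then (g (Nat.find h))⁻¹ • y else y

lemma gRem_anti1 {m n : ℕ} (h : m ≤ n) : (gRem g A B n).1 ⊆ (gRem g A B m).1 := by
  induction n, h using Nat.le_induction with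
  | base => exact subset_rfl
  | succ n _ ih => exact sdiff_subset.trans ih

lemma gRem_anti2 {m n : ℕ} (h : m ≤ n) : (gRem g A B n).2 ⊆ (gRem g A B m).2 := by
  induction n, h using Nat.le_induction with
  | base => exact subset_rfl
  | succ n _ ih => exact sdiff_subset.trans ih

lemma gC_disj {m n : ℕ} {x : X} (hm : x ∈ gC g A B m) (hn : x ∈ gC g A B n) : m = n := by
  wlog h : m < n generalizing m n
  · rcases eq_or_lt_of_le (not_lt.1 h) with h | h
    · exact h.symm
    · exact (this hn hm h).symm
  exact absurd hm.2 (gRem_anti1 g A B (Nat.succ_le_of_lt h) hn.1).2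

lemma gC_disj' {m n : ℕ} {x y : X} (hm : x ∈ gC g A B m) (hn : y ∈ gC g A B n)
    (h : g m • x = g n • y) : m = n := by
  wlog hl : m < n generalizing m n x y
  · rcases eq_or_lt_of_le (not_lt.1 hl) with hl | hl
    · exact hl.symm
    · exact (this hn hm h.symm hl).symm
  exfalso
  have := (gRem_anti2 g A B (Nat.succ_le_of_lt hl) hn.2).2
  apply this
  simp only [mem_preimage, ← h, inv_smul_smul]
  exact hm.1

lemma gMap_of {n : ℕ} {x : X} (h : x ∈ gC g A B n) : gMap g A B x = g n • x := by
  classical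
  have hex : ∃ n, x ∈ gC g A B n := ⟨n, h⟩
  unfold gMap
  rw [dif_pos hex, gC_disj g A B (Nat.find_spec hex) h]

lemma gDom_sub : gDom g A B ⊆ A := by
  intro x hx
  obtain ⟨n, hn⟩ := mem_iUnion.1 hx
  exact gRem_anti1 g A B (Nat.zero_le n) hn.1

lemma gMap_maps : MapsTo (gMap g A B) (gDom g A B) B := by
  intro x hx
  obtain ⟨n, hn⟩ := mem_iUnion.1 hx
  rw [gMap_of g A B hn]
  exact gRem_anti2 g A B (Nat.zero_le n) hn.2

lemma gInv_gMap {x : X} (hx : x ∈ gDom g A B) : gInv g A B (gMap g A B x) = x := by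
  classical
  obtain ⟨n, hn⟩ := mem_iUnion.1 hx
  rw [gMap_of g A B hn]
  have hex : ∃ k, (g k)⁻¹ • (g n • x) ∈ gC g A B k := ⟨n, by simpa using hn⟩
  unfold gInv
  rw [dif_pos hex]
  have h1 := Nat.find_spec hex
  have := gC_disj' g A B h1 hn (by simp)
  rw [this]; simp

lemma gMap_injOn : InjOn (gMap g A B) (gDom g A B) := by
  intro x hx y hy h
  rw [← gInv_gMap g A B hx, h, gInv_gMap g A B hy]

variable {g A B}

lemma gRem_meas {m : MeasurableSpace X} (hm : InvariantAlg G m) (hA : MeasurableSet[m] A)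
    (hB : MeasurableSet[m] B) (n : ℕ) :
    MeasurableSet[m] (gRem g A B n).1 ∧ MeasurableSet[m] (gRem g A B n).2 := by
  induction n with
  | zero => exact ⟨hA, hB⟩
  | succ n ih => exact ⟨ih.1.diff (hm.pre _ ih.2), ih.2.diff (hm.pre _ ih.1)⟩

lemma gC_meas {m : MeasurableSpace X} (hm : InvariantAlg G m) (hA : MeasurableSet[m] A)
    (hB : MeasurableSet[m] B) (n : ℕ) : MeasurableSet[m] (gC g A B n) :=
  (gRem_meas hm hA hB n).1.inter (hm.pre _ (gRem_meas hm hA hB n).2)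

lemma gDom_meas {m : MeasurableSpace X} (hm : InvariantAlg G m) (hA : MeasurableSet[m] A)
    (hB : MeasurableSet[m] B) : MeasurableSet[m] (gDom g A B) :=
  MeasurableSet.iUnion fun n => gC_meas hm hA hB n

lemma gMap_meas {m : MeasurableSpace X} (hm : InvariantAlg G m) (hA : MeasurableSet[m] A)
    (hB : MeasurableSet[m] B) : Measurable[m, m] (gMap g A B) := by
  intro D hD
  have : gMap g A B ⁻¹' D = (⋃ n, gC g A B n ∩ (fun x => g n • x) ⁻¹' D) ∪
      ((gDom g A B)ᶜ ∩ D) := by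
    ext x
    by_cases hx : x ∈ gDom g A B
    · obtain ⟨n, hn⟩ := mem_iUnion.1 hx
      simp only [mem_preimage, gMap_of g A B hn, mem_union, mem_iUnion, mem_inter_iff,
        mem_compl_iff, hx, not_true, false_and, or_false]
      constructor
      · intro h; exact ⟨n, hn, h⟩
      · rintro ⟨k, hk, h⟩
        rwa [gC_disj g A B hn hk]
    · have hx' : ¬ ∃ n, x ∈ gC g A B n := by simpa [gDom] using hx
      have h2 : gMap g A B x = x := by unfold gMap; rw [dif_neg hx']
      simp only [mem_preimage, h2, mem_union, mem_iUnion, mem_inter_iff, mem_compl_iff, hx,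
        not_false_iff, true_and]
      constructor
      · intro h; exact Or.inr h
      · rintro (⟨k, hk, -⟩ | h)
        · exact absurd ⟨k, hk⟩ hx'
        · exact h
  rw [this]
  exact (MeasurableSet.iUnion fun n => (gC_meas hm hA hB n).inter (hm.pre _ hD)).union
    ((gDom_meas hm hA hB).compl.inter hD)

lemma gMap_image (D : Set X) (hD : D ⊆ gDom g A B) :
    gMap g A B '' D = ⋃ n, (fun x => (g n)⁻¹ • x) ⁻¹' (D ∩ gC g A B n) := by
  ext y
  simp only [mem_image, mem_iUnion, mem_preimage, mem_inter_iff]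
  constructor
  · rintro ⟨x, hx, rfl⟩
    obtain ⟨n, hn⟩ := mem_iUnion.1 (hD hx)
    refine ⟨n, ?_⟩
    rw [gMap_of g A B hn]
    simpa using ⟨hx, hn⟩
  · rintro ⟨n, h1, h2⟩
    exact ⟨_, h1, by rw [gMap_of g A B h2]; simp⟩

lemma gMap_image_meas {m : MeasurableSpace X} (hm : InvariantAlg G m) (hA : MeasurableSet[m] A)
    (hB : MeasurableSet[m] B) {D : Set X} (hDm : MeasurableSet[m] D) (hD : D ⊆ gDom g A B) :
    MeasurableSet[m] (gMap g A B '' D) := by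
  rw [gMap_image D hD]
  exact MeasurableSet.iUnion fun n => hm.pre _ (hDm.inter (gC_meas hm hA hB n))

lemma gInv_meas {m : MeasurableSpace X} (hm : InvariantAlg G m) (hA : MeasurableSet[m] A)
    (hB : MeasurableSet[m] B) : Measurable[m, m] (gInv g A B) := by
  classical
  intro D hD
  have : gInv g A B ⁻¹' D = (⋃ n, (fun x => (g n)⁻¹ • x) ⁻¹' (D ∩ gC g A B n)) ∪
      ((⋃ n, (fun x => (g n)⁻¹ • x) ⁻¹' (gC g A B n))ᶜ ∩ D) := by
    ext y
    by_cases hx : ∃ n, (g n)⁻¹ • y ∈ gC g A B n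
    · obtain ⟨n, hn⟩ := hx
      have h1 : gInv g A B y = (g n)⁻¹ • y := by
        have := gInv_gMap g A B (mem_iUnion.2 ⟨n, hn⟩)
        rwa [gMap_of g A B hn, smul_inv_smul] at this
      simp only [mem_preimage, h1, mem_union, mem_iUnion, mem_inter_iff, mem_compl_iff]
      constructor
      · intro h; exact Or.inl ⟨n, h, hn⟩
      · rintro (⟨k, hk, h⟩ | ⟨h, -⟩)
        · rwa [gC_disj' g A B hn h (by simp)]
        · exact absurd ⟨n, hn⟩ h
    · have h2 : gInv g A B y = y := by unfold gInv; rw [dif_neg hx]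
      simp only [mem_preimage, h2, mem_union, mem_iUnion, mem_inter_iff, mem_compl_iff]
      constructor
      · intro h; exact Or.inr ⟨hx, h⟩
      · rintro (⟨k, hk, h⟩ | h)
        · exact absurd ⟨k, h⟩ hx
        · exact h.2
  rw [this]
  exact (MeasurableSet.iUnion fun n => hm.pre _ (hD.inter (gC_meas hm hA hB n))).union
    ((MeasurableSet.iUnion fun n => hm.pre _ (gC_meas hm hA hB n)).compl.inter hD)

lemma gMap_measure_image [mX : MeasurableSpace X] {ν : Measure X}
    (hp : IsPmp G ν) (hA : MeasurableSet A) (hB : MeasurableSet B) {D : Set X}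
    (hDm : MeasurableSet D) (hD : D ⊆ gDom g A B) : ν (gMap g A B '' D) = ν D := by
  have hC := gC_meas (g := g) hp.inv hA hB
  rw [gMap_image D hD, measure_iUnion]
  · have : D = ⋃ n, D ∩ gC g A B n := by rw [← inter_iUnion]; exact (inter_eq_left.2 hD).symm
    conv_rhs => rw [this]
    rw [measure_iUnion]
    · exact tsum_congr fun n => hp.measure_pre _ (hDm.inter (hC n))
    · intro m n hmn
      refine disjoint_left.2 fun x h1 h2 => hmn (gC_disj g A B h1.2 h2.2)
    · exact fun n => hDm.inter (hC n)
  · intro m n hmn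
    refine disjoint_left.2 fun x h1 h2 => hmn (gC_disj' g A B h1.2 h2.2 (by simp))
  · exact fun n => hp.meas _ (hDm.inter (hC n))

/-- the greedy matching matches almost all of the smaller set -/
lemma gDom_conull [mX : MeasurableSpace X] {ν : Measure X} [IsProbabilityMeasure ν]
    (hp : IsPmp G ν) (he : IsErgodicInv G ν) (hg : Surjective g)
    (hA : MeasurableSet A) (hB : MeasurableSet B) (hAB : ν A ≤ ν B) :
    ν (A \ gDom g A B) = 0 := by
  have hDm := gDom_meas (g := g) hp.inv hA hB
  have him := gMap_measure_image hp hA hB hDm (subset_rfl : gDom g A B ⊆ gDom g A B)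
  have himm := gMap_image_meas (g := g) hp.inv hA hB hDm (subset_rfl : gDom g A B ⊆ gDom g A B)
  have hsub : gMap g A B '' gDom g A B ⊆ B := (gMap_maps g A B).image_subset
  by_contra hne
  have hAm : MeasurableSet (A \ gDom g A B) := hA.diff hDm
  have hBr : ν (B \ gMap g A B '' gDom g A B) ≠ 0 := by
    rw [measure_sdiff hsub himm.nullMeasurableSet (measure_ne_top _ _), him]
    intro h0
    apply hne
    rw [measure_sdiff (gDom_sub g A B) hDm.nullMeasurableSet (measure_ne_top _ _)]
    exact le_antisymm ((tsub_le_tsub_right hAB _).trans h0.le) (zero_le)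
  have h1 := erg_cover hp he hg (hB.diff himm) hBr
  apply hne
  refine measure_mono_null ?_ h1
  intro x hx n hn
  apply hx.2
  have hxA : ∀ k, x ∈ (gRem g A B k).1 := by
    intro k
    induction k with
    | zero => exact hx.1
    | succ k ih =>
      refine ⟨ih, fun h => hx.2 (mem_iUnion.2 ⟨k, ih, h⟩)⟩
  have hnB : ∀ k, g n • x ∈ (gRem g A B k).2 := by
    intro k
    induction k with
    | zero => exact hn.1
    | succ k ih =>
      refine ⟨ih, fun h => hn.2 ?_⟩
      have : (g k)⁻¹ • g n • x ∈ gC g A B k := ⟨h, by simpa using ih⟩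
      exact ⟨_, mem_iUnion.2 ⟨k, this⟩, by rw [gMap_of g A B this]; simp⟩
  exact mem_iUnion.2 ⟨n, hxA n, hnB n⟩

end Greedy

open MeasureTheory Set Function
open scoped ENNReal symmDiff

section Multi
variable {G X : Type*} [Group G] [MulAction G X] (g : ℕ → G) (A : ℕ → Set X) (B : Set X)

/-- part of the target used by the first `j` matchings -/
noncomputable def mUsed : ℕ → Set X
  | 0 => ∅
  | j + 1 => mUsed j ∪ gMap g (A j) (B \ mUsed j) '' gDom g (A j) (B \ mUsed j)

def mDom (j : ℕ) : Set X := gDom g (A j) (B \ mUsed g A B j)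
noncomputable def mMap (j : ℕ) : X → X := gMap g (A j) (B \ mUsed g A B j)
noncomputable def mInv (j : ℕ) : X → X := gInv g (A j) (B \ mUsed g A B j)

lemma mUsed_mono {i j : ℕ} (h : i ≤ j) : mUsed g A B i ⊆ mUsed g A B j := by
  induction j, h using Nat.le_induction with
  | base => exact subset_rfl
  | succ n _ ih => exact ih.trans subset_union_left

lemma mDom_sub (j : ℕ) : mDom g A B j ⊆ A j := gDom_sub _ _ _

lemma mMap_mem {j : ℕ} {x : X} (hx : x ∈ mDom g A B j) : mMap g A B j x ∈ B :=
  (gMap_maps _ _ _ hx).1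

lemma mMap_notMem {j : ℕ} {x : X} (hx : x ∈ mDom g A B j) :
    mMap g A B j x ∉ mUsed g A B j := (gMap_maps _ _ _ hx).2

lemma mMap_used {j : ℕ} {x : X} (hx : x ∈ mDom g A B j) :
    mMap g A B j x ∈ mUsed g A B (j + 1) := Or.inr ⟨x, hx, rfl⟩

lemma mUsed_iff {j : ℕ} {y : X} : y ∈ mUsed g A B j ↔
    ∃ i < j, ∃ x ∈ mDom g A B i, mMap g A B i x = y := by
  induction j with
  | zero => simp [mUsed]
  | succ j ih =>
    simp only [mUsed, mem_union, ih]
    constructor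
    · rintro (⟨i, hi, h⟩ | ⟨x, hx, h⟩)
      · exact ⟨i, by omega, h⟩
      · exact ⟨j, by omega, x, hx, h⟩
    · rintro ⟨i, hi, x, hx, h⟩
      rcases Nat.lt_succ_iff_lt_or_eq.1 hi with h1 | rfl
      · exact Or.inl ⟨i, h1, x, hx, h⟩
      · exact Or.inr ⟨x, hx, h⟩

lemma mUsed_sub (j : ℕ) : mUsed g A B j ⊆ B := by
  intro y hy
  obtain ⟨i, -, x, hx, rfl⟩ := (mUsed_iff g A B).1 hy
  exact mMap_mem g A B hx

lemma mMap_disj {i j : ℕ} {x y : X} (hx : x ∈ mDom g A B i) (hy : y ∈ mDom g A B j)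
    (h : mMap g A B i x = mMap g A B j y) : i = j ∧ x = y := by
  have key : i = j := by
    rcases lt_trichotomy i j with h1 | h1 | h1
    · exact absurd (mUsed_mono g A B (Nat.succ_le_of_lt h1) (mMap_used g A B hx))
        (h ▸ mMap_notMem g A B hy)
    · exact h1
    · exact absurd (mUsed_mono g A B (Nat.succ_le_of_lt h1) (mMap_used g A B hy))
        (h ▸ mMap_notMem g A B hx)
  subst key
  exact ⟨rfl, gMap_injOn _ _ _ hx hy h⟩

lemma mInv_mMap {j : ℕ} {x : X} (hx : x ∈ mDom g A B j) :
    mInv g A B j (mMap g A B j x) = x := gInv_gMap _ _ _ hx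

variable {g A B}

lemma mUsed_meas {m : MeasurableSpace X} (hm : InvariantAlg G m) (j : ℕ)
    (hA : ∀ i < j, MeasurableSet[m] (A i)) (hB : MeasurableSet[m] B) :
    MeasurableSet[m] (mUsed g A B j) := by
  induction j with
  | zero => exact MeasurableSet.empty
  | succ j ih =>
    have h1 := ih fun i hi => hA i (by omega)
    refine h1.union (gMap_image_meas hm (hA j (by omega)) (hB.diff h1)
      (gDom_meas hm (hA j (by omega)) (hB.diff h1)) subset_rfl)

lemma mDom_meas {m : MeasurableSpace X} (hm : InvariantAlg G m) (j : ℕ)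
    (hA : ∀ i ≤ j, MeasurableSet[m] (A i)) (hB : MeasurableSet[m] B) :
    MeasurableSet[m] (mDom g A B j) :=
  gDom_meas hm (hA j le_rfl) (hB.diff (mUsed_meas hm j (fun i hi => hA i hi.le) hB))

lemma mMap_meas {m : MeasurableSpace X} (hm : InvariantAlg G m) (j : ℕ)
    (hA : ∀ i ≤ j, MeasurableSet[m] (A i)) (hB : MeasurableSet[m] B) :
    Measurable[m, m] (mMap g A B j) :=
  gMap_meas hm (hA j le_rfl) (hB.diff (mUsed_meas hm j (fun i hi => hA i hi.le) hB))

lemma mInv_meas {m : MeasurableSpace X} (hm : InvariantAlg G m) (j : ℕ)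
    (hA : ∀ i ≤ j, MeasurableSet[m] (A i)) (hB : MeasurableSet[m] B) :
    Measurable[m, m] (mInv g A B j) :=
  gInv_meas hm (hA j le_rfl) (hB.diff (mUsed_meas hm j (fun i hi => hA i hi.le) hB))

lemma mImg_meas {m : MeasurableSpace X} (hm : InvariantAlg G m) (j : ℕ)
    (hA : ∀ i ≤ j, MeasurableSet[m] (A i)) (hB : MeasurableSet[m] B) {D : Set X}
    (hD : MeasurableSet[m] D) (hDs : D ⊆ mDom g A B j) :
    MeasurableSet[m] (mMap g A B j '' D) :=
  gMap_image_meas hm (hA j le_rfl) (hB.diff (mUsed_meas hm j (fun i hi => hA i hi.le) hB)) hD hDs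

lemma mMap_measure_image [mX : MeasurableSpace X] {ν : Measure X} (hp : IsPmp G ν)
    (hA : ∀ i, MeasurableSet (A i)) (hB : MeasurableSet B) (j : ℕ) {D : Set X}
    (hD : MeasurableSet D) (hDs : D ⊆ mDom g A B j) :
    ν (mMap g A B j '' D) = ν D :=
  gMap_measure_image hp (hA j) (hB.diff (mUsed_meas hp.inv j (fun i _ => hA i) hB)) hD hDs

lemma mUsed_measure [mX : MeasurableSpace X] {ν : Measure X} (hp : IsPmp G ν)
    (hA : ∀ i, MeasurableSet (A i)) (hB : MeasurableSet B) (j : ℕ) :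
    ν (mUsed g A B j) ≤ ∑ i ∈ Finset.range j, ν (A i) := by
  induction j with
  | zero => simp [mUsed]
  | succ j ih =>
    rw [Finset.sum_range_succ]
    refine (measure_union_le _ _).trans (add_le_add ih ?_)
    have := mMap_measure_image (g := g) hp hA hB j (mDom_meas hp.inv j (fun i _ => hA i) hB)
      subset_rfl
    exact this.le.trans (measure_mono (mDom_sub _ _ _ _))

lemma mDom_conull [mX : MeasurableSpace X] {ν : Measure X} [IsProbabilityMeasure ν]
    (hp : IsPmp G ν) (he : IsErgodicInv G ν) (hg : Surjective g)
    (hA : ∀ i, MeasurableSet (A i)) (hB : MeasurableSet B) (j : ℕ)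
    (h : ∑ i ∈ Finset.range (j + 1), ν (A i) ≤ ν B) : ν (A j \ mDom g A B j) = 0 := by
  have hU := mUsed_meas (g := g) hp.inv j (fun i _ => hA i) hB
  refine gDom_conull hp he hg (hA j) (hB.diff hU) ?_
  rw [measure_sdiff (mUsed_sub _ _ _ _) hU.nullMeasurableSet (measure_ne_top _ _)]
  refine ENNReal.le_sub_of_add_le_left (measure_ne_top _ _) ?_
  rw [Finset.sum_range_succ] at h
  exact (add_le_add_left (mUsed_measure hp hA hB j) _).trans h

end Multi

open MeasureTheory Set Function Filter Topology
open scoped ENNReal symmDiff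

section NonAtomic
variable {X : Type*} [mX : MeasurableSpace X] [StandardBorelSpace X]

noncomputable def hX (X : Type*) [MeasurableSpace X] [StandardBorelSpace X] : X → ℝ :=
  embeddingReal X

lemma hX_emb : MeasurableEmbedding (hX X) := measurableEmbedding_embeddingReal X

/-- slices of a set by a real coordinate -/
noncomputable def slice (A : Set X) (t : ℝ) : Set X := A ∩ hX X ⁻¹' Iic t

lemma slice_meas {A : Set X} (hA : MeasurableSet A) (t : ℝ) : MeasurableSet (slice A t) :=
  hA.inter (hX_emb.measurable measurableSet_Iic)

lemma slice_mono {A : Set X} {s t : ℝ} (h : s ≤ t) : slice A s ⊆ slice A t :=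
  inter_subset_inter_right _ (preimage_mono (Iic_subset_Iic.2 h))

variable {ν : Measure X} [IsProbabilityMeasure ν]

lemma slice_top {A : Set X} (hA : MeasurableSet A) :
    Tendsto (fun t => ν (slice A t)) atTop (𝓝 (ν A)) := by
  have h : ⋃ t : ℝ, slice A t = A := by
    ext x; simp only [slice, mem_iUnion, mem_inter_iff, mem_preimage, mem_Iic]
    exact ⟨fun ⟨_, h, _⟩ => h, fun h => ⟨_, h, le_rfl⟩⟩
  have := tendsto_measure_iUnion_atTop (μ := ν) (s := slice A) (fun s t h => slice_mono h)
  rwa [h] at this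

lemma slice_bot {A : Set X} (hA : MeasurableSet A) :
    Tendsto (fun t => ν (slice A t)) atBot (𝓝 0) := by
  have h : ⋂ t : ℝ, slice A t = ∅ := by
    ext x; simp only [slice, mem_iInter, mem_inter_iff, mem_preimage, mem_Iic, mem_empty_iff_false,
      iff_false, not_forall]
    refine ⟨hX X x - 1, fun h => ?_⟩
    linarith [h.2]
  have := tendsto_measure_iInter_atBot (μ := ν) (s := slice A)
    (fun t => (slice_meas hA t).nullMeasurableSet) (fun s t h => slice_mono h)
    ⟨0, measure_ne_top _ _⟩
  rwa [h, measure_empty] at this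

lemma slice_cont [NullSingletonClass ν] {A : Set X} (hA : MeasurableSet A) :
    Continuous (fun t => (ν (slice A t)).toReal) := by
  let ρ := (ν.restrict A).map (hX X)
  have hm := (hX_emb (X := X)).measurable
  haveI : IsFiniteMeasure ρ := by dsimp only [ρ]; infer_instance
  haveI : NullSingletonClass ρ := by
    refine ⟨fun y => ?_⟩
    dsimp only [ρ]
    rw [Measure.map_apply hm (measurableSet_singleton y)]
    refine Set.Subsingleton.measure_zero ?_ _
    exact (subsingleton_singleton).preimage hX_emb.injective
  have hρ : ∀ t, ρ (Iic t) = ν (slice A t) := by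
    intro t
    dsimp only [ρ]
    rw [Measure.map_apply hm measurableSet_Iic, Measure.restrict_apply (hm measurableSet_Iic),
      inter_comm]; rfl
  have key : ∀ t, (ν (slice A t)).toReal = ρ.real (Iic 0) + ∫ x in (0:ℝ)..t, (1:ℝ) ∂ρ := by
    intro t
    have h1 : ∫ x in (0:ℝ)..t, (1:ℝ) ∂ρ = ρ.real (Iic t) - ρ.real (Iic 0) := by
      have := intervalIntegral.integral_Iic_sub_Iic (μ := ρ) (f := fun _ => (1:ℝ)) (a := 0) (b := t)
        (integrable_const _).integrableOn (integrable_const _).integrableOn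
      rw [← this]; simp
    rw [h1, ← hρ]; simp [Measure.real]
  simp_rw [key]
  exact continuous_const.add (intervalIntegral.continuous_primitive
    (fun a b => intervalIntegrable_const) 0)

lemma exists_sub_measure [NullSingletonClass ν] {A : Set X} (hA : MeasurableSet A) {t : ℝ≥0∞}
    (ht : t ≤ ν A) : ∃ D ⊆ A, MeasurableSet D ∧ ν D = t := by
  rcases eq_or_lt_of_le ht with h | h
  · exact ⟨A, subset_rfl, hA, h.symm⟩
  rcases eq_or_ne t 0 with h0 | h0
  · exact ⟨∅, empty_subset _, MeasurableSet.empty, by simp [h0]⟩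
  have h1 : ∃ s, t.toReal ≤ (ν (slice A s)).toReal := by
    obtain ⟨s, hs⟩ := ((slice_top (ν := ν) hA).eventually_const_lt h).exists
    exact ⟨s, ENNReal.toReal_mono (measure_ne_top _ _) hs.le⟩
  have h2 : ∃ s, (ν (slice A s)).toReal ≤ t.toReal := by
    obtain ⟨s, hs⟩ := ((slice_bot (ν := ν) hA).eventually_lt_const (pos_iff_ne_zero.2 h0)).exists
    exact ⟨s, ENNReal.toReal_mono (ne_top_of_lt h) hs.le⟩
  obtain ⟨s, hs⟩ := mem_range_of_exists_le_of_exists_ge (slice_cont (ν := ν) hA) h2 h1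
  exact ⟨slice A s, inter_subset_left, slice_meas hA s,
    (ENNReal.toReal_eq_toReal_iff' (measure_ne_top _ _) (ne_top_of_lt h)).1 hs⟩

/-- complete a partially defined labelling to one with prescribed law -/
lemma exists_fill [NullSingletonClass ν] {R : Set X} (hR : MeasurableSet R) {α₀ : X → ℕ}
    (hα : Measurable α₀) {P : ℕ → ℝ≥0∞} (hP : ∑' i, P i = 1)
    (hle : ∀ i, ν (R ∩ α₀ ⁻¹' {i}) ≤ P i) :
    ∃ α : X → ℕ, Measurable α ∧ (∀ x ∈ R, α x = α₀ x) ∧ ∀ i, ν (α ⁻¹' {i}) = P i := by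
  classical
  set u : ℕ → ℝ≥0∞ := fun i => ν (R ∩ α₀ ⁻¹' {i}) with hu
  have hmi : ∀ i, MeasurableSet (R ∩ α₀ ⁻¹' {i}) := fun i => hR.inter (hα (by measurability))
  have hus : ∑' i, u i = ν R := by
    rw [hu, ← measure_iUnion]
    · congr 1; ext x; simp
    · intro i j hij
      refine disjoint_left.2 fun x h1 h2 => hij ?_
      exact h1.2.symm.trans h2.2
    · exact hmi
  set r : ℕ → ℝ≥0∞ := fun i => P i - u i with hr
  have hrs : ∑' i, r i = ν Rᶜ := by
    rw [hr, ENNReal.tsum_sub (by rw [hus]; exact measure_ne_top _ _) hle, hP, hus,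
      prob_compl_eq_one_sub hR]
  have hsum : ∀ i, ∑ j ∈ Finset.range i, r j ≤ ν Rᶜ := fun i => hrs ▸ ENNReal.sum_le_tsum _
  have hstep : ∀ (i : ℕ) (U : {U : Set X // MeasurableSet U ∧ U ⊆ Rᶜ ∧
      ν U = ∑ j ∈ Finset.range i, r j}), ∃ U' : {U : Set X // MeasurableSet U ∧ U ⊆ Rᶜ ∧
      ν U = ∑ j ∈ Finset.range (i+1), r j}, (U : Set X) ⊆ U' := by
    rintro i ⟨U, hU, hUR, hUν⟩
    have hle2 : r i ≤ ν (Rᶜ \ U) := by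
      rw [measure_sdiff hUR hU.nullMeasurableSet (measure_ne_top _ _), hUν]
      refine ENNReal.le_sub_of_add_le_left (by rw [← hUν]; exact measure_ne_top _ _) ?_
      rw [← Finset.sum_range_succ]; exact hsum _
    obtain ⟨D, hD, hDm, hDν⟩ := exists_sub_measure (hR.compl.diff hU) hle2
    refine ⟨⟨U ∪ D, hU.union hDm, union_subset hUR (hD.trans sdiff_subset), ?_⟩,
      subset_union_left⟩
    rw [measure_union (disjoint_left.2 fun x h1 h2 => (hD h2).2 h1) hDm, hUν, hDν,
      Finset.sum_range_succ]
  choose nxt hnxt using hstep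
  let U : (i : ℕ) → {U : Set X // MeasurableSet U ∧ U ⊆ Rᶜ ∧ ν U = ∑ j ∈ Finset.range i, r j} :=
    fun i => Nat.rec ⟨∅, MeasurableSet.empty, empty_subset _, by simp⟩ (fun i V => nxt i V) i
  have hUs : ∀ i, (U i).1 ⊆ (U (i+1)).1 := fun i => by exact hnxt i (U i)
  have hUmono : Monotone (fun i => (U i).1) := monotone_nat_of_le_succ hUs
  have hU0 : (U 0).1 = ∅ := rfl
  -- the pieces
  let Dp : ℕ → Set X := fun i => (U (i+1)).1 \ (U i).1
  have hDm : ∀ i, MeasurableSet (Dp i) := fun i => (U (i+1)).2.1.diff (U i).2.1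
  have hDν : ∀ i, ν (Dp i) = r i := by
    intro i
    dsimp only [Dp]
    rw [measure_sdiff (hUs i) (U i).2.1.nullMeasurableSet (measure_ne_top _ _), (U (i+1)).2.2.2,
      (U i).2.2.2, Finset.sum_range_succ]
    refine ENNReal.add_sub_cancel_left ?_
    rw [← (U i).2.2.2]; exact measure_ne_top _ _
  have hDdis : Pairwise (Disjoint on Dp) := by
    intro i j hij
    wlog h : i < j generalizing i j
    · exact (this hij.symm (lt_of_le_of_ne (not_lt.1 h) hij.symm)).symm
    exact disjoint_left.2 fun x h1 h2 => h2.2 (hUmono (Nat.succ_le_of_lt h) h1.1)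
  have hDu : ν (⋃ i, Dp i) = ν Rᶜ := by
    rw [measure_iUnion hDdis hDm]; simp_rw [hDν]; exact hrs
  have hDR : (⋃ i, Dp i) ⊆ Rᶜ := iUnion_subset fun i => sdiff_subset.trans (U (i+1)).2.2.1
  have hnull : ν (Rᶜ \ ⋃ i, Dp i) = 0 := by
    rw [measure_sdiff hDR (MeasurableSet.iUnion hDm).nullMeasurableSet (measure_ne_top _ _), hDu,
      tsub_self]
  let α : X → ℕ := fun x => if x ∈ R then α₀ x else
    if h : ∃ i, x ∈ Dp i then Nat.find h else 0
  have hα1 : ∀ x ∈ R, α x = α₀ x := fun x hx => if_pos hx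
  have hα2 : ∀ i, ∀ x ∈ Dp i, α x = i := by
    intro i x hx
    have hxR : x ∉ R := hDR (mem_iUnion.2 ⟨i, hx⟩)
    have hex : ∃ i, x ∈ Dp i := ⟨i, hx⟩
    dsimp only [α]
    rw [if_neg hxR, dif_pos hex]
    by_contra hne
    exact disjoint_left.1 (hDdis hne) (Nat.find_spec hex) hx
  have hα3 : ∀ x, x ∉ R → x ∉ ⋃ i, Dp i → α x = 0 := by
    intro x hx h
    dsimp only [α]
    rw [if_neg hx, dif_neg (by simpa using h)]
  have hpre : ∀ i, α ⁻¹' {i} = (R ∩ α₀ ⁻¹' {i}) ∪ Dp i ∪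
      (if i = 0 then Rᶜ \ ⋃ i, Dp i else ∅) := by
    intro i
    ext x
    by_cases hx : x ∈ R
    · have h1 : x ∉ Dp i := fun h => hDR (mem_iUnion.2 ⟨i, h⟩) hx
      have h2 : x ∉ (if i = 0 then Rᶜ \ ⋃ i, Dp i else ∅) := by
        split_ifs
        · exact fun h => h.1 hx
        · exact fun h => h
      simp [hα1 x hx, hx, h1, h2]
    · by_cases hxD : ∃ j, x ∈ Dp j
      · obtain ⟨j, hj⟩ := hxD
        have h2 : x ∉ (if i = 0 then Rᶜ \ ⋃ i, Dp i else ∅) := by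
          split_ifs
          · exact fun h => h.2 (mem_iUnion.2 ⟨j, hj⟩)
          · exact fun h => h
        simp only [mem_preimage, hα2 j x hj, mem_singleton_iff, mem_union, mem_inter_iff, hx,
          false_and, false_or, h2, or_false]
        constructor
        · rintro rfl; exact hj
        · intro h
          by_contra hne
          exact disjoint_left.1 (hDdis hne) hj h
      · have h3 : x ∉ ⋃ i, Dp i := by simpa using hxD
        have h4 : x ∉ Dp i := fun h => hxD ⟨i, h⟩
        simp only [mem_preimage, hα3 x hx h3, mem_singleton_iff, mem_union, mem_inter_iff, hx,
          false_and, h4, or_false, false_or]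
        split_ifs with h
        · simp only [h, true_iff]; exact ⟨hx, h3⟩
        · simp [Ne.symm h]
  refine ⟨α, ?_, hα1, ?_⟩
  · refine measurable_to_countable' fun i => ?_
    rw [hpre]
    refine ((hmi i).union (hDm i)).union ?_
    split_ifs
    · exact hR.compl.diff (MeasurableSet.iUnion hDm)
    · exact MeasurableSet.empty
  · intro i
    rw [hpre]
    have h0 : ν (if i = 0 then Rᶜ \ ⋃ i, Dp i else ∅) = 0 := by
      split_ifs
      · exact hnull
      · simp
    have hz : ∀ Y Z : Set X, ν Z = 0 → ν (Y ∪ Z) = ν Y := fun Y Z hZ =>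
      le_antisymm ((measure_union_le _ _).trans (by simp [hZ])) (measure_mono subset_union_left)
    rw [hz _ _ h0]
    rw [measure_union (disjoint_left.2 fun x h1 h2 => hDR (mem_iUnion.2 ⟨i, h2⟩) h1.1) (hDm i),
      hDν]
    exact add_tsub_cancel_of_le (hle i)

end NonAtomic

open MeasureTheory Set Function Filter Topology
open scoped ENNReal symmDiff

section Marker
variable {G X : Type*} [Group G] [MulAction G X]

def spread (g : ℕ → G) (K : ℕ) (M : Set X) : Set X := {y | ∃ l < K, (g l)⁻¹ • y ∈ M}
def coreS (g : ℕ → G) (K : ℕ) (V : Set X) : Set X := {x | ∀ l < K, g l • x ∈ V}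

lemma spread_meas {m : MeasurableSpace X} (hm : InvariantAlg G m) (g : ℕ → G) (K : ℕ) {M : Set X}
    (hM : MeasurableSet[m] M) : MeasurableSet[m] (spread g K M) := by
  have : spread g K M = ⋃ l : Fin K, (fun y => (g l)⁻¹ • y) ⁻¹' M := by
    ext y; simp [spread, Fin.exists_iff]
  rw [this]
  exact MeasurableSet.iUnion fun l => hm.pre _ hM

lemma coreS_meas {m : MeasurableSpace X} (hm : InvariantAlg G m) (g : ℕ → G) (K : ℕ) {V : Set X}
    (hV : MeasurableSet[m] V) : MeasurableSet[m] (coreS g K V) := by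
  have : coreS g K V = ⋂ l : Fin K, (fun y => (g l) • y) ⁻¹' V := by
    ext y; simp [coreS, Fin.forall_iff]
  rw [this]
  exact MeasurableSet.iInter fun l => hm.pre _ hV

lemma coreS_anti (g : ℕ → G) {K L : ℕ} (h : K ≤ L) (V : Set X) : coreS g L V ⊆ coreS g K V :=
  fun _ hx l hl => hx l (hl.trans_le h)

lemma sub_coreS_spread (g : ℕ → G) (K : ℕ) (M : Set X) : M ⊆ coreS g K (spread g K M) :=
  fun x hx l hl => ⟨l, hl, by simpa using hx⟩

lemma spread_mono (g : ℕ → G) (K : ℕ) {M M' : Set X} (h : M ⊆ M') :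
    spread g K M ⊆ spread g K M' := fun _ ⟨l, hl, hx⟩ => ⟨l, hl, h hx⟩

lemma spread_coreS (g : ℕ → G) (K : ℕ) (V : Set X) : spread g K (coreS g K V) ⊆ V := by
  rintro y ⟨l, hl, hy⟩
  simpa using hy l hl

variable [mX : MeasurableSpace X] {ν : Measure X} [IsProbabilityMeasure ν]

lemma spread_measure (hp : IsPmp G ν) (g : ℕ → G) (K : ℕ) {M : Set X} (hM : MeasurableSet M) :
    ν (spread g K M) ≤ K * ν M := by
  have : spread g K M = ⋃ l : Fin K, (fun y => (g l)⁻¹ • y) ⁻¹' M := by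
    ext y; simp [spread, Fin.exists_iff]
  rw [this]
  refine (measure_iUnion_fintype_le _ _).trans ?_
  simp [hp.measure_pre _ hM]

lemma coreS_tendsto (hp : IsPmp G ν) (he : IsErgodicInv G ν) {g : ℕ → G} (hg : Surjective g)
    {V : Set X} (hV : MeasurableSet V) (h : ν Vᶜ ≠ 0) :
    Tendsto (fun k => ν (coreS g k V)) atTop (𝓝 0) := by
  have h1 := erg_cover hp he hg hV.compl h
  have h2 : ⋂ k, coreS g k V = {x | ∀ n, g n • x ∉ Vᶜ} := by
    ext x
    simp only [coreS, mem_iInter, mem_setOf_eq, mem_compl_iff, not_not]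
    exact ⟨fun h n => h (n+1) n (by omega), fun h _ n _ => h n⟩
  have := tendsto_measure_iInter_atTop (μ := ν) (s := fun k => coreS g k V)
    (fun k => (coreS_meas hp.inv g k hV).nullMeasurableSet) (fun i j h => coreS_anti g h V)
    ⟨0, measure_ne_top _ _⟩
  rwa [h2, h1] at this

variable [StandardBorelSpace X] [NullSingletonClass ν]

lemma exists_syndetic (hp : IsPmp G ν) (he : IsErgodicInv G ν) {g : ℕ → G} (hg : Surjective g)
    (hg0 : g 0 = 1) {ε : ℝ≥0∞} (hε : ε ≠ 0) :
    ∃ (S : Set X) (k : ℕ), MeasurableSet S ∧ ν S ≤ ε ∧ 0 < k ∧ ∀ x, ∃ l < k, g l • x ∈ S := by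
  obtain ⟨S0, -, hS0, hS0ν⟩ := exists_sub_measure (ν := ν) (A := univ) MeasurableSet.univ
    (t := min (ε/2) 1) (by simp)
  have hpos : ν S0ᶜᶜ ≠ 0 := by
    rw [compl_compl, hS0ν]; simp [hε]
  have h1 := coreS_tendsto hp he hg hS0.compl hpos
  have h2 := h1.eventually_lt_const (show (0:ℝ≥0∞) < ε/2 by
    simpa [pos_iff_ne_zero] using hε)
  obtain ⟨k, hk, hk0⟩ := (h2.and (eventually_gt_atTop 0)).exists
  refine ⟨S0 ∪ coreS g k S0ᶜ, k, hS0.union (coreS_meas hp.inv g k hS0.compl), ?_, hk0, ?_⟩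
  · refine (measure_union_le _ _).trans ?_
    rw [hS0ν]
    exact (add_le_add (min_le_left _ _) hk.le).trans (ENNReal.add_halves ε).le
  · intro x
    by_cases hx : ∃ l < k, g l • x ∈ S0
    · obtain ⟨l, hl, h⟩ := hx
      exact ⟨l, hl, Or.inl h⟩
    · refine ⟨0, hk0, Or.inr ?_⟩
      rw [hg0, one_smul]
      intro l hl h
      exact hx ⟨l, hl, h⟩

lemma exists_V0 (hp : IsPmp G ν) (he : IsErgodicInv G ν) {g : ℕ → G} (hg : Surjective g)
    (hg0 : g 0 = 1) {k0 : ℕ} (hk0 : 0 < k0) :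
    ∃ (K : ℕ) (V0 : Set X), k0 ≤ K ∧ MeasurableSet V0 ∧ ν (coreS g K V0) ≠ 0 ∧
      ν (coreS g (K+1) V0) = 0 := by
  have hk0' : (k0 : ℝ≥0∞) ≠ 0 := by simpa using hk0.ne'
  obtain ⟨M, -, hM, hMν⟩ := exists_sub_measure (ν := ν) (A := univ) MeasurableSet.univ
    (t := (2 * k0 : ℝ≥0∞)⁻¹) (by
      rw [measure_univ]
      refine ENNReal.inv_le_one.2 ?_
      exact_mod_cast (by omega : 1 ≤ 2 * k0))
  set V := spread g k0 M with hVdef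
  have hV : MeasurableSet V := spread_meas hp.inv g k0 hM
  have hVν : ν V ≤ 2⁻¹ := by
    refine (spread_measure hp g k0 hM).trans ?_
    rw [hMν, ENNReal.mul_inv (by simp) (by simp), mul_comm, mul_assoc,
      ENNReal.inv_mul_cancel hk0' (by simp), mul_one]
  have hVc : ν Vᶜ ≠ 0 := by
    rw [prob_compl_eq_one_sub hV]
    intro h
    have := tsub_eq_zero_iff_le.1 h
    have h2 := this.trans hVν
    simp at h2
  have hη : ν (coreS g k0 V) ≠ 0 := by
    intro h
    have := measure_mono_null (sub_coreS_spread g k0 M) h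
    rw [hMν] at this
    simp [ENNReal.mul_eq_top] at this
  have ht := coreS_tendsto hp he hg hV hVc
  have h2 := ht.eventually_lt_const (show (0:ℝ≥0∞) < ν (coreS g k0 V) / k0 by
    simpa [pos_iff_ne_zero] using hη)
  obtain ⟨k1, hk1, hk10⟩ := (h2.and (eventually_gt_atTop 0)).exists
  set B := coreS g k1 V with hBdef
  have hB : MeasurableSet B := coreS_meas hp.inv g k1 hV
  set V0 := V \ B with hV0
  have hV0m : MeasurableSet V0 := hV.diff hB
  have hpos : ν (coreS g k0 V0) ≠ 0 := by
    intro h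
    have hsub : coreS g k0 V ⊆ coreS g k0 V0 ∪ ⋃ l : Fin k0, (fun x => g l • x) ⁻¹' B := by
      intro x hx
      by_cases hx2 : ∃ l < k0, g l • x ∈ B
      · obtain ⟨l, hl, h⟩ := hx2
        exact Or.inr (mem_iUnion.2 ⟨⟨l, hl⟩, h⟩)
      · left
        intro l hl
        exact ⟨hx l hl, fun h => hx2 ⟨l, hl, h⟩⟩
    have h3 : ν (coreS g k0 V) ≤ k0 * ν B := by
      refine (measure_mono hsub).trans ((measure_union_le _ _).trans ?_)
      rw [h, zero_add]
      refine (measure_iUnion_fintype_le _ _).trans ?_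
      simp [hp.measure_pre _ hB]
    have h4 : (k0 : ℝ≥0∞) * ν B < ν (coreS g k0 V) := by
      rw [mul_comm]
      exact (ENNReal.lt_div_iff_mul_lt (Or.inl hk0') (Or.inl (by simp))).1 hk1
    exact absurd h3 (not_le.2 h4)
  have hemp : coreS g k1 V0 = ∅ := by
    ext x
    simp only [mem_empty_iff_false, iff_false]
    intro hx
    have h5 := (hx 0 hk10).2
    rw [hg0, one_smul] at h5
    exact h5 fun l hl => (hx l hl).1
  classical
  have hex : ∃ k, ν (coreS g k V0) = 0 := ⟨k1, by simp [hemp]⟩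
  have hfind := Nat.find_spec hex
  have hlt : k0 < Nat.find hex := by
    by_contra hh
    exact hpos (measure_mono_null (coreS_anti g (not_lt.1 hh) V0) hfind)
  refine ⟨Nat.find hex - 1, V0, by omega, hV0m, Nat.find_min hex (by omega), ?_⟩
  rw [Nat.sub_add_cancel (by omega)]
  exact hfind

lemma exists_tune (hp : IsPmp G ν) {g : ℕ → G}
    (hg0 : g 0 = 1) {K : ℕ} (hK : 0 < K) {V0 : Set X} (hV0 : MeasurableSet V0) {v : ℝ≥0∞}
    (hv0 : v ≠ 0) (hv : v < ν (coreS g K V0)) :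
    ∃ M : Set X, MeasurableSet M ∧ ν M = v ∧ coreS g K (spread g K M) = M ∧ spread g K M ⊆ V0 := by
  set M0 := coreS g K V0 with hM0
  have hM0m : MeasurableSet M0 := coreS_meas hp.inv g K hV0
  let V : ℝ → Set X := fun t => spread g K (slice M0 t)
  let M1 : ℝ → Set X := fun t => coreS g K (V t)
  have hVm : ∀ t, MeasurableSet (V t) := fun t => spread_meas hp.inv g K (slice_meas hM0m t)
  have hM1m : ∀ t, MeasurableSet (M1 t) := fun t => coreS_meas hp.inv g K (hVm t)
  have hVM : ∀ t, spread g K (M1 t) = V t := fun t =>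
    subset_antisymm (spread_coreS g K _) (spread_mono g K (sub_coreS_spread g K _))
  have hVV0 : ∀ t, V t ⊆ V0 := fun t =>
    (spread_mono g K inter_subset_left).trans (spread_coreS g K V0)
  have hlow : ∀ t, ν (slice M0 t) ≤ ν (M1 t) := fun t => measure_mono (sub_coreS_spread g K _)
  have hup : ∀ t, ν (M1 t) ≤ K * ν (slice M0 t) := by
    intro t
    refine (measure_mono (t := V t) ?_).trans (spread_measure hp g K (slice_meas hM0m t))
    intro x hx
    have := hx 0 hK
    rwa [hg0, one_smul] at this
  let f : ℝ → ℝ := fun t => (ν (M1 t)).toReal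
  let F : ℝ → ℝ := fun t => (ν (slice M0 t)).toReal
  have hFc : Continuous F := slice_cont hM0m
  have hmono : ∀ s t, s ≤ t → M1 s ⊆ M1 t := fun s t h x hx l hl =>
    spread_mono g K (slice_mono h) (hx l hl)
  have hdiff : ∀ s t, s ≤ t → f t - f s ≤ (K * K) * (F t - F s) := by
    intro s t hst
    have h1 : M1 t \ M1 s ⊆ ⋃ l : Fin K, (fun x => g l • x) ⁻¹'
        (spread g K (slice M0 t \ slice M0 s)) := by
      rintro x ⟨hx1, hx2⟩
      have : ∃ l < K, g l • x ∉ V s := by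
        by_contra hh
        push Not at hh
        exact hx2 hh
      obtain ⟨l, hl, hxl⟩ := this
      refine mem_iUnion.2 ⟨⟨l, hl⟩, ?_⟩
      obtain ⟨l', hl', h'⟩ := hx1 l hl
      exact ⟨l', hl', h', fun hh => hxl ⟨l', hl', hh⟩⟩
    have hd : MeasurableSet (slice M0 t \ slice M0 s) :=
      (slice_meas hM0m t).diff (slice_meas hM0m s)
    have h2 : ν (M1 t \ M1 s) ≤ K * (K * ν (slice M0 t \ slice M0 s)) := by
      refine (measure_mono h1).trans ((measure_iUnion_fintype_le _ _).trans ?_)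
      simp only [hp.measure_pre _ (spread_meas hp.inv g K hd), Finset.sum_const,
        Finset.card_univ, Fintype.card_fin, nsmul_eq_mul]
      gcongr
      exact spread_measure hp g K hd
    have h3 : (ν (M1 t \ M1 s)).toReal = f t - f s := by
      rw [measure_sdiff (hmono s t hst) (hM1m s).nullMeasurableSet (measure_ne_top _ _),
        ENNReal.toReal_sub_of_le (measure_mono (hmono s t hst)) (measure_ne_top _ _)]
    have h4 : (ν (slice M0 t \ slice M0 s)).toReal = F t - F s := by
      rw [measure_sdiff (slice_mono hst) (slice_meas hM0m s).nullMeasurableSet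
        (measure_ne_top _ _), ENNReal.toReal_sub_of_le (measure_mono (slice_mono hst))
        (measure_ne_top _ _)]
    rw [← h3, ← h4]
    have := ENNReal.toReal_mono (by finiteness) h2
    simpa [mul_assoc] using this
  have hnn : ∀ s t, s ≤ t → 0 ≤ f t - f s := fun s t h => sub_nonneg.2
    (ENNReal.toReal_mono (measure_ne_top _ _) (measure_mono (hmono s t h)))
  have hfc : Continuous f := by
    rw [continuous_iff_continuousAt]
    intro t0
    have h1 : Tendsto (fun t => (K * K : ℝ) * |F t - F t0|) (𝓝 t0) (𝓝 0) := by
      have : Continuous fun t => (K * K : ℝ) * |F t - F t0| := by fun_prop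
      have h := this.tendsto t0
      simpa using h
    refine tendsto_iff_norm_sub_tendsto_zero.2 (squeeze_zero (fun _ => norm_nonneg _) ?_ h1)
    intro t
    rw [Real.norm_eq_abs]
    rcases le_total t t0 with h | h
    · rw [abs_sub_comm, abs_of_nonneg (hnn _ _ h), abs_sub_comm]
      exact (hdiff _ _ h).trans (mul_le_mul_of_nonneg_left (le_abs_self _) (by positivity))
    · rw [abs_of_nonneg (hnn _ _ h)]
      exact (hdiff _ _ h).trans (mul_le_mul_of_nonneg_left (le_abs_self _) (by positivity))
  have h1 : ∃ s, v.toReal ≤ f s := by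
    obtain ⟨s, hs⟩ := ((slice_top (ν := ν) hM0m).eventually_const_lt hv).exists
    exact ⟨s, ENNReal.toReal_mono (measure_ne_top _ _) (hs.le.trans (hlow s))⟩
  have h2 : ∃ s, f s ≤ v.toReal := by
    have hK0 : (K : ℝ≥0∞) ≠ 0 := by simpa using hK.ne'
    have hpos : (0:ℝ≥0∞) < v / K := by simpa [pos_iff_ne_zero] using hv0
    obtain ⟨s, hs⟩ := ((slice_bot (ν := ν) hM0m).eventually_lt_const hpos).exists
    refine ⟨s, ENNReal.toReal_mono (ne_top_of_lt hv) ((hup s).trans ?_)⟩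
    rw [mul_comm]
    exact (ENNReal.le_div_iff_mul_le (Or.inl hK0) (Or.inl (by simp))).1 hs.le
  obtain ⟨t, ht⟩ := mem_range_of_exists_le_of_exists_ge hfc h2 h1
  refine ⟨M1 t, hM1m t, (ENNReal.toReal_eq_toReal_iff' (measure_ne_top _ _)
    (ne_top_of_lt hv)).1 ht, ?_, ?_⟩
  · rw [hVM]
  · rw [hVM]; exact hVV0 t

end Marker

open MeasureTheory Set Function Filter Topology
open scoped ENNReal symmDiff

section Capacity

lemma logfact_lower (n : ℕ) : n * Real.log n - n ≤ Real.log (n.factorial) := by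
  induction n with
  | zero => simp
  | succ n ih =>
    rw [Nat.factorial_succ, Nat.cast_mul, Real.log_mul (by positivity) (by positivity)]
    rcases Nat.eq_zero_or_pos n with rfl | hn
    · simp
    have hn' : (0:ℝ) < n := by exact_mod_cast hn
    have h : Real.log ((n + 1 : ℝ) / n) ≤ (n + 1 : ℝ) / n - 1 :=
      Real.log_le_sub_one_of_pos (by positivity)
    rw [Real.log_div (by positivity) (by positivity)] at h
    have h2 : (n : ℝ) * ((n + 1 : ℝ) / n - 1) = 1 := by field_simp; ring
    have h3 := mul_le_mul_of_nonneg_left h hn'.le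
    rw [h2] at h3
    push_cast
    nlinarith

lemma logfact_upper (n : ℕ) : Real.log (n.factorial) ≤ n * Real.log n - n + (1 + Real.log (n + 1)) := by
  rcases Nat.eq_zero_or_pos n with rfl | hn
  · simp
  have key : Real.log (n.factorial) ≤ n * Real.log n - n + (1 + Real.log n) := by
    induction n, hn using Nat.le_induction with
    | base => simp
    | succ n hn ih =>
      rw [Nat.factorial_succ, Nat.cast_mul, Real.log_mul (by positivity) (by positivity)]
      have hn' : (0:ℝ) < n := by exact_mod_cast hn
      have h : Real.log ((n : ℝ) / (n + 1)) ≤ (n : ℝ) / (n + 1) - 1 :=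
        Real.log_le_sub_one_of_pos (by positivity)
      rw [Real.log_div (by positivity) (by positivity)] at h
      have h2 : (n + 1 : ℝ) * ((n : ℝ) / (n + 1) - 1) = -1 := by field_simp; ring
      have h3 := mul_le_mul_of_nonneg_left h (show (0:ℝ) ≤ n + 1 by positivity)
      rw [h2] at h3
      push_cast
      nlinarith
  have : Real.log n ≤ Real.log (n + 1) := Real.log_le_log (by exact_mod_cast hn) (by linarith)
  linarith

/-- words with prescribed letter counts -/
lemma exists_words {r : ℕ} (n : Fin r → ℕ) : ∃ 𝒰 : Finset (Fin (∑ i, n i) → ℕ),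
    (∀ u ∈ 𝒰, ∀ i : Fin r, (Finset.univ.filter fun j => u j = i).card = n i) ∧
    (∀ u ∈ 𝒰, ∀ i : ℕ, r ≤ i → (Finset.univ.filter fun j => u j = i).card = 0) ∧
    (∑ i, n i).factorial ≤ 𝒰.card * ∏ i, (n i).factorial := by
  classical
  let e := finSigmaFinEquiv (n := n)
  let w0 : Fin (∑ i, n i) → Fin r := fun j => (e.symm j).1
  have hw0 : ∀ i, (Finset.univ.filter fun j => w0 j = i).card = n i := by
    intro i
    have hinj : Injective fun k : Fin (n i) => e ⟨i, k⟩ := by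
      intro a b h
      have := e.injective h
      simpa using this
    have : (Finset.univ.filter fun j => w0 j = i) =
        (Finset.univ : Finset (Fin (n i))).image (fun k => e ⟨i, k⟩) := by
      ext j
      simp only [Finset.mem_filter, Finset.mem_univ, true_and, Finset.mem_image, w0]
      constructor
      · rintro rfl
        exact ⟨(e.symm j).2, by simp⟩
      · rintro ⟨k, rfl⟩; simp
    rw [this, Finset.card_image_of_injective _ hinj]; simp
  have hperm : ∀ (σ : Equiv.Perm (Fin (∑ i, n i))) (i : Fin r),
      (Finset.univ.filter fun j => w0 (σ j) = i).card = n i := by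
    intro σ i
    rw [← hw0 i]
    refine Finset.card_bij (fun j _ => σ j) ?_ ?_ ?_
    · intro a ha; simpa using ha
    · intro a _ b _ h; exact σ.injective h
    · intro b hb; exact ⟨σ.symm b, by simpa using hb, by simp⟩
  let 𝒱 : Finset (Fin (∑ i, n i) → Fin r) :=
    Finset.univ.image fun σ : Equiv.Perm (Fin (∑ i, n i)) => w0 ∘ σ
  have hcard : (∑ i, n i).factorial ≤ 𝒱.card * ∏ i, (n i).factorial := by
    have h1 : (Finset.univ : Finset (Equiv.Perm (Fin (∑ i, n i)))).card = (∑ i, n i).factorial := by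
      rw [Finset.card_univ, Fintype.card_perm, Fintype.card_fin]
    rw [← h1, mul_comm]
    refine Finset.card_le_mul_card_image _ _ ?_
    intro b hb
    obtain ⟨σ, -, rfl⟩ := Finset.mem_image.1 hb
    have h2 := DomMulAct.stabilizer_card w0
    have h3 : Fintype.card {τ : Equiv.Perm (Fin (∑ i, n i)) // w0 ∘ τ = w0}
        ≤ ∏ i, (n i).factorial := by
      rw [h2]
      refine le_of_eq (Finset.prod_congr rfl fun i _ => ?_)
      rw [Fintype.card_subtype, hw0]
    refine le_trans ?_ h3
    rw [← Fintype.card_coe]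
    refine Fintype.card_le_of_injective (fun τ => ⟨τ.1 * σ⁻¹, ?_⟩) ?_
    · have := (Finset.mem_filter.1 τ.2).2
      funext j
      have h4 := congrFun this (σ⁻¹ j)
      simpa using h4
    · intro τ τ' h
      have := congrArg Subtype.val h
      exact Subtype.ext (mul_right_cancel this)
  refine ⟨𝒱.image fun u j => (u j : ℕ), ?_, ?_, ?_⟩
  · intro u hu i
    obtain ⟨v, hv, rfl⟩ := Finset.mem_image.1 hu
    obtain ⟨σ, -, rfl⟩ := Finset.mem_image.1 hv
    rw [← hperm σ i]
    congr 1
    ext j; simp [Fin.ext_iff]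
  · intro u hu i hi
    obtain ⟨v, hv, rfl⟩ := Finset.mem_image.1 hu
    rw [Finset.card_eq_zero, Finset.filter_eq_empty_iff]
    intro j _ h
    have h2 := (v j).2
    have h3 : (v j : ℕ) = i := h
    omega
  · rw [Finset.card_image_of_injective]
    · exact hcard
    · intro u v h
      funext j
      exact Fin.ext (congrFun h j)

lemma exists_capacity {p : ℕ → ℝ} (hp0 : ∀ i, 0 ≤ p i) (hp1 : ∑' i, p i = 1) {h : ℝ≥0∞}
    (hh : h < ∑' i, ENNReal.ofReal (Real.negMulLog (p i))) :
    ∃ δ h' : ℝ, 0 < δ ∧ δ < 1 ∧ 0 < h' ∧ h < ENNReal.ofReal h' ∧ ∀ᶠ s : ℕ in atTop,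
      ∃ (ℓ : ℕ) (𝒰 : Finset (Fin ℓ → ℕ)), (ℓ : ℝ) ≤ (1 - δ) * s ∧
        (∀ u ∈ 𝒰, ∀ i, ((Finset.univ.filter fun j => u j = i).card : ℝ) ≤ (1 - δ) * p i * s) ∧
        Real.exp (s * h') ≤ 𝒰.card := by
  have hsum : Summable p := by
    by_contra hn
    rw [tsum_eq_zero_of_not_summable hn] at hp1
    exact zero_ne_one hp1
  have hple : ∀ i, p i ≤ 1 := fun i => hp1 ▸ hsum.le_tsum i (fun j _ => hp0 j)
  have hnl : ∀ i, 0 ≤ Real.negMulLog (p i) := fun i => Real.negMulLog_nonneg (hp0 i) (hple i)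
  obtain ⟨h1, hh1, hh1'⟩ := exists_between hh
  have hh1t : h1 ≠ ∞ := ne_top_of_lt hh1'
  have hh1p : 0 < h1.toReal := ENNReal.toReal_pos (ne_zero_of_lt hh1) hh1t
  -- choose r
  have hP : Tendsto (fun r => ∑ i ∈ Finset.range r, p i) atTop (𝓝 1) := by
    have := hsum.hasSum.tendsto_sum_nat
    rwa [hp1] at this
  have hPl : Tendsto (fun r => Real.negMulLog (∑ i ∈ Finset.range r, p i)) atTop (𝓝 0) := by
    have := (Real.continuous_negMulLog.tendsto 1).comp hP
    rw [Real.negMulLog_one] at this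
    exact this
  obtain ⟨h2, hh2, hh2'⟩ := exists_between hh1'
  have hh2t : h2 ≠ ∞ := ne_top_of_lt hh2'
  have hfin : ∀ᶠ r in atTop, h2.toReal < ∑ i ∈ Finset.range r, Real.negMulLog (p i) := by
    have ht := ENNReal.tendsto_nat_tsum (fun i => ENNReal.ofReal (Real.negMulLog (p i)))
    filter_upwards [ht.eventually_const_lt hh2'] with r hr
    rw [← ENNReal.ofReal_sum_of_nonneg (fun i _ => hnl i)] at hr
    exact (ENNReal.lt_ofReal_iff_toReal_lt hh2t).1 hr
  have h12 : 0 < h2.toReal - h1.toReal := by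
    have := (ENNReal.toReal_lt_toReal hh1t hh2t).2 hh2
    linarith
  obtain ⟨r, hr1, hr2⟩ := (hfin.and (hPl.eventually_lt_const h12)).exists
  -- choose δ
  let φ : ℝ → ℝ := fun c => (∑ i ∈ Finset.range r, Real.negMulLog (c * p i)) -
    Real.negMulLog (∑ i ∈ Finset.range r, c * p i)
  have hφ : Continuous φ := by
    dsimp only [φ]
    have := Real.continuous_negMulLog
    fun_prop
  have hφ1 : h1.toReal < φ 1 := by
    simp only [φ, one_mul]; linarith
  have hev : ∀ᶠ d in 𝓝[>] (0:ℝ), h1.toReal < φ (1 - d) := by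
    have : Tendsto (fun d : ℝ => φ (1 - d)) (𝓝[>] 0) (𝓝 (φ 1)) := by
      have h : Continuous fun d : ℝ => φ (1 - d) := hφ.comp (continuous_const.sub continuous_id)
      have := h.tendsto 0
      simp only [sub_zero] at this
      exact this.mono_left nhdsWithin_le_nhds
    exact this.eventually_const_lt hφ1
  have hev2 : ∀ᶠ d in 𝓝[>] (0:ℝ), d < 1 :=
    (eventually_lt_nhds one_pos).filter_mono nhdsWithin_le_nhds
  obtain ⟨δ, ⟨hδ1, hδ2⟩, hδ0⟩ := ((hev.and hev2).and self_mem_nhdsWithin).exists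
  have hδ0 : 0 < δ := hδ0
  refine ⟨δ, h1.toReal, hδ0, hδ2, hh1p, by rwa [ENNReal.ofReal_toReal hh1t], ?_⟩
  set θ : ℕ → ℝ := fun i => (1 - δ) * p i with hθ
  have hθ0 : ∀ i, 0 ≤ θ i := fun i => mul_nonneg (by linarith) (hp0 i)
  let n : ℕ → ℕ → ℕ := fun s i => ⌊θ i * s⌋₊
  let u : ℕ → ℕ → ℝ := fun s i => (n s i : ℝ) / s
  have hu : ∀ i, Tendsto (fun s => u s i) atTop (𝓝 (θ i)) := fun i =>
    (tendsto_nat_floor_mul_div_atTop (hθ0 i)).comp tendsto_natCast_atTop_atTop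
  let ψ : ℕ → ℝ := fun s => (∑ i ∈ Finset.range r, Real.negMulLog (u s i)) -
    Real.negMulLog (∑ i ∈ Finset.range r, u s i) - r * ((1 + Real.log (s + 1)) / s)
  have hψ : Tendsto ψ atTop (𝓝 (φ (1 - δ))) := by
    have e1 : Tendsto (fun s => ∑ i ∈ Finset.range r, Real.negMulLog (u s i)) atTop
        (𝓝 (∑ i ∈ Finset.range r, Real.negMulLog (θ i))) :=
      tendsto_finsetSum _ fun i _ => (Real.continuous_negMulLog.tendsto _).comp (hu i)
    have e2 : Tendsto (fun s => Real.negMulLog (∑ i ∈ Finset.range r, u s i)) atTop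
        (𝓝 (Real.negMulLog (∑ i ∈ Finset.range r, θ i))) :=
      (Real.continuous_negMulLog.tendsto _).comp (tendsto_finsetSum _ fun i _ => hu i)
    have e3 : Tendsto (fun s : ℕ => (r : ℝ) * ((1 + Real.log (s + 1)) / s)) atTop (𝓝 0) := by
      have a1 : Tendsto (fun x : ℝ => (1 + Real.log (x + 1)) / x) atTop (𝓝 0) := by
        have b1 : Tendsto (fun x : ℝ => Real.log x / x) atTop (𝓝 0) :=
          Real.isLittleO_log_id_atTop.tendsto_div_nhds_zero
        have b2 : Tendsto (fun x : ℝ => (1 : ℝ) / x) atTop (𝓝 0) :=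
          tendsto_const_nhds.div_atTop tendsto_id
        have b3 : Tendsto (fun x : ℝ => (1 + Real.log 2) * (1 / x) + Real.log x / x) atTop (𝓝 0) := by
          simpa using (b2.const_mul (1 + Real.log 2)).add b1
        refine squeeze_zero' ?_ ?_ b3
        · filter_upwards [eventually_ge_atTop 1] with x hx
          have : 0 ≤ Real.log (x + 1) := Real.log_nonneg (by linarith)
          positivity
        · filter_upwards [eventually_ge_atTop 1] with x hx
          have : Real.log (x + 1) ≤ Real.log 2 + Real.log x := by
            rw [← Real.log_mul (by norm_num) (by positivity)]
            exact Real.log_le_log (by positivity) (by linarith)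
          rw [mul_one_div, ← add_div]
          exact div_le_div_of_nonneg_right (by linarith) (by positivity)
      have := (a1.comp tendsto_natCast_atTop_atTop).const_mul (r : ℝ)
      simpa using this
    have := (e1.sub e2).sub e3
    simpa [φ, hθ] using this
  filter_upwards [hψ.eventually_const_lt hδ1, eventually_gt_atTop 0] with s hs hs0
  have hs0' : (0 : ℝ) < s := by exact_mod_cast hs0
  obtain ⟨N, hN, 𝒰, hU1, hU2, hU3⟩ : ∃ N, N = ∑ i : Fin r, n s i ∧
      ∃ 𝒰 : Finset (Fin N → ℕ),
      (∀ u ∈ 𝒰, ∀ i : Fin r, (Finset.univ.filter fun j => u j = i).card = n s i) ∧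
      (∀ u ∈ 𝒰, ∀ i : ℕ, r ≤ i → (Finset.univ.filter fun j => u j = i).card = 0) ∧
      N.factorial ≤ 𝒰.card * ∏ i : Fin r, (n s i).factorial :=
    ⟨_, rfl, exists_words (fun i : Fin r => n s i)⟩
  have hNr : N = ∑ i ∈ Finset.range r, n s i := by rw [hN, Finset.sum_range]
  have hfl : ∀ i, (n s i : ℝ) ≤ θ i * s := fun i => Nat.floor_le (mul_nonneg (hθ0 i) hs0'.le)
  have hNle : (N : ℝ) ≤ (1 - δ) * s := by
    rw [hNr]; push_cast
    calc ∑ i ∈ Finset.range r, (n s i : ℝ) ≤ ∑ i ∈ Finset.range r, θ i * s :=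
          Finset.sum_le_sum fun i _ => hfl i
      _ = ((1 - δ) * s) * ∑ i ∈ Finset.range r, p i := by
          rw [Finset.mul_sum]; refine Finset.sum_congr rfl fun i _ => ?_; simp only [hθ]; ring
      _ ≤ ((1 - δ) * s) * 1 := by
          refine mul_le_mul_of_nonneg_left ?_ (mul_nonneg (by linarith) hs0'.le)
          rw [← hp1]; exact hsum.sum_le_tsum _ fun i _ => hp0 i
      _ = _ := mul_one _
  refine ⟨N, 𝒰, hNle, ?_, ?_⟩
  · intro w hw i
    by_cases hi : i < r
    · rw [hU1 w hw ⟨i, hi⟩]; exact hfl i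
    · rw [hU2 w hw i (not_lt.1 hi)]
      simpa using mul_nonneg (hθ0 i) hs0'.le
  · have hU3' : ((N.factorial : ℕ) : ℝ) ≤ 𝒰.card * ∏ i : Fin r, ((n s i).factorial : ℝ) := by
      exact_mod_cast hU3
    have hprod : (0:ℝ) < ∏ i : Fin r, ((n s i).factorial : ℝ) :=
      Finset.prod_pos fun i _ => by positivity
    have hcpos : (0:ℝ) < 𝒰.card := by
      have : (0:ℝ) < N.factorial := by positivity
      exact pos_of_mul_pos_left (this.trans_le hU3') hprod.le
    rw [← Real.le_log_iff_exp_le hcpos]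
    have hlog : Real.log N.factorial ≤ Real.log 𝒰.card +
        ∑ i ∈ Finset.range r, Real.log ((n s i).factorial) := by
      have := Real.log_le_log (by positivity) hU3'
      rwa [Real.log_mul hcpos.ne' hprod.ne', Real.log_prod (fun i _ => by positivity),
        ← Finset.sum_range (fun i => Real.log ((n s i).factorial : ℝ))] at this
    have hlow := logfact_lower N
    have hup : ∑ i ∈ Finset.range r, Real.log ((n s i).factorial) ≤
        ∑ i ∈ Finset.range r, ((n s i) * Real.log (n s i) - (n s i) + (1 + Real.log (s + 1))) := by
      refine Finset.sum_le_sum fun i _ => (logfact_upper _).trans ?_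
      have : (n s i : ℝ) ≤ s := by
        refine (hfl i).trans ?_
        have : θ i ≤ 1 := by
          have := hple i
          have := hp0 i
          simp only [hθ]; nlinarith
        nlinarith
      have := Real.log_le_log (by positivity) (by linarith : (n s i : ℝ) + 1 ≤ s + 1)
      linarith
    -- n log n = s * (u log u) + n log s
    have hx : ∀ k : ℕ, (k : ℝ) * Real.log k = k * Real.log s - s * Real.negMulLog (k / s) := by
      intro k
      rcases Nat.eq_zero_or_pos k with rfl | hk
      · simp
      have hk' : (0:ℝ) < k := by exact_mod_cast hk
      rw [Real.negMulLog, Real.log_div hk'.ne' hs0'.ne']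
      field_simp
      ring
    have hNu : ((N : ℝ) / s) = ∑ i ∈ Finset.range r, u s i := by
      rw [hNr, Nat.cast_sum, Finset.sum_div]
    have hNs : (N : ℝ) = ∑ i ∈ Finset.range r, (n s i : ℝ) := by rw [hNr]; push_cast; rfl
    have hsumx : ∑ i ∈ Finset.range r, ((n s i) * Real.log (n s i) - (n s i) +
        (1 + Real.log (s + 1))) = N * Real.log s - s * (∑ i ∈ Finset.range r,
          Real.negMulLog (u s i)) - N + r * (1 + Real.log (s + 1)) := by
      rw [Finset.sum_add_distrib, Finset.sum_sub_distrib, ← hNs]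
      have e1 : ∑ i ∈ Finset.range r, (n s i : ℝ) * Real.log (n s i) = N * Real.log s -
          s * ∑ i ∈ Finset.range r, Real.negMulLog (u s i) := by
        rw [Finset.sum_congr rfl fun i _ => hx (n s i), Finset.sum_sub_distrib, ← Finset.sum_mul,
          ← Finset.mul_sum, ← hNs]
      rw [e1]
      simp [mul_add]
    rw [hsumx] at hup
    rw [hx N, hNu] at hlow
    have hψs : s * ψ s = s * (∑ i ∈ Finset.range r, Real.negMulLog (u s i)) -
        s * Real.negMulLog (∑ i ∈ Finset.range r, u s i) - r * (1 + Real.log (s + 1)) := by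
      have e : (s : ℝ) * (r * ((1 + Real.log (s + 1)) / s)) = r * (1 + Real.log (s + 1)) := by
        field_simp
      simp only [ψ, mul_sub, e]
    have := mul_le_mul_of_nonneg_left hs.le hs0'.le
    rw [hψs] at this
    linarith

end Capacity

open MeasureTheory Set Function Filter Topology
open scoped ENNReal symmDiff

section Info
variable {X : Type*}

lemma lintegral_pullout {F : MeasurableSpace X} [mX : MeasurableSpace X] {ν : Measure X}
    [IsProbabilityMeasure ν] (hF : F ≤ mX) {B : Set X} (hB : MeasurableSet B) {L : X → ℝ≥0∞}
    (hL : Measurable[F] L) {f : X → ℝ} (hfm : Measurable[F] f)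
    (hf : f =ᵐ[ν] ν[B.indicator (fun _ => (1:ℝ)) | F]) (hf0 : ∀ x, 0 ≤ f x) :
    ∫⁻ x in B, L x ∂ν = ∫⁻ x, ENNReal.ofReal (f x) * L x ∂ν := by
  have hInteg : Integrable (B.indicator (fun _ => (1:ℝ))) ν := (integrable_const 1).indicator hB
  have hfi : Integrable f ν := (integrable_condExp).congr hf.symm
  have key : (ν.restrict B).trim hF = (ν.trim hF).withDensity (fun x => ENNReal.ofReal (f x)) := by
    refine @Measure.ext _ F _ _ fun A hA => ?_
    rw [trim_measurableSet_eq hF hA, withDensity_apply _ hA, ← lintegral_indicator hA,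
      lintegral_trim hF ((hfm.ennreal_ofReal).indicator hA), lintegral_indicator (hF _ hA),
      Measure.restrict_apply (hF _ hA)]
    rw [← ofReal_integral_eq_lintegral_ofReal hfi.integrableOn (ae_of_all _ hf0)]
    have h1 : ∫ x in A, f x ∂ν = ∫ x in A, B.indicator (fun _ => (1:ℝ)) x ∂ν := by
      rw [← setIntegral_condExp hF hInteg hA]
      exact integral_congr_ae (ae_restrict_of_ae hf)
    rw [h1, integral_indicator hB, Measure.restrict_restrict hB, integral_const, smul_eq_mul,
      mul_one, inter_comm]
    simp [Measure.real]
  have e1 : ∫⁻ x in B, L x ∂ν = @lintegral X F ((ν.restrict B).trim hF) L := by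
    rw [lintegral_trim hF hL]
  rw [e1, key, lintegral_withDensity_eq_lintegral_mul _ hfm.ennreal_ofReal hL,
    lintegral_trim hF (hfm.ennreal_ofReal.mul hL)]
  rfl

lemma exists_info {F : MeasurableSpace X} [mX : MeasurableSpace X] {ν : Measure X}
    [IsProbabilityMeasure ν] (hF : F ≤ mX) {β : X → ℕ} (hβ : Measurable β) :
    ∃ q : ℕ → X → ℝ, (∀ i, Measurable[F] (q i)) ∧ (∀ i x, 0 ≤ q i x) ∧
      (∀ n x, ∑ i ∈ Finset.range n, q i x ≤ 1) ∧ (∀ᵐ x ∂ν, 0 < q (β x) x) ∧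
      ∫⁻ x, ENNReal.ofReal (-Real.log (q (β x) x)) ∂ν = condEnt F ν (fun i => β ⁻¹' {i}) := by
  classical
  have hBm : ∀ i, MeasurableSet (β ⁻¹' {i}) := fun i => hβ (measurableSet_singleton i)
  let f : ℕ → X → ℝ := fun i => ν[(β ⁻¹' {i}).indicator (fun _ => (1:ℝ)) | F]
  have hfm : ∀ i, Measurable[F] (f i) := fun i => stronglyMeasurable_condExp.measurable
  have hInteg : ∀ i, Integrable ((β ⁻¹' {i}).indicator (fun _ => (1:ℝ))) ν := fun i =>
    (integrable_const 1).indicator (hBm i)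
  let E : Set X := {x | (∀ i, 0 ≤ f i x) ∧ ∀ n, ∑ i ∈ Finset.range n, f i x ≤ 1}
  have hEm : MeasurableSet[F] E := by
    have : E = (⋂ i, {x | 0 ≤ f i x}) ∩ ⋂ n, {x | ∑ i ∈ Finset.range n, f i x ≤ 1} := by
      ext x; simp [E]
    rw [this]
    refine MeasurableSet.inter (MeasurableSet.iInter fun i => ?_) (MeasurableSet.iInter fun n => ?_)
    · exact hfm i measurableSet_Ici
    · have : Measurable[F] fun x => ∑ i ∈ Finset.range n, f i x :=
        Finset.measurable_sum _ fun i _ => hfm i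
      exact this measurableSet_Iic
  have hE : ∀ᵐ x ∂ν, x ∈ E := by
    have h1 : ∀ᵐ x ∂ν, ∀ i, 0 ≤ f i x := by
      refine ae_all_iff.2 fun i => ?_
      exact condExp_nonneg (ae_of_all _ fun x => indicator_nonneg (fun _ _ => zero_le_one) x)
    have h2 : ∀ᵐ x ∂ν, ∀ n, ∑ i ∈ Finset.range n, f i x ≤ 1 := by
      refine ae_all_iff.2 fun n => ?_
      have a1 := condExp_finsetSum (μ := ν) (m := F) (s := Finset.range n)
        (f := fun i => (β ⁻¹' {i}).indicator (fun _ => (1:ℝ))) (fun i _ => hInteg i)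
      have a2 : ν[∑ i ∈ Finset.range n, (β ⁻¹' {i}).indicator (fun _ => (1:ℝ)) | F] ≤ᵐ[ν]
          ν[(fun _ => (1:ℝ)) | F] := by
        refine condExp_mono (integrable_finsetSum' _ fun i _ => hInteg i) (integrable_const 1)
          (ae_of_all _ fun x => ?_)
        simp only [Finset.sum_apply]
        by_cases hx : β x < n
        · rw [Finset.sum_eq_single (β x)]
          · simp
          · intro b _ hb
            exact indicator_of_notMem (by simpa using hb.symm) _
          · intro h; exact absurd (Finset.mem_range.2 hx) h
        · rw [Finset.sum_eq_zero]
          · exact zero_le_one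
          · intro b hb
            refine indicator_of_notMem ?_ _
            have := Finset.mem_range.1 hb
            simp; omega
      rw [condExp_const hF] at a2
      filter_upwards [a1, a2] with x h3 h4
      rw [h3] at h4
      simpa using h4
    filter_upwards [h1, h2] with x h3 h4 using ⟨h3, h4⟩
  let q : ℕ → X → ℝ := fun i => E.indicator (f i)
  have hqm : ∀ i, Measurable[F] (q i) := fun i => (hfm i).indicator hEm
  have hqf : ∀ i, q i =ᵐ[ν] f i := fun i => by
    filter_upwards [hE] with x hx using indicator_of_mem hx _
  have hq0 : ∀ i x, 0 ≤ q i x := fun i x => indicator_nonneg (fun x hx => hx.1 i) x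
  have hcov : ⋃ i, β ⁻¹' {i} = univ := by ext x; simp
  have hdis : Pairwise (Disjoint on fun i => β ⁻¹' {i}) := by
    intro i j hij
    exact disjoint_left.2 fun x h1 h2 => hij (h1.symm.trans h2)
  have hsplit : ∀ φ : X → ℝ≥0∞, ∫⁻ x, φ x ∂ν = ∑' i, ∫⁻ x in β ⁻¹' {i}, φ x ∂ν := by
    intro φ
    rw [← lintegral_iUnion hBm hdis, hcov, Measure.restrict_univ]
  refine ⟨q, hqm, hq0, ?_, ?_, ?_⟩
  · intro n x
    by_cases hx : x ∈ E
    · simpa [q, hx] using hx.2 n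
    · simp [q, hx]
  · have hz : ∀ i, ν (β ⁻¹' {i} ∩ {x | q i x = 0}) = 0 := by
      intro i
      have hs : MeasurableSet[F] {x | q i x = 0} := hqm i (measurableSet_singleton 0)
      have := lintegral_pullout hF (hBm i)
        (L := {x | q i x = 0}.indicator (fun _ => (1:ℝ≥0∞)))
        ((@measurable_const _ _ _ F _).indicator hs) (hqm i) (hqf i) (hq0 i)
      rw [lintegral_indicator (hF _ hs), Measure.restrict_restrict (hF _ hs), inter_comm] at this
      simp only [lintegral_const, one_mul, Measure.restrict_apply, MeasurableSet.univ,
        univ_inter] at this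
      rw [this, lintegral_eq_zero_iff' ?_]
      · refine ae_of_all _ fun x => ?_
        by_cases hx : q i x = 0
        · simp [hx]
        · have : x ∉ {x | q i x = 0} := hx
          simp [indicator_of_notMem this]
      · exact (((hqm i).ennreal_ofReal.mono hF le_rfl).mul
          (measurable_const.indicator (hF _ hs))).aemeasurable
    have : ∀ᵐ x ∂ν, ∀ i, ¬ (x ∈ β ⁻¹' {i} ∩ {x | q i x = 0}) :=
      ae_all_iff.2 fun i => measure_eq_zero_iff_ae_notMem.1 (hz i)
    filter_upwards [this] with x hx
    refine lt_of_le_of_ne (hq0 _ _) fun h => hx (β x) ⟨rfl, h.symm⟩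
  · rw [hsplit]
    have e1 : ∀ i, ∫⁻ x in β ⁻¹' {i}, ENNReal.ofReal (-Real.log (q (β x) x)) ∂ν =
        ∫⁻ x, ENNReal.ofReal (Real.negMulLog (f i x)) ∂ν := by
      intro i
      have a1 : ∫⁻ x in β ⁻¹' {i}, ENNReal.ofReal (-Real.log (q (β x) x)) ∂ν =
          ∫⁻ x in β ⁻¹' {i}, ENNReal.ofReal (-Real.log (q i x)) ∂ν := by
        refine setLIntegral_congr_fun (hBm i) fun x hx => ?_
        have : β x = i := hx
        simp only [this]
      rw [a1, lintegral_pullout hF (hBm i)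
        (L := fun x => ENNReal.ofReal (-Real.log (q i x)))
        (((Real.measurable_log.comp (hqm i)).neg).ennreal_ofReal) (hqm i) (hqf i) (hq0 i)]
      refine lintegral_congr_ae ?_
      filter_upwards [hqf i] with x hx
      rw [← hx, ← ENNReal.ofReal_mul (hq0 i x), Real.negMulLog]
      congr 1; ring
    simp_rw [e1]
    rw [condEnt, lintegral_tsum]
    intro i
    exact ((Real.continuous_negMulLog.measurable.comp
      ((hfm i).mono hF le_rfl)).ennreal_ofReal).aemeasurable
end Info

section Kraft

lemma kraft (I : Finset ℕ) (r : ℕ → ℕ → ℝ) (hr0 : ∀ i n, 0 ≤ r i n)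
    (hr1 : ∀ i N, ∑ n ∈ Finset.range N, r i n ≤ 1) (W : Finset (ℕ →₀ ℕ))
    (hW : ∀ w ∈ W, w.support ⊆ I) (c : ℝ) (hc : ∀ w ∈ W, c ≤ ∏ i ∈ I, r i (w i)) :
    W.card * c ≤ 1 := by
  classical
  obtain ⟨N, hN⟩ : ∃ N, ∀ w ∈ W, ∀ i, w i < N := by
    refine ⟨(∑ w ∈ W, ∑ i ∈ w.support, w i) + 1, fun w hw i => ?_⟩
    have h1 : w i ≤ ∑ i ∈ w.support, w i := by
      by_cases hi : i ∈ w.support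
      · exact Finset.single_le_sum (f := fun i => w i) (fun _ _ => Nat.zero_le _) hi
      · simp [Finsupp.notMem_support_iff.1 hi]
    have h2 := Finset.single_le_sum (f := fun w : ℕ →₀ ℕ => ∑ i ∈ w.support, w i)
      (fun _ _ => Nat.zero_le _) hw
    have h3 : ∑ i ∈ w.support, w i ≤ ∑ w ∈ W, ∑ i ∈ w.support, w i := h2
    omega
  have h1 : ∏ i : I, ∑ n ∈ Finset.range N, r i n ≤ 1 :=
    Finset.prod_le_one (fun i _ => Finset.sum_nonneg fun n _ => hr0 _ _) (fun i _ => hr1 _ _)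
  rw [Finset.prod_univ_sum] at h1
  let e : (ℕ →₀ ℕ) → (I → ℕ) := fun w i => w i
  have hinj : Set.InjOn e W := by
    intro w hw w' hw' h
    ext i
    by_cases hi : i ∈ I
    · exact congrFun h ⟨i, hi⟩
    · rw [Finsupp.notMem_support_iff.1 fun h => hi (hW w hw h),
        Finsupp.notMem_support_iff.1 fun h => hi (hW w' hw' h)]
  have hsub : W.image e ⊆ Fintype.piFinset fun _ : I => Finset.range N := by
    intro f hf
    obtain ⟨w, hw, rfl⟩ := Finset.mem_image.1 hf
    exact Fintype.mem_piFinset.2 fun i => Finset.mem_range.2 (hN w hw i)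
  calc (W.card : ℝ) * c = ∑ w ∈ W, c := by simp
    _ ≤ ∑ w ∈ W, ∏ i ∈ I, r i (w i) := Finset.sum_le_sum hc
    _ = ∑ w ∈ W, ∏ i : I, r i (e w i) := by
        refine Finset.sum_congr rfl fun w _ => ?_
        rw [Finset.prod_coe_sort I (fun i => r i (w i))]
    _ = ∑ f ∈ W.image e, ∏ i : I, r i (f i) := by rw [Finset.sum_image hinj]
    _ ≤ _ := Finset.sum_le_sum_of_subset_of_nonneg hsub fun f _ _ =>
        Finset.prod_nonneg fun i _ => hr0 _ _
    _ ≤ 1 := h1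

/-- a fixed numbering of finitely supported words -/
noncomputable def encW : (ℕ →₀ ℕ) → ℕ := (exists_injective_nat (ℕ →₀ ℕ)).choose

lemma encW_inj : Injective encW := (exists_injective_nat (ℕ →₀ ℕ)).choose_spec

lemma belowW_finite (w : ℕ →₀ ℕ) : {w' | encW w' < encW w}.Finite :=
  (Set.finite_lt_nat (encW w)).preimage encW_inj.injOn

noncomputable def belowW (w : ℕ →₀ ℕ) : Finset (ℕ →₀ ℕ) := (belowW_finite w).toFinset

lemma mem_belowW {w w' : ℕ →₀ ℕ} : w' ∈ belowW w ↔ encW w' < encW w := by simp [belowW]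

open Classical in
/-- rank of a word in a set of words -/
noncomputable def rankW (S : Set (ℕ →₀ ℕ)) (w : ℕ →₀ ℕ) : ℕ :=
  ((belowW w).filter (· ∈ S)).card

lemma rankW_lt {S : Set (ℕ →₀ ℕ)} {N : ℕ} (hS : ∀ W : Finset (ℕ →₀ ℕ), ↑W ⊆ S → W.card ≤ N)
    {w : ℕ →₀ ℕ} (hw : w ∈ S) : rankW S w < N := by
  classical
  have h : w ∉ (belowW w).filter (· ∈ S) := by simp [mem_belowW]
  have := hS (insert w ((belowW w).filter (· ∈ S))) (by
    intro x hx
    rcases Finset.mem_insert.1 hx with rfl | hx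
    · exact hw
    · exact (Finset.mem_filter.1 hx).2)
  rw [Finset.card_insert_of_notMem h] at this
  unfold rankW
  omega

lemma rankW_inj {S : Set (ℕ →₀ ℕ)} {w w' : ℕ →₀ ℕ} (hw : w ∈ S) (hw' : w' ∈ S)
    (h : rankW S w = rankW S w') : w = w' := by
  classical
  have key : ∀ {w w' : ℕ →₀ ℕ}, w ∈ S → encW w < encW w' → rankW S w < rankW S w' := by
    intro w w' hw h
    refine Finset.card_lt_card ⟨?_, ?_⟩
    · intro x hx
      simp only [Finset.mem_filter, mem_belowW] at hx ⊢
      exact ⟨hx.1.trans h, hx.2⟩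
    · intro hh
      have : w ∈ (belowW w).filter (· ∈ S) := hh (by simp [mem_belowW, h, hw])
      simp [mem_belowW] at this
  rcases lt_trichotomy (encW w) (encW w') with h1 | h1 | h1
  · exact absurd h (key hw h1).ne
  · exact encW_inj h1
  · exact absurd h (key hw' h1).ne'

end Kraft

open MeasureTheory Set Function Filter Topology
open scoped ENNReal symmDiff

section Enc
variable {G X : Type*} [Group G] [MulAction G X] (g : ℕ → G) (M : Set X) (q : ℕ → X → ℝ)
  (β : X → ℕ) (Q : ℕ)

def cellE (i : ℕ) : Set X := {x | (g i)⁻¹ • x ∈ M ∧ ∀ j < i, (g j)⁻¹ • x ∉ M}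
def cellC (i : ℕ) : Set X := (fun x => g i • x) ⁻¹' cellE g M i

lemma cellC_sub (i : ℕ) : cellC g M i ⊆ M := by
  intro e he
  have : (g i)⁻¹ • g i • e ∈ M := he.1
  simpa using this

noncomputable def costW (w : ℕ →₀ ℕ) (e : X) : ℝ≥0∞ :=
  ∑' i, (cellC g M i).indicator (fun e => ENNReal.ofReal (-Real.log (q (w i) (g i • e)))) e

noncomputable def demand (e : X) : ℝ≥0∞ :=
  ∑' i, (cellC g M i).indicator (fun e => ENNReal.ofReal (-Real.log (q (β (g i • e)) (g i • e)))) e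

def Adm (k : ℕ) (w : ℕ →₀ ℕ) : Set X :=
  {e | (∀ i, w i ≠ 0 → e ∈ cellC g M i) ∧ (∀ i, e ∈ cellC g M i → 0 < q (w i) (g i • e)) ∧
    costW g M q w e ≤ k * ENNReal.ofReal (Real.log Q)}

def demSet (j : ℕ) : Set X := {e | e ∈ M ∧ j * ENNReal.ofReal (Real.log Q) ≤ demand g M q β e}

open Classical in
noncomputable def wordE (e : X) : ℕ →₀ ℕ :=
  if h : {i | e ∈ cellC g M i ∧ β (g i • e) ≠ 0}.Finite then
    Finsupp.onFinset h.toFinset (fun i => if e ∈ cellC g M i then β (g i • e) else 0)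
      (by intro i hi; simpa using hi)
  else 0

open Classical in
noncomputable def lenE (e : X) : ℕ :=
  if h : ∃ k, e ∉ demSet g M q β Q k then Nat.find h else 0

noncomputable def rankE (e : X) : ℕ :=
  rankW {w | e ∈ Adm g M q Q (lenE g M q β Q e) w} (wordE g M β e)

lemma wordE_apply {e : X} (h : {i | e ∈ cellC g M i ∧ β (g i • e) ≠ 0}.Finite) (i : ℕ) :
    wordE g M β e i = (cellC g M i).indicator (fun e => β (g i • e)) e := by
  classical
  simp [wordE, h, indicator_apply]

lemma adm_card {q : ℕ → X → ℝ} {Q : ℕ} (hQ : 2 ≤ Q) (hq0 : ∀ i x, 0 ≤ q i x)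
    (hq1 : ∀ n x, ∑ i ∈ Finset.range n, q i x ≤ 1) (e : X) (k : ℕ) (W : Finset (ℕ →₀ ℕ))
    (hW : ↑W ⊆ {w | e ∈ Adm g M q Q k w}) : W.card ≤ Q ^ k := by
  classical
  have hQ' : (0:ℝ) < Q := by exact_mod_cast (by omega : 0 < Q)
  have hlog : 0 ≤ Real.log Q := Real.log_nonneg (by exact_mod_cast (by omega : 1 ≤ Q))
  have hqle : ∀ i x, q i x ≤ 1 := by
    intro i x
    refine le_trans ?_ (hq1 (i+1) x)
    exact Finset.single_le_sum (f := fun i => q i x) (fun j _ => hq0 j x)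
      (Finset.mem_range.2 (Nat.lt_succ_self i))
  let I : Finset ℕ := W.biUnion Finsupp.support
  have hIC : ∀ i ∈ I, e ∈ cellC g M i := by
    intro i hi
    obtain ⟨w, hw, h⟩ := Finset.mem_biUnion.1 hi
    exact (hW hw).1 i (Finsupp.mem_support_iff.1 h)
  have := kraft I (fun i n => q n (g i • e)) (fun i n => hq0 _ _) (fun i N => hq1 _ _) W
    (fun w hw => Finset.subset_biUnion_of_mem Finsupp.support hw) (((Q:ℝ) ^ k)⁻¹) (by
      intro w hw
      obtain ⟨h1, h2, h3⟩ := hW hw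
      have hpos : ∀ i ∈ I, 0 < q (w i) (g i • e) := fun i hi => h2 i (hIC i hi)
      have hprod : 0 < ∏ i ∈ I, q (w i) (g i • e) := Finset.prod_pos hpos
      have h4 : ∑ i ∈ I, ENNReal.ofReal (-Real.log (q (w i) (g i • e))) ≤
          k * ENNReal.ofReal (Real.log Q) := by
        refine le_trans ?_ h3
        refine le_trans (le_of_eq ?_) (ENNReal.sum_le_tsum I)
        exact Finset.sum_congr rfl fun i hi => by rw [indicator_of_mem (hIC i hi)]
      rw [← ENNReal.ofReal_sum_of_nonneg (fun i _ =>
        neg_nonneg.2 (Real.log_nonpos (hq0 _ _) (hqle _ _))), ← ENNReal.ofReal_natCast,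
        ← ENNReal.ofReal_mul (by positivity),
        ENNReal.ofReal_le_ofReal_iff (by positivity), Finset.sum_neg_distrib,
        ← Real.log_prod (fun i hi => (hpos i hi).ne')] at h4
      rw [← Real.exp_log hprod, ← Real.exp_log hQ', ← Real.exp_nat_mul, ← Real.exp_neg,
        Real.exp_le_exp]
      linarith)
  have hQk : (0:ℝ) < (Q:ℝ)^k := by positivity
  rw [← div_eq_mul_inv, div_le_one hQk] at this
  exact_mod_cast this

variable {g M q β Q}

lemma cellE_meas {m : MeasurableSpace X} (hm : InvariantAlg G m) (hM : MeasurableSet[m] M) (i : ℕ) :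
    MeasurableSet[m] (cellE g M i) := by
  have : cellE g M i = ((fun x => (g i)⁻¹ • x) ⁻¹' M) ∩
      ⋂ j : Fin i, ((fun x => (g j)⁻¹ • x) ⁻¹' M)ᶜ := by
    ext x; simp [cellE, Fin.forall_iff]
  rw [this]
  exact (hm.pre _ hM).inter (MeasurableSet.iInter fun j => (hm.pre _ hM).compl)

lemma cellC_meas {m : MeasurableSpace X} (hm : InvariantAlg G m) (hM : MeasurableSet[m] M) (i : ℕ) :
    MeasurableSet[m] (cellC g M i) := hm.pre _ (cellE_meas hm hM i)

lemma cellE_disj : Pairwise (Disjoint on cellE g M) := by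
  intro i j hij
  wlog h : i < j generalizing i j
  · exact (this hij.symm (lt_of_le_of_ne (not_lt.1 h) hij.symm)).symm
  exact disjoint_left.2 fun x h1 h2 => h2.2 i h h1.1

lemma costW_meas {m : MeasurableSpace X} (hm : InvariantAlg G m) (hM : MeasurableSet[m] M)
    (hq : ∀ i, Measurable[m] (q i)) (w : ℕ →₀ ℕ) : Measurable[m] (costW g M q w) := by
  refine Measurable.ennreal_tsum fun i => Measurable.indicator ?_ (cellC_meas hm hM i)
  exact ((Real.measurable_log.comp ((hq (w i)).comp (hm.measurable_smul (g i)))).neg).ennreal_ofReal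

lemma adm_meas {m : MeasurableSpace X} (hm : InvariantAlg G m) (hM : MeasurableSet[m] M)
    (hq : ∀ i, Measurable[m] (q i)) (k : ℕ) (w : ℕ →₀ ℕ) :
    MeasurableSet[m] (Adm g M q Q k w) := by
  have : Adm g M q Q k w = (⋂ i, {e | w i ≠ 0 → e ∈ cellC g M i}) ∩
      ((⋂ i, {e | e ∈ cellC g M i → 0 < q (w i) (g i • e)}) ∩
      {e | costW g M q w e ≤ k * ENNReal.ofReal (Real.log Q)}) := by
    ext e; simp [Adm]
  rw [this]
  refine MeasurableSet.inter (MeasurableSet.iInter fun i => ?_)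
    (MeasurableSet.inter (MeasurableSet.iInter fun i => ?_) ?_)
  · by_cases h : w i ≠ 0
    · simp only [h, forall_true_left, ne_eq, not_false_iff]; exact cellC_meas hm hM i
    · simp only [h, false_imp_iff, ne_eq, not_false_iff]; exact MeasurableSet.univ
  · have e1 : {e | e ∈ cellC g M i → 0 < q (w i) (g i • e)} =
        (cellC g M i)ᶜ ∪ (fun e => q (w i) (g i • e)) ⁻¹' Ioi 0 := by
      ext e; simp [imp_iff_not_or]
    rw [e1]
    exact (cellC_meas hm hM i).compl.union
      (((hq (w i)).comp (hm.measurable_smul (g i))) measurableSet_Ioi)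
  · exact (costW_meas hm hM hq w) measurableSet_Iic

lemma rank_meas {m : MeasurableSpace X} (hm : InvariantAlg G m) (hM : MeasurableSet[m] M)
    (hq : ∀ i, Measurable[m] (q i)) (k : ℕ) (w : ℕ →₀ ℕ) :
    Measurable[m] (fun e => rankW {w | e ∈ Adm g M q Q k w} w) := by
  classical
  have : (fun e => rankW {w | e ∈ Adm g M q Q k w} w) =
      fun e => ∑ w' ∈ belowW w, (Adm g M q Q k w').indicator (fun _ => 1) e := by
    funext e
    unfold rankW
    rw [Finset.card_filter]
    exact Finset.sum_congr rfl fun w' _ => by by_cases h : e ∈ Adm g M q Q k w' <;> simp [h]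
  rw [this]
  exact Finset.measurable_sum _ fun w' _ => measurable_const.indicator (adm_meas hm hM hq k w')

lemma demand_meas [mX : MeasurableSpace X] (hm : InvariantAlg G mX) (hM : MeasurableSet M)
    (hq : ∀ i, Measurable (q i)) (hβ : Measurable β) : Measurable (demand g M q β) := by
  refine Measurable.ennreal_tsum fun i => Measurable.indicator ?_ (cellC_meas hm hM i)
  have h1 : Measurable fun x => q (β x) x :=
    measurable_from_prod_countable_right (f := fun z : ℕ × X => q z.1 z.2) (fun n => hq n)
      |>.comp (hβ.prodMk measurable_id)
  exact ((Real.measurable_log.comp (h1.comp (hm.measurable_smul (g i)))).neg).ennreal_ofReal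

lemma demSet_meas [mX : MeasurableSpace X] (hm : InvariantAlg G mX) (hM : MeasurableSet M)
    (hq : ∀ i, Measurable (q i)) (hβ : Measurable β) (j : ℕ) :
    MeasurableSet (demSet g M q β Q j) :=
  hM.inter ((demand_meas hm hM hq hβ) measurableSet_Ici)

lemma demSet_anti {i j : ℕ} (h : i ≤ j) : demSet g M q β Q j ⊆ demSet g M q β Q i := by
  rintro e ⟨h1, h2⟩
  refine ⟨h1, le_trans ?_ h2⟩
  gcongr

lemma demSet_zero : demSet g M q β Q 0 = M := by ext e; simp [demSet]

lemma cell_cover [mX : MeasurableSpace X] {ν : Measure X} [IsProbabilityMeasure ν]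
    (hp : IsPmp G ν) (he : IsErgodicInv G ν) (hg : Surjective g) (hM : MeasurableSet M)
    (hM0 : ν M ≠ 0) : ∀ᵐ x ∂ν, ∃ i, x ∈ cellE g M i := by
  classical
  have hg' : Surjective fun n => (g n)⁻¹ := fun k => by
    obtain ⟨n, hn⟩ := hg k⁻¹
    exact ⟨n, by simp [hn]⟩
  have := erg_cover hp he hg' hM hM0
  filter_upwards [measure_eq_zero_iff_ae_notMem.1 this] with x hx
  have hex : ∃ n, (g n)⁻¹ • x ∈ M := by
    by_contra hh
    push Not at hh
    exact hx hh
  exact ⟨Nat.find hex, Nat.find_spec hex, fun j hj => Nat.find_min hex hj⟩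

lemma lintegral_cells [mX : MeasurableSpace X] {ν : Measure X} [IsProbabilityMeasure ν]
    (hp : IsPmp G ν) (he : IsErgodicInv G ν) (hg : Surjective g) (hM : MeasurableSet M)
    (hM0 : ν M ≠ 0) {φ : X → ℝ≥0∞} (hφ : Measurable φ) :
    ∫⁻ e, ∑' i, (cellC g M i).indicator (fun e => φ (g i • e)) e ∂ν = ∫⁻ x, φ x ∂ν := by
  rw [lintegral_tsum]
  · have h1 : ∀ i, ∫⁻ e, (cellC g M i).indicator (fun e => φ (g i • e)) e ∂ν =
        ∫⁻ x in cellE g M i, φ x ∂ν := by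
      intro i
      rw [← lintegral_indicator (cellE_meas hp.inv hM i)]
      rw [← (hp (g i)).lintegral_comp (hφ.indicator (cellE_meas hp.inv hM i))]
      rfl
    simp_rw [h1]
    rw [← lintegral_iUnion (fun i => cellE_meas hp.inv hM i) cellE_disj]
    have : (⋃ i, cellE g M i : Set X) =ᵐ[ν] univ := by
      refine eventuallyEq_univ.2 ?_
      filter_upwards [cell_cover hp he hg hM hM0] with x hx
      exact mem_iUnion.2 hx
    rw [Measure.restrict_congr_set this, Measure.restrict_univ]
  · intro i
    exact ((hφ.comp (hp.meas _)).indicator (cellC_meas hp.inv hM i)).aemeasurable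

lemma levels_le (D c : ℝ≥0∞) (n : ℕ) :
    ∑ j ∈ Finset.range n, (if ((j + 1 : ℕ) : ℝ≥0∞) * c ≤ D then c else 0) ≤ D := by
  induction n with
  | zero => simp
  | succ n ih =>
    by_cases h : ((n + 1 : ℕ) : ℝ≥0∞) * c ≤ D
    · refine le_trans ?_ h
      refine (Finset.sum_le_card_nsmul _ _ c fun j _ => ?_).trans ?_
      · split_ifs <;> simp
      · simp
    · rw [Finset.sum_range_succ, if_neg h, add_zero]; exact ih

lemma demSet_sum [mX : MeasurableSpace X] {ν : Measure X} [IsProbabilityMeasure ν]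
    (hp : IsPmp G ν) (he : IsErgodicInv G ν) (hg : Surjective g) (hM : MeasurableSet M)
    (hM0 : ν M ≠ 0) (hq : ∀ i, Measurable (q i)) (hβ : Measurable β) (hQ : 2 ≤ Q) (n : ℕ) :
    ∑ j ∈ Finset.range n, ν (demSet g M q β Q j) ≤
      ν M + (∫⁻ x, ENNReal.ofReal (-Real.log (q (β x) x)) ∂ν) / ENNReal.ofReal (Real.log Q) := by
  have hlog : 0 < Real.log Q := Real.log_pos (by exact_mod_cast (by omega : 1 < Q))
  set c := ENNReal.ofReal (Real.log Q) with hc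
  have hc0 : c ≠ 0 := by simpa [hc] using hlog
  have hct : c ≠ ∞ := ENNReal.ofReal_ne_top
  have hqβ : Measurable fun x => ENNReal.ofReal (-Real.log (q (β x) x)) := by
    have h1 : Measurable fun x => q (β x) x :=
      measurable_from_prod_countable_right (f := fun z : ℕ × X => q z.1 z.2) (fun n => hq n)
        |>.comp (hβ.prodMk measurable_id)
    exact ((Real.measurable_log.comp h1).neg).ennreal_ofReal
  have hD := lintegral_cells hp he hg hM hM0 hqβ
  have hm := demand_meas (g := g) hp.inv hM hq hβ
  cases n with
  | zero => simp
  | succ n =>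
    rw [Finset.sum_range_succ', demSet_zero, add_comm]
    refine add_le_add le_rfl ?_
    rw [ENNReal.le_div_iff_mul_le (Or.inl hc0) (Or.inl hct), ← hD, Finset.sum_mul]
    calc ∑ j ∈ Finset.range n, ν (demSet g M q β Q (j + 1)) * c
        ≤ ∑ j ∈ Finset.range n, ∫⁻ e, (if ((j + 1 : ℕ) : ℝ≥0∞) * c ≤ demand g M q β e
            then c else 0) ∂ν := by
          refine Finset.sum_le_sum fun j _ => ?_
          have e1 : (fun e => if ((j + 1 : ℕ) : ℝ≥0∞) * c ≤ demand g M q β e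
            then c else 0) = {e | ((j + 1 : ℕ) : ℝ≥0∞) * c ≤ demand g M q β e}.indicator
              (fun _ => c) := by
            funext e; simp [indicator_apply]
          have hms : MeasurableSet {e | ((j + 1 : ℕ) : ℝ≥0∞) * c ≤ demand g M q β e} :=
            hm measurableSet_Ici
          rw [e1, lintegral_indicator hms, setLIntegral_const, mul_comm]
          gcongr
          intro e he
          exact he.2
      _ = ∫⁻ e, ∑ j ∈ Finset.range n, (if ((j + 1 : ℕ) : ℝ≥0∞) * c ≤ demand g M q β e
            then c else 0) ∂ν := by
          rw [lintegral_finsetSum]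
          intro j _
          exact Measurable.ite (hm measurableSet_Ici) measurable_const measurable_const
      _ ≤ ∫⁻ e, demand g M q β e ∂ν := lintegral_mono fun e => levels_le _ _ _
      _ = _ := rfl

end Enc

open MeasureTheory Set Function Filter Topology
open scoped ENNReal symmDiff

section Enc2
variable {G X : Type*} [Group G] [MulAction G X] {g : ℕ → G} {M : Set X} {q : ℕ → X → ℝ}
  {β : X → ℕ} {Q : ℕ}

lemma lenE_meas [mX : MeasurableSpace X] (hE : ∀ j, MeasurableSet (demSet g M q β Q j)) :
    Measurable (lenE g M q β Q) := by
  classical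
  let p : ℕ → X → Prop := fun k e => e ∉ demSet g M q β Q k ∨ ∀ j, e ∈ demSet g M q β Q j
  have hp : ∀ e, ∃ k, p k e := by
    intro e
    by_cases h : ∃ k, e ∉ demSet g M q β Q k
    · obtain ⟨k, hk⟩ := h; exact ⟨k, Or.inl hk⟩
    · push Not at h; exact ⟨0, Or.inr h⟩
  have : lenE g M q β Q = fun e => Nat.find (hp e) := by
    funext e
    unfold lenE
    split_ifs with h
    · refine le_antisymm ?_ ?_
      · refine Nat.find_min' _ ?_
        rcases Nat.find_spec (hp e) with h1 | h1
        · exact h1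
        · exact absurd (h1 _) h.choose_spec
      · exact Nat.find_min' _ (Or.inl (Nat.find_spec h))
    · push Not at h
      symm
      exact (Nat.find_eq_zero (hp e)).2 (Or.inr h)
  rw [this]
  refine measurable_find hp fun k => ?_
  have : {x | p k x} = (demSet g M q β Q k)ᶜ ∪ ⋂ j, demSet g M q β Q j := by
    ext e; simp [p]
  rw [this]
  exact (hE k).compl.union (MeasurableSet.iInter hE)

lemma wordE_eq_meas [mX : MeasurableSpace X] (hm : InvariantAlg G mX) (hM : MeasurableSet M)
    (hβ : Measurable β) (w : ℕ →₀ ℕ) : MeasurableSet {e | wordE g M β e = w} := by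
  classical
  have h1 : ∀ i, MeasurableSet {e | e ∈ cellC g M i ∧ β (g i • e) ≠ 0} := fun i =>
    (cellC_meas hm hM i).inter
      ((hβ.comp (hm.measurable_smul (g i))) (measurableSet_singleton 0).compl)
  have hFin : MeasurableSet {e | {i | e ∈ cellC g M i ∧ β (g i • e) ≠ 0}.Finite} := by
    have : {e | {i | e ∈ cellC g M i ∧ β (g i • e) ≠ 0}.Finite} =
        ⋃ n : ℕ, ⋂ i : ℕ, {e | n ≤ i → ¬ (e ∈ cellC g M i ∧ β (g i • e) ≠ 0)} := by
      ext e
      simp only [mem_setOf_eq, mem_iUnion, mem_iInter]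
      constructor
      · intro h
        obtain ⟨n, hn⟩ := h.bddAbove
        exact ⟨n + 1, fun i hi hh => by have := hn hh; omega⟩
      · rintro ⟨n, hn⟩
        refine (Set.finite_lt_nat n).subset fun i hi => ?_
        by_contra h
        exact hn i (not_lt.1 h) hi
    rw [this]
    refine MeasurableSet.iUnion fun n => MeasurableSet.iInter fun i => ?_
    by_cases h : n ≤ i
    · simp only [h, forall_true_left]; exact (h1 i).compl
    · simp only [h, false_imp_iff]; exact MeasurableSet.univ
  have h2 : MeasurableSet {e | ∀ i, (cellC g M i).indicator (fun e => β (g i • e)) e = w i} := by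
    rw [setOf_forall]
    exact MeasurableSet.iInter fun i =>
      ((hβ.comp (hm.measurable_smul (g i))).indicator (cellC_meas hm hM i))
        (measurableSet_singleton (w i))
  have : {e | wordE g M β e = w} =
      ({e | {i | e ∈ cellC g M i ∧ β (g i • e) ≠ 0}.Finite} ∩
        {e | ∀ i, (cellC g M i).indicator (fun e => β (g i • e)) e = w i}) ∪
      ({e | {i | e ∈ cellC g M i ∧ β (g i • e) ≠ 0}.Finite}ᶜ ∩ {_e | 0 = w}) := by
    ext e
    by_cases h : {i | e ∈ cellC g M i ∧ β (g i • e) ≠ 0}.Finite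
    · simp only [mem_setOf_eq, mem_union, mem_inter_iff, h, true_and, mem_compl_iff,
        not_true_eq_false, false_and, or_false]
      rw [Finsupp.ext_iff]
      exact forall_congr' fun i => by rw [wordE_apply g M β h i]
    · have : wordE g M β e = 0 := by unfold wordE; rw [dif_neg h]
      simp only [mem_setOf_eq, mem_union, mem_inter_iff, h, mem_compl_iff,
        not_false_iff, false_and, false_or, true_and, this]
  rw [this]
  exact (hFin.inter h2).union (hFin.compl.inter (MeasurableSet.const _))

lemma rankE_meas [mX : MeasurableSpace X] (hm : InvariantAlg G mX) (hM : MeasurableSet M)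
    (hq : ∀ i, Measurable (q i)) (hβ : Measurable β) : Measurable (rankE g M q β Q) := by
  refine measurable_to_countable' fun n => ?_
  have : rankE g M q β Q ⁻¹' {n} = ⋃ k : ℕ, ⋃ w : ℕ →₀ ℕ, (lenE g M q β Q ⁻¹' {k}) ∩
      ({e | wordE g M β e = w} ∩ ((fun e => rankW {w | e ∈ Adm g M q Q k w} w) ⁻¹' {n})) := by
    ext e
    simp [rankE]
  rw [this]
  exact MeasurableSet.iUnion fun k => MeasurableSet.iUnion fun w =>
    (lenE_meas (demSet_meas hm hM hq hβ) (measurableSet_singleton k)).inter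
      ((wordE_eq_meas hm hM hβ w).inter (rank_meas hm hM hq k w (measurableSet_singleton n)))

open Classical in
/-- the value written at level `j` -/
noncomputable def valE (g : ℕ → G) (M : Set X) (q : ℕ → X → ℝ) (β : X → ℕ) (Q j : ℕ) (e : X) : ℕ :=
  2 * (rankE g M q β Q e / Q ^ j % Q) + if e ∈ demSet g M q β Q (j + 1) then 1 else 0

lemma exists_sym [mX : MeasurableSpace X] (hm : InvariantAlg G mX) (hM : MeasurableSet M)
    (hq : ∀ i, Measurable (q i)) (hβ : Measurable β) (hQ : 2 ≤ Q) {T : Set X}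
    (hT : MeasurableSet T) :
    ∃ sym : X → ℕ, Measurable sym ∧ (∀ x, sym x < 2 * Q) ∧
      ∀ j, ∀ e ∈ mDom g (demSet g M q β Q) T j,
        sym (mMap g (demSet g M q β Q) T j e) = valE g M q β Q j e := by
  classical
  set E := demSet g M q β Q with hE
  have hEm : ∀ j, MeasurableSet (E j) := demSet_meas hm hM hq hβ
  have hval : ∀ j, Measurable (valE g M q β Q j) := by
    intro j
    unfold valE
    refine Measurable.add ?_ (Measurable.ite (hEm (j+1)) measurable_const measurable_const)
    exact (measurable_from_top (f := fun r : ℕ => 2 * (r / Q ^ j % Q))).comp (rankE_meas hm hM hq hβ)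
  have hvlt : ∀ j e, valE g M q β Q j e < 2 * Q := by
    intro j e
    unfold valE
    have := Nat.mod_lt (rankE g M q β Q e / Q ^ j) (by omega : Q > 0)
    split_ifs <;> omega
  let I : ℕ → Set X := fun j => mMap g E T j '' mDom g E T j
  have hI : ∀ j, MeasurableSet (I j) := fun j =>
    mImg_meas hm j (fun i _ => hEm i) hT (mDom_meas hm j (fun i _ => hEm i) hT) subset_rfl
  let p : ℕ → X → Prop := fun j y => y ∈ I j ∨ ∀ k, y ∉ I k
  have hp : ∀ y, ∃ k, p k y := by
    intro e
    by_cases h : ∃ k, e ∈ I k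
    · obtain ⟨k, hk⟩ := h; exact ⟨k, Or.inl hk⟩
    · push Not at h; exact ⟨0, Or.inr h⟩
  let f : ℕ → X → ℕ := fun j y => if y ∈ I j then valE g M q β Q j (mInv g E T j y) else 0
  have hf : ∀ j, Measurable (f j) := fun j => Measurable.ite (hI j)
    ((hval j).comp (mInv_meas hm j (fun i _ => hEm i) hT)) measurable_const
  refine ⟨fun y => f (Nat.find (hp y)) y, ?_, ?_, ?_⟩
  · refine Measurable.find hf (fun n => ?_) hp
    have : {x | p n x} = I n ∪ ⋂ k, (I k)ᶜ := by
      ext e; simp [p]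
    rw [this]
    exact (hI n).union (MeasurableSet.iInter fun k => (hI k).compl)
  · intro y
    simp only [f]
    split_ifs
    · exact hvlt _ _
    · omega
  · intro j e he
    have hmem : mMap g E T j e ∈ I j := ⟨e, he, rfl⟩
    have hj : Nat.find (hp (mMap g E T j e)) = j := by
      rcases Nat.find_spec (hp (mMap g E T j e)) with ⟨e', he', h⟩ | h
      · exact (mMap_disj g E T he' he h).1
      · exact absurd hmem (h j)
    simp only [hj, f, if_pos hmem]
    rw [mInv_mMap g E T he]

lemma digit_sum (r Q k : ℕ) : ∑ j ∈ Finset.range k, (r / Q ^ j % Q) * Q ^ j = r % Q ^ k := by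
  induction k with
  | zero => simp [Nat.mod_one]
  | succ k ih => rw [Finset.sum_range_succ, ih, Nat.mod_pow_succ, mul_comm]

/-- The encoding lemma. -/
theorem enc {F : MeasurableSpace X} [mX : MeasurableSpace X] {ν : Measure X} [IsProbabilityMeasure ν]
    (hp : IsPmp G ν) (he : IsErgodicInv G ν) (hg : Surjective g) (hM : MeasurableSet M)
    (hM0 : ν M ≠ 0) (hF : F ≤ mX) (hqF : ∀ i, Measurable[F] (q i))
    (hq0 : ∀ i x, 0 ≤ q i x) (hq1 : ∀ n x, ∑ i ∈ Finset.range n, q i x ≤ 1)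
    (hqpos : ∀ᵐ x ∂ν, 0 < q (β x) x) (hβ : Measurable β) (hQ : 2 ≤ Q)
    (hJ : ∫⁻ x, ENNReal.ofReal (-Real.log (q (β x) x)) ∂ν ≠ ∞) {T : Set X} (hT : MeasurableSet T)
    (hTm : ν M + (∫⁻ x, ENNReal.ofReal (-Real.log (q (β x) x)) ∂ν) / ENNReal.ofReal (Real.log Q)
      ≤ ν T) :
    ∃ sym : X → ℕ, Measurable sym ∧ (∀ x, sym x < 2 * Q) ∧
      ∀ m : MeasurableSpace X, InvariantAlg G m → F ≤ m →
        (∀ A B : Set X, A =ᵐ[ν] B → MeasurableSet[m] B → MeasurableSet[m] A) →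
        MeasurableSet[m] M → MeasurableSet[m] T →
        (∀ c, MeasurableSet[m] (T ∩ sym ⁻¹' {c})) → ∀ n, MeasurableSet[m] (β ⁻¹' {n}) := by
  classical
  have hq : ∀ i, Measurable (q i) := fun i => (hqF i).mono hF le_rfl
  obtain ⟨sym, hsm, hslt, hsym⟩ := exists_sym (g := g) hp.inv hM hq hβ hQ hT
  refine ⟨sym, hsm, hslt, ?_⟩
  set E := demSet g M q β Q with hE
  have hEm : ∀ j, MeasurableSet (E j) := demSet_meas hp.inv hM hq hβ
  have hlog : 0 < Real.log Q := Real.log_pos (by exact_mod_cast (by omega : 1 < Q))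
  -- full domain
  have hdom : ∀ᵐ e ∂ν, ∀ j, e ∈ E j → e ∈ mDom g E T j := by
    rw [ae_all_iff]
    intro j
    have := mDom_conull hp he hg hEm hT j
      ((demSet_sum hp he hg hM hM0 hq hβ hQ (j+1)).trans hTm)
    filter_upwards [measure_eq_zero_iff_ae_notMem.1 this] with e he1 he2
    by_contra h
    exact he1 ⟨he2, h⟩
  -- digits
  let dg : ℕ → X → ℕ := fun j e => if e ∈ mDom g E T j then sym (mMap g E T j e) / 2 else 0
  let R : ℕ → (ℕ →₀ ℕ) → Set X := fun k w => {e | e ∈ M ∧ (∀ j < k, e ∈ E j) ∧ e ∉ E k ∧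
    e ∈ Adm g M q Q k w ∧ rankW {w | e ∈ Adm g M q Q k w} w = ∑ j ∈ Finset.range k, dg j e * Q ^ j}
  -- good points
  have hqβ : Measurable fun x => ENNReal.ofReal (-Real.log (q (β x) x)) := by
    have h1 : Measurable fun x => q (β x) x :=
      measurable_from_prod_countable_right (f := fun z : ℕ × X => q z.1 z.2) (fun n => hq n)
        |>.comp (hβ.prodMk measurable_id)
    exact ((Real.measurable_log.comp h1).neg).ennreal_ofReal
  have hdem : ∀ᵐ e ∂ν, demand g M q β e < ∞ := by
    refine ae_lt_top (demand_meas hp.inv hM hq hβ) ?_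
    have : ∫⁻ e, demand g M q β e ∂ν = _ := lintegral_cells hp he hg hM hM0 hqβ
    rw [this]; exact hJ
  have hfin : ∀ᵐ e ∂ν, {i | e ∈ cellC g M i}.Finite := by
    refine ae_finite_setOf_mem ?_
    have h1 : ∀ i, ν (cellC g M i) = ν (cellE g M i) := fun i =>
      (hp (g i)).measure_preimage (cellE_meas hp.inv hM i).nullMeasurableSet
    simp_rw [h1]
    rw [← measure_iUnion cellE_disj (cellE_meas hp.inv hM)]
    exact measure_ne_top _ _
  have hpos : ∀ᵐ e ∂ν, ∀ i, 0 < q (β (g i • e)) (g i • e) := by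
    rw [ae_all_iff]; intro i
    exact (hp (g i)).quasiMeasurePreserving.ae hqpos
  have hgood : ∀ᵐ e ∂ν, ∀ i, e ∈ cellC g M i → ∀ n,
      ((∃ k w, w i = n ∧ e ∈ R k w) ↔ β (g i • e) = n) := by
    filter_upwards [hdom, hdem, hfin, hpos] with e h1 h2 h3 h4 i hi n
    have heM : e ∈ M := cellC_sub _ _ _ hi
    have hex : ∃ k, e ∉ E k := by
      obtain ⟨k, hk⟩ := ENNReal.exists_nat_mul_gt (a := ENNReal.ofReal (Real.log Q))
        (by simpa using hlog) h2.ne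
      exact ⟨k, fun h => absurd h.2 (not_le.2 hk)⟩
    have hlen : lenE g M q β Q e = Nat.find hex := by unfold lenE; rw [dif_pos hex]
    have hfin' : {i | e ∈ cellC g M i ∧ β (g i • e) ≠ 0}.Finite := h3.subset fun i hi => hi.1
    have hw : ∀ i, e ∈ cellC g M i → wordE g M β e i = β (g i • e) := by
      intro i hi
      rw [wordE_apply _ _ _ hfin', indicator_of_mem hi]
    have hcost : costW g M q (wordE g M β e) e = demand g M q β e := by
      unfold costW demand
      refine tsum_congr fun i => ?_
      by_cases hi : e ∈ cellC g M i
      · rw [indicator_of_mem hi, indicator_of_mem hi, hw i hi]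
      · rw [indicator_of_notMem hi, indicator_of_notMem hi]
    have hadm : e ∈ Adm g M q Q (Nat.find hex) (wordE g M β e) := by
      refine ⟨?_, ?_, ?_⟩
      · intro i hi
        by_contra h
        rw [wordE_apply _ _ _ hfin', indicator_of_notMem h] at hi
        exact hi rfl
      · intro i hi; rw [hw i hi]; exact h4 i
      · rw [hcost]
        by_contra h
        exact Nat.find_spec hex ⟨heM, (not_le.1 h).le⟩
    have hlt : ∀ j < Nat.find hex, e ∈ E j := fun j hj => by
      by_contra h; exact Nat.find_min hex hj h
    have hsum : ∑ j ∈ Finset.range (Nat.find hex), dg j e * Q ^ j = rankE g M q β Q e := by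
      have e1 : ∑ j ∈ Finset.range (Nat.find hex), dg j e * Q ^ j =
          ∑ j ∈ Finset.range (Nat.find hex), (rankE g M q β Q e / Q ^ j % Q) * Q ^ j := by
        refine Finset.sum_congr rfl fun j hj => ?_
        have hd := h1 j (hlt j (Finset.mem_range.1 hj))
        congr 1
        simp only [dg, if_pos hd]
        rw [hsym j e hd]
        unfold valE
        split_ifs <;> omega
      rw [e1, digit_sum, Nat.mod_eq_of_lt]
      unfold rankE
      rw [hlen]
      exact rankW_lt (fun W hW => adm_card g M hQ hq0 hq1 e _ W hW) hadm
    constructor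
    · rintro ⟨k, w, rfl, -, hk1, hk2, hk3, hk4⟩
      have hk : k = Nat.find hex := by
        refine le_antisymm ?_ (Nat.find_min' _ hk2)
        by_contra h
        exact Nat.find_spec hex (hk1 _ (not_le.1 h))
      subst hk
      rw [hsum] at hk4
      unfold rankE at hk4
      rw [hlen] at hk4
      rw [rankW_inj hk3 hadm hk4, hw i hi]
    · rintro rfl
      refine ⟨Nat.find hex, wordE g M β e, hw i hi, heM, hlt, Nat.find_spec hex, hadm, ?_⟩
      rw [hsum]
      unfold rankE
      rw [hlen]
  have hgood2 : ∀ᵐ x ∂ν, ∀ i : ℕ, ∀ i', (g i)⁻¹ • x ∈ cellC g M i' → ∀ n,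
      ((∃ k w, w i' = n ∧ (g i)⁻¹ • x ∈ R k w) ↔ β (g i' • (g i)⁻¹ • x) = n) := by
    rw [ae_all_iff]; intro i
    exact (hp (g i)⁻¹).quasiMeasurePreserving.ae hgood
  have hcov := cell_cover hp he hg hM hM0
  have hae : ∀ {A B : Set X}, (∀ᵐ x ∂ν, x ∈ A ↔ x ∈ B) → A =ᵐ[ν] B := fun h => eventuallyEq_set.2 h
  intro m hmi hFm hcompl hMm hTm' hsymm n
  have hqm : ∀ i, Measurable[m] (q i) := fun i => (hqF i).mono hFm le_rfl
  -- values
  have hTs : ∀ P : ℕ → Prop, MeasurableSet[m] (T ∩ {y | P (sym y)}) := by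
    intro P
    have : T ∩ {y | P (sym y)} = ⋃ c : ℕ, ⋃ _ : P c, T ∩ sym ⁻¹' {c} := by
      ext y; simp only [mem_inter_iff, mem_ofPred_eq, mem_iUnion, mem_preimage, mem_singleton_iff]
      constructor
      · rintro ⟨h1, h2⟩; exact ⟨sym y, h2, h1, rfl⟩
      · rintro ⟨c, h2, h1, rfl⟩; exact ⟨h1, h2⟩
    rw [this]
    exact MeasurableSet.iUnion fun c => MeasurableSet.iUnion fun _ => hsymm c
  have hDv : ∀ j, (∀ i ≤ j, MeasurableSet[m] (E i)) → ∀ P : ℕ → Prop,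
      MeasurableSet[m] {e | e ∈ mDom g E T j ∧ P (sym (mMap g E T j e))} := by
    intro j hj P
    have : {e | e ∈ mDom g E T j ∧ P (sym (mMap g E T j e))} =
        mDom g E T j ∩ (mMap g E T j) ⁻¹' (T ∩ {y | P (sym y)}) := by
      ext e
      constructor
      · rintro ⟨h1, h2⟩; exact ⟨h1, mMap_mem g E T h1, h2⟩
      · rintro ⟨h1, h2, h3⟩; exact ⟨h1, h3⟩
    rw [this]
    exact (mDom_meas hmi j hj hTm').inter (mMap_meas hmi j hj hTm' (hTs P))
  have hEmm' : ∀ j, ∀ i ≤ j, MeasurableSet[m] (E i) := by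
    intro j
    induction j with
    | zero =>
      intro i hi
      obtain rfl : i = 0 := by omega
      rw [hE, demSet_zero]; exact hMm
    | succ j ih =>
      intro i hi
      rcases Nat.lt_or_ge i (j + 1) with h | h
      · exact ih i (by omega)
      obtain rfl : i = j + 1 := by omega
      refine hcompl _ {e | e ∈ mDom g E T j ∧ (fun c => c % 2 = 1) (sym (mMap g E T j e))} ?_
        (hDv j ih fun c => c % 2 = 1)
      refine hae ?_
      filter_upwards [hdom] with e he1
      have hodd : ∀ a : ℕ, (2 * a + if e ∈ E (j + 1) then 1 else 0) % 2 = 1 ↔ e ∈ E (j + 1) := by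
        intro a; split_ifs with h <;> simp [h] <;> omega
      constructor
      · intro h
        have h1 := he1 j (demSet_anti (Nat.le_succ j) h)
        refine ⟨h1, ?_⟩
        show sym (mMap g E T j e) % 2 = 1
        rw [hsym j e h1]; exact (hodd _).2 h
      · rintro ⟨h1, h2⟩
        have h2 : sym (mMap g E T j e) % 2 = 1 := h2
        rw [hsym j e h1] at h2; exact (hodd _).1 h2
  have hEmm : ∀ j, MeasurableSet[m] (E j) := fun j => hEmm' j j le_rfl
  have hdg : ∀ j, Measurable[m] (dg j) := by
    intro j
    refine @measurable_to_countable' ℕ X _ _ m _ fun d => ?_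
    have : dg j ⁻¹' {d} = {e | e ∈ mDom g E T j ∧ (fun c => c / 2 = d) (sym (mMap g E T j e))} ∪
        ((mDom g E T j)ᶜ ∩ {_e | 0 = d}) := by
      ext e
      by_cases h : e ∈ mDom g E T j <;> simp [dg, h]
    rw [this]
    exact (hDv j (hEmm' j) fun c => c / 2 = d).union ((mDom_meas hmi j (hEmm' j) hTm').compl.inter
      (MeasurableSet.const _))
  have hR : ∀ k w, MeasurableSet[m] (R k w) := by
    intro k w
    have : R k w = M ∩ ((⋂ j : Fin k, E j) ∩ ((E k)ᶜ ∩ (Adm g M q Q k w ∩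
        {e | rankW {w | e ∈ Adm g M q Q k w} w = ∑ j ∈ Finset.range k, dg j e * Q ^ j}))) := by
      ext e
      constructor
      · rintro ⟨h1, h2, h3, h4, h5⟩
        exact ⟨h1, mem_iInter.2 fun j => h2 j j.2, h3, h4, h5⟩
      · rintro ⟨h1, h2, h3, h4, h5⟩
        exact ⟨h1, fun j hj => mem_iInter.1 h2 ⟨j, hj⟩, h3, h4, h5⟩
    rw [this]
    refine hMm.inter (MeasurableSet.inter (MeasurableSet.iInter fun j => hEmm _)
      ((hEmm k).compl.inter ((adm_meas hmi hMm hqm k w).inter ?_)))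
    refine measurableSet_eq_fun (rank_meas hmi hMm hqm k w) ?_
    exact Finset.measurable_sum _ fun j _ => (hdg j).mul_const _
  refine hcompl _ (⋃ i, cellE g M i ∩ (fun x => (g i)⁻¹ • x) ⁻¹'
    (⋃ k, ⋃ w : ℕ →₀ ℕ, ⋃ _ : w i = n, R k w)) ?_ ?_
  · refine hae ?_
    filter_upwards [hgood2, hcov] with x h1 h2
    have hC : ∀ i, x ∈ cellE g M i → (g i)⁻¹ • x ∈ cellC g M i := by
      intro i hi
      simpa [cellC] using hi
    simp only [mem_iUnion, mem_inter_iff, mem_preimage, mem_singleton_iff, exists_prop]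
    constructor
    · intro h
      obtain ⟨i, hi⟩ := h2
      exact ⟨i, hi, (h1 i i (hC i hi) n).2 (by simpa using h)⟩
    · rintro ⟨i, hi, h⟩
      simpa using (h1 i i (hC i hi) n).1 h
  · exact MeasurableSet.iUnion fun i => (cellE_meas hmi hMm i).inter (hmi.pre _
      (MeasurableSet.iUnion fun k => MeasurableSet.iUnion fun w =>
        MeasurableSet.iUnion fun _ => hR k w))

end Enc2

open MeasureTheory Set Function Filter Topology
open scoped ENNReal symmDiff

section Geom
variable {G X : Type*} [Group G] [MulAction G X] [mX : MeasurableSpace X] [StandardBorelSpace X]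
  {ν : Measure X} [IsProbabilityMeasure ν] [NullSingletonClass ν]

lemma core_geom (hp : IsPmp G ν) (he : IsErgodicInv G ν) {g : ℕ → G} (hg : Surjective g)
    (hg0 : g 0 = 1) {ε t c : ℝ} (hε : 0 < ε) (htε : t + ε < 1) (ht : 0 < t) (hc : 0 < c) :
    ∃ (K J n : ℕ) (M N : Set X), MeasurableSet M ∧ MeasurableSet N ∧
      ν M = ENNReal.ofReal (c / 2 ^ J) ∧ ν M ≠ 0 ∧ ν M ≤ ENNReal.ofReal ε ∧
      ν (spread g K M) ≤ ENNReal.ofReal ε ∧ ν N ≤ ENNReal.ofReal (2 * ε) ∧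
      Disjoint N (spread g K M) ∧
      (∀ H : Set X, spread g K M ⊆ H → Disjoint N H →
        coreS g K H = M ∧ ν (coreS g (K + 1) H) = 0) ∧
      ν (spread g n M \ spread g K M) ≤ ENNReal.ofReal t ∧
      ENNReal.ofReal t ≤ ν (spread g n M \ spread g K M) + ENNReal.ofReal ε := by
  classical
  obtain ⟨S, k0, hS, hSε, hk0, hSx⟩ := exists_syndetic hp he hg hg0
    (ε := ENNReal.ofReal ε) (by simpa using hε)
  obtain ⟨K, V0, hKk, hV0, hcore, hcore1⟩ := exists_V0 hp he hg hg0 hk0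
  have hK : 0 < K := hk0.trans_le hKk
  -- choose the tuning size
  obtain ⟨J, hJ1, hJ2⟩ : ∃ J : ℕ, ENNReal.ofReal (c / 2 ^ J) < ν (coreS g K V0) ∧
      c / 2 ^ J * ((K + 1 : ℕ) : ℝ) ^ 3 ≤ ε := by
    have h1 : Tendsto (fun J : ℕ => c / 2 ^ J) atTop (𝓝 0) := by
      have := (tendsto_pow_atTop_nhds_zero_of_lt_one (r := (1/2:ℝ)) (by norm_num)
        (by norm_num)).const_mul c
      rw [mul_zero] at this
      refine this.congr fun J => ?_
      rw [one_div, inv_pow]; rfl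
    have h2 : Tendsto (fun J : ℕ => ENNReal.ofReal (c / 2 ^ J)) atTop (𝓝 0) := by
      simpa using ENNReal.tendsto_ofReal h1
    have h3 : Tendsto (fun J : ℕ => c / 2 ^ J * ((K + 1 : ℕ) : ℝ) ^ 3) atTop (𝓝 0) := by
      simpa using h1.mul_const (((K + 1 : ℕ) : ℝ) ^ 3)
    obtain ⟨J, h4, h5⟩ := ((h2.eventually_lt_const (pos_iff_ne_zero.2 hcore)).and
      (h3.eventually_lt_const hε)).exists
    exact ⟨J, h4, h5.le⟩
  have hv0 : 0 < c / 2 ^ J := by positivity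
  obtain ⟨M, hM, hMv, hMc, hMV0⟩ := exists_tune hp hg0 hK hV0
    (v := ENNReal.ofReal (c / 2 ^ J)) (by simpa using hv0) hJ1
  set V := spread g K M with hV
  have hVm : MeasurableSet V := spread_meas hp.inv g K hM
  set v := c / 2 ^ J with hv
  have hK1 : (1:ℝ) ≤ ((K + 1 : ℕ) : ℝ) := by exact_mod_cast (by omega : 1 ≤ K + 1)
  have hKK : (K:ℝ) ≤ ((K + 1 : ℕ) : ℝ) := by exact_mod_cast (by omega : K ≤ K + 1)
  have hνV : ν V ≤ ENNReal.ofReal (((K + 1 : ℕ) : ℝ) * v) := by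
    refine (spread_measure hp g K hM).trans ?_
    rw [hMv, ENNReal.ofReal_mul (by positivity), ENNReal.ofReal_natCast]
    gcongr
    omega
  let g' : ℕ → G := fun n => (g n)⁻¹
  let nearV := spread g' K V
  have hnear : MeasurableSet nearV := spread_meas hp.inv g' K hVm
  let N2 := spread g (K + 1) nearV
  have hN2 : MeasurableSet N2 := spread_meas hp.inv g (K+1) hnear
  have hνN2 : ν N2 ≤ ENNReal.ofReal ε := by
    refine (spread_measure hp g (K+1) hnear).trans ?_
    refine le_trans ?_ (ENNReal.ofReal_le_ofReal hJ2)
    calc ((K + 1 : ℕ) : ℝ≥0∞) * ν nearV ≤ ((K + 1 : ℕ) : ℝ≥0∞) * (((K + 1 : ℕ) : ℝ≥0∞) *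
          ENNReal.ofReal (((K + 1 : ℕ) : ℝ) * v)) := by
          gcongr
          refine (spread_measure hp g' K hVm).trans ?_
          gcongr
          omega
      _ = ENNReal.ofReal (v * ((K + 1 : ℕ) : ℝ) ^ 3) := by
          rw [← ENNReal.ofReal_natCast, ← ENNReal.ofReal_mul (by positivity),
            ← ENNReal.ofReal_mul (by positivity)]
          congr 1; ring
  have hvε : v ≤ ε := by
    refine le_trans ?_ hJ2
    exact le_mul_of_one_le_right hv0.le (one_le_pow₀ hK1)
  have hνVε : ν V ≤ ENNReal.ofReal ε := by
    refine hνV.trans (ENNReal.ofReal_le_ofReal (le_trans ?_ hJ2))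
    rw [mul_comm]
    gcongr
    exact le_self_pow₀ hK1 (by norm_num)
  have hνM0 : ν M ≠ 0 := by rw [hMv]; simpa using hv0
  have hνMε : ν M ≤ ENNReal.ofReal ε := by
    rw [hMv]; exact ENNReal.ofReal_le_ofReal hvε
  -- choice of n
  have hlim : ν (⋃ n, spread g n M \ V) = ν Vᶜ := by
    have hg' : Surjective g' := fun k => by
      obtain ⟨n, hn⟩ := hg k⁻¹
      exact ⟨n, by simp [g', hn]⟩
    have h0 := erg_cover hp he hg' hM hνM0
    refine measure_congr (eventuallyEq_set.2 ?_)
    filter_upwards [measure_eq_zero_iff_ae_notMem.1 h0] with x hx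
    have hx' : ∃ l, (g l)⁻¹ • x ∈ M := by
      by_contra hh; push Not at hh; exact hx hh
    obtain ⟨l, hl⟩ := hx'
    constructor
    · intro h; obtain ⟨n, hn⟩ := mem_iUnion.1 h; exact hn.2
    · intro h; exact mem_iUnion.2 ⟨l + 1, ⟨l, Nat.lt_succ_self l, hl⟩, h⟩
  have hVc : ENNReal.ofReal t < ν Vᶜ := by
    rw [measure_compl hVm (measure_ne_top _ _), measure_univ]
    refine lt_of_lt_of_le ?_ (tsub_le_tsub_left hνVε 1)
    rw [lt_tsub_iff_right, ← ENNReal.ofReal_add ht.le hε.le, ← ENNReal.ofReal_one]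
    exact (ENNReal.ofReal_lt_ofReal_iff one_pos).2 htε
  have hmono : Monotone fun n => spread g n M \ V := by
    intro a b hab
    refine sdiff_subset_sdiff_left ?_
    rintro x ⟨l, hl, h⟩; exact ⟨l, hl.trans_le hab, h⟩
  have hex : ∃ n, ENNReal.ofReal t < ν (spread g n M \ V) := by
    rw [← hlim, hmono.measure_iUnion] at hVc
    exact lt_iSup_iff.1 hVc
  have hfind := Nat.find_spec hex
  have hne : Nat.find hex ≠ 0 := by
    intro h
    rw [h] at hfind
    have : spread g 0 M \ V = ∅ := by ext x; simp [spread]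
    rw [this, measure_empty] at hfind
    exact not_lt_bot hfind
  obtain ⟨n, hn⟩ := Nat.exists_eq_succ_of_ne_zero hne
  rw [hn] at hfind
  refine ⟨K, J, n, M, (S ∪ N2) \ V, hM, (hS.union hN2).diff hVm, hMv, hνM0, hνMε, hνVε, ?_,
    disjoint_sdiff_left, ?_, ?_, ?_⟩
  · refine (measure_mono sdiff_subset).trans ((measure_union_le _ _).trans ?_)
    rw [two_mul, ENNReal.ofReal_add hε.le hε.le]
    exact add_le_add hSε hνN2
  · intro H hVH hNH
    have key : ∀ x ∈ coreS g K H, ∀ l < K + 1, g l • x ∈ H → g l • x ∈ V := by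
      intro x hx l hl hlH
      obtain ⟨i, hi, hiS⟩ := hSx x
      have hiH := hx i (hi.trans_le hKk)
      have hiV : g i • x ∈ V := by
        by_contra h
        exact disjoint_left.1 hNH ⟨Or.inl hiS, h⟩ hiH
      have hxn : x ∈ nearV := ⟨i, hi.trans_le hKk, by simpa [g'] using hiV⟩
      by_contra h
      exact disjoint_left.1 hNH ⟨Or.inr ⟨l, hl, by simpa using hxn⟩, h⟩ hlH
    constructor
    · refine subset_antisymm ?_ ?_
      · intro x hx
        rw [← hMc]
        exact fun l hl => key x hx l (by omega) (hx l hl)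
      · rw [← hMc]
        exact fun x hx l hl => hVH (hx l hl)
    · refine measure_mono_null ?_ hcore1
      intro x hx l hl
      exact hMV0 (key x (coreS_anti g (Nat.le_succ K) H hx) l hl (hx l hl))
  · by_contra h
    exact Nat.find_min hex (by omega : n < Nat.find hex) (not_le.1 h)
  · refine hfind.le.trans ?_
    have : spread g n.succ M \ V ⊆ (spread g n M \ V) ∪ (fun y => (g n)⁻¹ • y) ⁻¹' M := by
      rintro x ⟨⟨l, hl, h⟩, h2⟩
      rcases Nat.lt_succ_iff_lt_or_eq.1 hl with h3 | rfl
      · exact Or.inl ⟨⟨l, h3, h⟩, h2⟩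
      · exact Or.inr h
    refine (measure_mono this).trans ((measure_union_le _ _).trans (add_le_add le_rfl ?_))
    rw [hp.measure_pre _ hM]
    exact hνMε

end Geom

open MeasureTheory Set Function Filter Topology
open scoped ENNReal symmDiff

section Slots
variable {G X : Type*} [Group G] [MulAction G X] {g : ℕ → G}

lemma exists_write [mX : MeasurableSpace X] (hm : InvariantAlg G mX) {E : ℕ → Set X}
    (hEm : ∀ j, MeasurableSet (E j)) {T : Set X} (hT : MeasurableSet T) {val : ℕ → X → ℕ}
    (hval : ∀ j, Measurable (val j)) :
    ∃ f : X → ℕ, Measurable f ∧ ∀ j, ∀ e ∈ mDom g E T j, f (mMap g E T j e) = val j e := by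
  classical
  let I : ℕ → Set X := fun j => mMap g E T j '' mDom g E T j
  have hI : ∀ j, MeasurableSet (I j) := fun j =>
    mImg_meas hm j (fun i _ => hEm i) hT (mDom_meas hm j (fun i _ => hEm i) hT) subset_rfl
  let p : ℕ → X → Prop := fun j y => y ∈ I j ∨ ∀ k, y ∉ I k
  have hp : ∀ y, ∃ k, p k y := by
    intro e
    by_cases h : ∃ k, e ∈ I k
    · obtain ⟨k, hk⟩ := h; exact ⟨k, Or.inl hk⟩
    · push Not at h; exact ⟨0, Or.inr h⟩
  let f : ℕ → X → ℕ := fun j y => val j (mInv g E T j y)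
  have hf : ∀ j, Measurable (f j) := fun j =>
    ((hval j).comp (mInv_meas hm j (fun i _ => hEm i) hT))
  refine ⟨fun y => f (Nat.find (hp y)) y, ?_, ?_⟩
  · refine Measurable.find hf (fun n => ?_) hp
    have : {x | p n x} = I n ∪ ⋂ k, (I k)ᶜ := by
      ext e; simp [p]
    rw [this]
    exact (hI n).union (MeasurableSet.iInter fun k => (hI k).compl)
  · intro j e he
    have hmem : mMap g E T j e ∈ I j := ⟨e, he, rfl⟩
    have hj : Nat.find (hp (mMap g E T j e)) = j := by
      rcases Nat.find_spec (hp (mMap g E T j e)) with ⟨e', he', h⟩ | h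
      · exact (mMap_disj g E T he' he h).1
      · exact absurd hmem (h j)
    simp only [hj, f]
    rw [mInv_mMap g E T he]

/-- heads all of whose slots are defined -/
def headD (g : ℕ → G) (T0 B : Set X) (ℓ : ℕ) : Set X :=
  {x | x ∈ T0 ∧ ∀ j < ℓ, x ∈ mDom g (fun _ => T0) B j}

/-- good heads -/
def headG (g : ℕ → G) (T0 B N : Set X) (ℓ : ℕ) : Set X :=
  {x | x ∈ headD g T0 B ℓ ∧ x ∉ N ∧ ∀ j < ℓ, mMap g (fun _ => T0) B j x ∉ N}

lemma headD_meas {m : MeasurableSpace X} (hm : InvariantAlg G m) {T0 B : Set X}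
    (hT : MeasurableSet[m] T0) (hB : MeasurableSet[m] B) (ℓ : ℕ) :
    MeasurableSet[m] (headD g T0 B ℓ) := by
  have : headD g T0 B ℓ = T0 ∩ ⋂ j : Fin ℓ, mDom g (fun _ => T0) B j := by
    ext x; simp [headD, Fin.forall_iff]
  rw [this]
  exact hT.inter (MeasurableSet.iInter fun j => mDom_meas hm j (fun _ _ => hT) hB)

lemma headG_meas {m : MeasurableSpace X} (hm : InvariantAlg G m) {T0 B N : Set X}
    (hT : MeasurableSet[m] T0) (hB : MeasurableSet[m] B) (hN : MeasurableSet[m] N) (ℓ : ℕ) :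
    MeasurableSet[m] (headG g T0 B N ℓ) := by
  have : headG g T0 B N ℓ = headD g T0 B ℓ ∩ (Nᶜ ∩ ⋂ j : Fin ℓ,
      (mMap g (fun _ => T0) B j ⁻¹' N)ᶜ) := by
    ext x; simp [headG, Fin.forall_iff]; tauto
  rw [this]
  exact (headD_meas hm hT hB ℓ).inter (hN.compl.inter (MeasurableSet.iInter fun j =>
    (mMap_meas hm j (fun _ _ => hT) hB hN).compl))

lemma headG_measure [mX : MeasurableSpace X] {ν : Measure X} [IsProbabilityMeasure ν]
    (hp : IsPmp G ν) (he : IsErgodicInv G ν) (hg : Surjective g) {T0 B N : Set X}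
    (hT : MeasurableSet T0) (hB : MeasurableSet B) (hN : MeasurableSet N) (ℓ : ℕ)
    (h : ℓ * ν T0 ≤ ν B) : ν T0 ≤ ν (headG g T0 B N ℓ) + (ℓ + 1 : ℕ) * ν N := by
  have hsub : T0 ⊆ headG g T0 B N ℓ ∪ ((⋃ j : Fin ℓ, T0 \ mDom g (fun _ => T0) B j) ∪
      (N ∪ ⋃ j : Fin ℓ, mDom g (fun _ => T0) B j ∩ mMap g (fun _ => T0) B j ⁻¹' N)) := by
    intro x hx
    by_cases h1 : ∀ j < ℓ, x ∈ mDom g (fun _ => T0) B j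
    · by_cases h2 : x ∈ N
      · exact Or.inr (Or.inr (Or.inl h2))
      by_cases h3 : ∀ j < ℓ, mMap g (fun _ => T0) B j x ∉ N
      · exact Or.inl ⟨⟨hx, h1⟩, h2, h3⟩
      · push Not at h3
        obtain ⟨j, hj, h3⟩ := h3
        exact Or.inr (Or.inr (Or.inr (mem_iUnion.2 ⟨⟨j, hj⟩, h1 j hj, h3⟩)))
    · push Not at h1
      obtain ⟨j, hj, h1⟩ := h1
      exact Or.inr (Or.inl (mem_iUnion.2 ⟨⟨j, hj⟩, hx, h1⟩))
  have hz : ν (⋃ j : Fin ℓ, T0 \ mDom g (fun _ => T0) B j) = 0 := by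
    refine measure_iUnion_null fun j => ?_
    refine mDom_conull hp he hg (A := fun _ => T0) (fun _ => hT) hB j ?_
    refine le_trans ?_ h
    rw [Finset.sum_const, Finset.card_range, nsmul_eq_mul]
    gcongr
    exact j.2
  refine (measure_mono hsub).trans ((measure_union_le _ _).trans (add_le_add le_rfl ?_))
  refine (measure_union_le _ _).trans ?_
  rw [hz, zero_add]
  refine (measure_union_le _ _).trans ?_
  push_cast
  rw [add_mul, one_mul, add_comm]
  refine add_le_add ?_ le_rfl
  refine (measure_iUnion_fintype_le _ _).trans ?_
  refine (Finset.sum_le_card_nsmul _ _ (ν N) fun j _ => ?_).trans (by simp)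
  have hDm : MeasurableSet (mDom g (fun _ => T0) B j ∩ mMap g (fun _ => T0) B j ⁻¹' N) :=
    (mDom_meas hp.inv j (fun _ _ => hT) hB).inter (mMap_meas hp.inv j (fun _ _ => hT) hB hN)
  rw [← mMap_measure_image hp (A := fun _ => T0) (fun _ => hT) hB j hDm inter_subset_left]
  refine measure_mono ?_
  rintro y ⟨x, hx, rfl⟩
  exact hx.2

lemma used_measure [mX : MeasurableSpace X] {ν : Measure X} [IsProbabilityMeasure ν]
    (hp : IsPmp G ν) {T0 B Tg : Set X}
    (hT : MeasurableSet T0) (hB : MeasurableSet B) {ℓ : ℕ} (hTg : MeasurableSet Tg)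
    (hsub : Tg ⊆ headD g T0 B ℓ) {U : X → Fin ℓ → ℕ} (hU : ∀ j, Measurable fun x => U x j)
    (i : ℕ) {r : ℝ≥0∞} (hr : ∀ x, ((Finset.univ.filter fun j => U x j = i).card : ℝ≥0∞) ≤ r) :
    ν (⋃ j : Fin ℓ, mMap g (fun _ => T0) B j '' (Tg ∩ {x | U x j = i})) ≤ r * ν Tg := by
  classical
  have hm : ∀ j, MeasurableSet {x | U x j = i} := fun j => hU j (measurableSet_singleton i)
  refine (measure_iUnion_fintype_le _ _).trans ?_
  have h1 : ∀ j : Fin ℓ, ν (mMap g (fun _ => T0) B j '' (Tg ∩ {x | U x j = i})) =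
      ∫⁻ x in Tg, {x | U x j = i}.indicator 1 x ∂ν := by
    intro j
    rw [mMap_measure_image hp (A := fun _ => T0) (fun _ => hT) hB j (hTg.inter (hm j))
      (fun x hx => (hsub hx.1).2 j j.2), lintegral_indicator_one (hm j),
      Measure.restrict_apply (hm j), inter_comm]
  simp_rw [h1]
  rw [← lintegral_finsetSum _ fun j _ => measurable_one.indicator (hm j)]
  calc ∫⁻ x in Tg, ∑ j : Fin ℓ, {x | U x j = i}.indicator 1 x ∂ν ≤ ∫⁻ _x in Tg, r ∂ν := by
        refine lintegral_mono fun x => le_trans (le_of_eq ?_) (hr x)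
        rw [Finset.card_filter]
        push_cast
        exact Finset.sum_congr rfl fun j _ => by by_cases h : U x j = i <;> simp [h]
    _ = r * ν Tg := by rw [setLIntegral_const]

end Slots

open MeasureTheory Set Function Filter Topology
open scoped ENNReal symmDiff

section Core
variable {G X : Type*} [Group G] [MulAction G X]

/-- the coding step -/
lemma core_code [mX : MeasurableSpace X] [StandardBorelSpace X]
    {ν : Measure X} [IsProbabilityMeasure ν] [NullSingletonClass ν] (hp : IsPmp G ν)
    {g : ℕ → G} {p : ℕ → ℝ}
    (hp0 : ∀ i, 0 ≤ p i) (hp1 : ∑' i, p i = 1) {a b : ℕ} (hab : a ≠ b)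
    {δ : ℝ} (hδ1 : δ < 1) {s : ℕ} (hs : 0 < s) {ℓ : ℕ} {𝒰 : Finset (Fin ℓ → ℕ)}
    (hU : ∀ u ∈ 𝒰, ∀ i, ((Finset.univ.filter fun j => u j = i).card : ℝ) ≤ (1 - δ) * p i * s)
    {V N T0 : Set X} (hV : MeasurableSet V) (hN : MeasurableSet N) (hT0 : MeasurableSet T0)
    (hNV : Disjoint N V) (hTV : Disjoint T0 V) {ε : ℝ}
    (hνV : ν V ≤ ENNReal.ofReal ε) (hνN : ν N ≤ ENNReal.ofReal (2 * ε))
    (hνT : ν T0 ≤ ENNReal.ofReal (1 / s)) (hε : 0 < ε)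
    (ha : 1 / s + ε ≤ δ * p a) (hb : 1 / s + 2 * ε ≤ δ * p b)
    {Q : ℕ} (hQ : 2 * Q ≤ 𝒰.card) {sym : X → ℕ} (hsm : Measurable sym) (hslt : ∀ x, sym x < 2 * Q) :
    ∃ α : X → ℕ, Measurable α ∧ (∀ i, ν (α ⁻¹' {i}) = ENNReal.ofReal (p i)) ∧
      V ⊆ α ⁻¹' {a} ∧ Disjoint N (α ⁻¹' {a}) ∧
      ∀ m : MeasurableSpace X, InvariantAlg G m → MeasurableSet[m] V → MeasurableSet[m] T0 →
        (∀ i, MeasurableSet[m] (α ⁻¹' {i})) →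
        MeasurableSet[m] (headG g T0 (Vᶜ \ T0) N ℓ) ∧
        ∀ c, MeasurableSet[m] (headG g T0 (Vᶜ \ T0) N ℓ ∩ sym ⁻¹' {c}) := by
  classical
  set B := Vᶜ \ T0 with hB
  have hBm : MeasurableSet B := hV.compl.diff hT0
  set Tg := headG g T0 B N ℓ with hTg
  have hTgm : MeasurableSet Tg := headG_meas hp.inv hT0 hBm hN ℓ
  have hQ0 : ∀ x : X, 0 < 𝒰.card := fun x => lt_of_lt_of_le ((Nat.zero_le _).trans_lt (hslt x)) hQ
  have hcard : 0 < 𝒰.card := by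
    have : Nonempty X := nonempty_of_isProbabilityMeasure ν
    exact hQ0 (Classical.arbitrary X)
  let u : ℕ → Fin ℓ → ℕ := fun c => (𝒰.equivFin.symm ⟨c % 𝒰.card, Nat.mod_lt _ hcard⟩ : Fin ℓ → ℕ)
  have hu : ∀ c, u c ∈ 𝒰 := fun c => (𝒰.equivFin.symm ⟨c % 𝒰.card, Nat.mod_lt _ hcard⟩).2
  have huinj : ∀ c c', c < 2 * Q → c' < 2 * Q → u c = u c' → c = c' := by
    intro c c' hc hc' h
    have h1 := 𝒰.equivFin.symm.injective (Subtype.ext h)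
    have h2 : c % 𝒰.card = c' % 𝒰.card := congrArg Fin.val h1
    rwa [Nat.mod_eq_of_lt (hc.trans_le hQ), Nat.mod_eq_of_lt (hc'.trans_le hQ)] at h2
  let val : ℕ → X → ℕ := fun j x => if h : j < ℓ then u (sym x) ⟨j, h⟩ else 0
  have hval : ∀ j, Measurable (val j) := fun j =>
    (measurable_from_top (f := fun c : ℕ => if h : j < ℓ then u c ⟨j, h⟩ else 0)).comp hsm
  obtain ⟨f, hf, hfv⟩ := exists_write (g := g) hp.inv (E := fun _ => T0) (fun _ => hT0) hBm hval
  let φ : ℕ → X → X := fun j => mMap g (fun _ => T0) B j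
  let α₀ : X → ℕ := fun y => if y ∈ V ∪ Tg then a else if y ∈ N ∪ T0 then b else f y
  have hα₀ : Measurable α₀ := Measurable.ite (hV.union hTgm) measurable_const
    (Measurable.ite (hN.union hT0) measurable_const hf)
  let Sl : Set X := ⋃ j : Fin ℓ, φ j '' Tg
  let R : Set X := V ∪ (N ∪ (T0 ∪ Sl))
  have hTgD : Tg ⊆ headD g T0 B ℓ := fun x hx => hx.1
  have hR : MeasurableSet R := hV.union (hN.union (hT0.union (MeasurableSet.iUnion fun j =>
    mImg_meas hp.inv j (fun _ _ => hT0) hBm hTgm (fun x hx => (hTgD hx).2 j j.2))))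
  -- values of α₀
  have v1 : ∀ y ∈ V, α₀ y = a := fun y hy => if_pos (Or.inl hy)
  have v2 : ∀ y ∈ Tg, α₀ y = a := fun y hy => if_pos (Or.inr hy)
  have v3 : ∀ y ∈ N, α₀ y = b := by
    intro y hy
    have h1 : y ∉ V ∪ Tg := by
      rintro (h | h)
      · exact disjoint_left.1 hNV hy h
      · exact h.2.1 hy
    simp only [α₀, if_neg h1]
    exact if_pos (Or.inl hy)
  have v4 : ∀ y ∈ T0, y ∉ Tg → α₀ y = b := by
    intro y hy hy'
    have h1 : y ∉ V ∪ Tg := by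
      rintro (h | h)
      · exact disjoint_left.1 hTV hy h
      · exact hy' h
    simp only [α₀, if_neg h1]
    exact if_pos (Or.inr hy)
  have v5 : ∀ x ∈ Tg, ∀ j : Fin ℓ, α₀ (φ j x) = u (sym x) j := by
    intro x hx j
    have hd := (hTgD hx).2 j j.2
    have hBx : φ j x ∈ B := mMap_mem g (fun _ => T0) B hd
    have h1 : φ j x ∉ V ∪ Tg := by
      rintro (h | h)
      · exact hBx.1 h
      · exact hBx.2 h.1.1
    have h2 : φ j x ∉ N ∪ T0 := by
      rintro (h | h)
      · exact hx.2.2 j j.2 h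
      · exact hBx.2 h
    simp only [α₀, if_neg h1, if_neg h2]
    rw [hfv j x hd]
    simp [val]
  have hs' : (0:ℝ) < s := by exact_mod_cast hs
  have hused : ∀ i, ν (⋃ j : Fin ℓ, φ j '' (Tg ∩ {x | u (sym x) j = i})) ≤
      ENNReal.ofReal ((1 - δ) * p i) := by
    intro i
    have := used_measure (ν := ν) (g := g) hp hT0 hBm hTgm hTgD (U := fun x => u (sym x))
      (fun j => (measurable_from_top (f := fun c : ℕ => u c j)).comp hsm) i
      (r := ENNReal.ofReal ((1 - δ) * p i * s)) (fun x => by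
        rw [← ENNReal.ofReal_natCast]
        exact ENNReal.ofReal_le_ofReal (hU _ (hu _) i))
    refine this.trans ?_
    calc _ ≤ ENNReal.ofReal ((1 - δ) * p i * s) * ENNReal.ofReal (1 / s) := by
          gcongr
          exact (measure_mono fun x hx => (hTgD hx).1).trans hνT
      _ = _ := by
          rw [← ENNReal.ofReal_mul (mul_nonneg (mul_nonneg (by linarith) (hp0 i)) hs'.le)]
          congr 1
          field_simp
  have hs1 : (0:ℝ) ≤ 1 / s := by positivity
  have hd0 : ∀ i, 0 ≤ (1 - δ) * p i := fun i => mul_nonneg (by linarith) (hp0 i)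
  have hle : ∀ i, ν (R ∩ α₀ ⁻¹' {i}) ≤ ENNReal.ofReal (p i) := by
    intro i
    have hslot : Sl ∩ α₀ ⁻¹' {i} ⊆ ⋃ j : Fin ℓ, φ j '' (Tg ∩ {x | u (sym x) j = i}) := by
      rintro y ⟨hy, hyi⟩
      obtain ⟨j, x, hx, rfl⟩ := mem_iUnion.1 hy
      refine mem_iUnion.2 ⟨j, x, ⟨hx, ?_⟩, rfl⟩
      have : α₀ (φ j x) = i := hyi
      rw [v5 x hx j] at this
      exact this
    by_cases hia : i = a
    · subst hia
      have hsub : R ∩ α₀ ⁻¹' {i} ⊆ V ∪ (T0 ∪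
          ⋃ j : Fin ℓ, φ j '' (Tg ∩ {x | u (sym x) j = i})) := by
        rintro y ⟨h | h | h | h, hy⟩
        · exact Or.inl h
        · have : α₀ y = i := hy
          rw [v3 y h] at this
          exact absurd this.symm hab
        · exact Or.inr (Or.inl h)
        · exact Or.inr (Or.inr (hslot ⟨h, hy⟩))
      refine (measure_mono hsub).trans ((measure_union_le _ _).trans
        ((add_le_add hνV ((measure_union_le _ _).trans (add_le_add hνT (hused i)))).trans ?_))
      rw [← ENNReal.ofReal_add hs1 (hd0 i), ← ENNReal.ofReal_add hε.le (add_nonneg hs1 (hd0 i))]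
      exact ENNReal.ofReal_le_ofReal (by linarith)
    by_cases hib : i = b
    · subst hib
      have hsub : R ∩ α₀ ⁻¹' {i} ⊆ N ∪ (T0 ∪
          ⋃ j : Fin ℓ, φ j '' (Tg ∩ {x | u (sym x) j = i})) := by
        rintro y ⟨h | h | h | h, hy⟩
        · have : α₀ y = i := hy
          rw [v1 y h] at this
          exact absurd this hab
        · exact Or.inl h
        · exact Or.inr (Or.inl h)
        · exact Or.inr (Or.inr (hslot ⟨h, hy⟩))
      refine (measure_mono hsub).trans ((measure_union_le _ _).trans
        ((add_le_add hνN ((measure_union_le _ _).trans (add_le_add hνT (hused i)))).trans ?_))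
      rw [← ENNReal.ofReal_add hs1 (hd0 i),
        ← ENNReal.ofReal_add (by linarith) (add_nonneg hs1 (hd0 i))]
      exact ENNReal.ofReal_le_ofReal (by linarith)
    · have hsub : R ∩ α₀ ⁻¹' {i} ⊆ ⋃ j : Fin ℓ, φ j '' (Tg ∩ {x | u (sym x) j = i}) := by
        rintro y ⟨h | h | h | h, hy⟩
        · have : α₀ y = i := hy
          rw [v1 y h] at this
          exact absurd this.symm hia
        · have : α₀ y = i := hy
          rw [v3 y h] at this
          exact absurd this.symm hib
        · have : α₀ y = i := hy
          by_cases h' : y ∈ Tg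
          · rw [v2 y h'] at this
            exact absurd this.symm hia
          · rw [v4 y h h'] at this
            exact absurd this.symm hib
        · exact hslot ⟨h, hy⟩
      refine (measure_mono hsub).trans ((hused i).trans (ENNReal.ofReal_le_ofReal ?_))
      have hδ0 : 0 ≤ δ := by
        by_contra hneg
        have := mul_nonpos_of_nonpos_of_nonneg (not_le.1 hneg).le (hp0 a)
        linarith
      nlinarith [hp0 i]
  have hsummable : Summable p := by
    by_contra hn
    rw [tsum_eq_zero_of_not_summable hn] at hp1
    exact zero_ne_one hp1
  obtain ⟨α, hα, hαR, hαν⟩ := exists_fill (ν := ν) hR hα₀ (P := fun i => ENNReal.ofReal (p i))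
    (by rw [← ENNReal.ofReal_tsum_of_nonneg hp0 hsummable, hp1, ENNReal.ofReal_one]) hle
  refine ⟨α, hα, hαν, ?_, ?_, ?_⟩
  · intro y hy
    show α y = a
    rw [hαR y (Or.inl hy), v1 y hy]
  · refine disjoint_left.2 fun y hy h => ?_
    have h : α y = a := h
    rw [hαR y (Or.inr (Or.inl hy)), v3 y hy] at h
    exact hab h.symm
  · intro m hm hVm hT0m hαm
    have hBm' : MeasurableSet[m] B := hVm.compl.diff hT0m
    have hTgm' : MeasurableSet[m] Tg := by
      have : Tg = headD g T0 B ℓ ∩ α ⁻¹' {a} := by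
        ext x
        constructor
        · intro hx
          refine ⟨hx.1, ?_⟩
          show α x = a
          rw [hαR x (Or.inr (Or.inr (Or.inl hx.1.1))), v2 x hx]
        · rintro ⟨hx, hxa⟩
          by_contra h
          have hxa : α x = a := hxa
          rw [hαR x (Or.inr (Or.inr (Or.inl hx.1))), v4 x hx.1 h] at hxa
          exact hab hxa.symm
      rw [this]
      exact (headD_meas hm hT0m hBm' ℓ).inter (hαm a)
    refine ⟨hTgm', fun c => ?_⟩
    by_cases hc : c < 2 * Q
    · have : Tg ∩ sym ⁻¹' {c} = Tg ∩ ⋂ j : Fin ℓ, φ j ⁻¹' (α ⁻¹' {u c j}) := by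
        ext x
        have hval : ∀ h : x ∈ Tg, ∀ j : Fin ℓ, α (φ j x) = u (sym x) j := by
          intro hx j
          rw [hαR _ (Or.inr (Or.inr (Or.inr (mem_iUnion.2 ⟨j, x, hx, rfl⟩)))), v5 x hx j]
        simp only [mem_inter_iff, mem_preimage, mem_singleton_iff, mem_iInter]
        refine and_congr_right fun hx => ?_
        constructor
        · rintro rfl j; exact hval hx j
        · intro h
          refine huinj _ _ (hslt x) hc (funext fun j => ?_)
          rw [← hval hx j, h j]
      rw [this]
      exact hTgm'.inter (MeasurableSet.iInter fun j =>
        mMap_meas hm j (fun _ _ => hT0m) hBm' (hαm _))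
    · have : Tg ∩ sym ⁻¹' {c} = ∅ := by
        ext x
        simp only [mem_inter_iff, mem_preimage, mem_singleton_iff, mem_empty_iff_false, iff_false]
        rintro ⟨-, rfl⟩
        exact hc (hslt x)
      rw [this]; exact MeasurableSet.empty

end Core

open MeasureTheory Set Function Filter Topology
open scoped ENNReal symmDiff

section CoreThm
variable {G X : Type*} [Group G] [MulAction G X]

set_option maxHeartbeats 1000000 in
theorem core {F : MeasurableSpace X} [mX : MeasurableSpace X] [StandardBorelSpace X]
    {ν : Measure X} [IsProbabilityMeasure ν] [NullSingletonClass ν] (hp : IsPmp G ν)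
    (he : IsErgodicInv G ν) {g : ℕ → G} (hg : Surjective g) (hg0 : g 0 = 1)
    (hF : F ≤ mX) {β : X → ℕ} (hβ : Measurable β) {p : ℕ → ℝ}
    (hp0 : ∀ i, 0 ≤ p i) (hp1 : ∑' i, p i = 1) {a b : ℕ} (hab : a ≠ b) (ha : 0 < p a) (hb : 0 < p b)
    (hent : condEnt F ν (fun i => β ⁻¹' {i}) < ∑' i, ENNReal.ofReal (Real.negMulLog (p i)))
    {c : ℝ} (hc : 0 < c) :
    ∃ α : X → ℕ, Measurable α ∧ (∀ i, ν (α ⁻¹' {i}) = ENNReal.ofReal (p i)) ∧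
      (∃ K J : ℕ, ν (coreS g K (α ⁻¹' {a})) = ENNReal.ofReal (c / 2 ^ J) ∧
        ν (coreS g (K + 1) (α ⁻¹' {a})) = 0) ∧
      ∀ m : MeasurableSpace X, InvariantAlg G m → F ≤ m →
        (∀ A B : Set X, A =ᵐ[ν] B → MeasurableSet[m] B → MeasurableSet[m] A) →
        (∀ i, MeasurableSet[m] (α ⁻¹' {i})) → ∀ n, MeasurableSet[m] (β ⁻¹' {n}) := by
  classical
  obtain ⟨q, hqF, hq0, hq1, hqpos, hqJ⟩ := exists_info (ν := ν) hF hβ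
  set h := condEnt F ν (fun i => β ⁻¹' {i}) with hh
  obtain ⟨δ, h', hδ0, hδ1, hh'0, hlt, hcap⟩ := exists_capacity hp0 hp1 hent
  have hfin : h ≠ ∞ := (hlt.trans ENNReal.ofReal_lt_top).ne
  set hr := h.toReal with hhr
  have hhr0 : 0 ≤ hr := ENNReal.toReal_nonneg
  have hhe : h = ENNReal.ofReal hr := (ENNReal.ofReal_toReal hfin).symm
  have hrlt : hr < h' := by
    rw [hhe] at hlt; exact (ENNReal.ofReal_lt_ofReal_iff hh'0).1 hlt
  set h2 := (hr + h') / 2 with hh2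
  have h2pos : 0 < h2 := by linarith
  set κ := 1 - hr / h2 with hκ
  have hκ0 : 0 < κ := by
    have : hr / h2 < 1 := (div_lt_one h2pos).2 (by linarith)
    linarith
  have hple : ∀ i, p i ≤ 1 := by
    have hsum : Summable p := by
      by_contra hn
      rw [tsum_eq_zero_of_not_summable hn] at hp1
      exact zero_ne_one hp1
    exact fun i => hp1 ▸ hsum.le_tsum i (fun j _ => hp0 j)
  have hpa := hple a
  -- choice of s
  obtain ⟨s, ⟨ℓ, 𝒰, hℓ, hU, hcardU⟩, hs1, hsa, hsb, hsL⟩ : ∃ s : ℕ,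
      (∃ (ℓ : ℕ) (𝒰 : Finset (Fin ℓ → ℕ)), (ℓ : ℝ) ≤ (1 - δ) * s ∧
        (∀ u ∈ 𝒰, ∀ i, ((Finset.univ.filter fun j => u j = i).card : ℝ) ≤ (1 - δ) * p i * s) ∧
        Real.exp (s * h') ≤ 𝒰.card) ∧ 0 < s ∧ 1 / (s:ℝ) < δ * p a / 2 ∧ 1 / (s:ℝ) < δ * p b / 2 ∧
        Real.log 4 / (h' - h2) ≤ s := by
    have l1 := tendsto_one_div_atTop_nhds_zero_nat (𝕜 := ℝ)
    have l2 : Tendsto (fun s : ℕ => (s:ℝ)) atTop atTop := tendsto_natCast_atTop_atTop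
    obtain ⟨s, h1, h2, h3, h4, h5⟩ := (hcap.and ((eventually_gt_atTop 0).and
      ((l1.eventually_lt_const (show (0:ℝ) < δ * p a / 2 by positivity)).and
      ((l1.eventually_lt_const (show (0:ℝ) < δ * p b / 2 by positivity)).and
      (l2.eventually_ge_atTop (Real.log 4 / (h' - h2))))))).exists
    exact ⟨s, h1, h2, h3, h4, h5⟩
  have hs0 : (0:ℝ) < s := by exact_mod_cast hs1
  have hsL' : Real.log 4 ≤ s * (h' - h2) := by
    rwa [div_le_iff₀ (by linarith)] at hsL
  have hcard4 : 4 ≤ 𝒰.card := by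
    have : (4:ℝ) ≤ 𝒰.card := by
      refine le_trans ?_ hcardU
      rw [← Real.log_le_iff_le_exp (by norm_num)]
      nlinarith
    exact_mod_cast this
  set Q := 𝒰.card / 2 with hQ
  have hQ2 : 2 ≤ Q := by omega
  have hQle : 2 * Q ≤ 𝒰.card := by omega
  have hlogQ : s * h2 ≤ Real.log Q := by
    have h4 : (𝒰.card : ℝ) ≤ 4 * Q := by exact_mod_cast (by omega : 𝒰.card ≤ 4 * Q)
    have hQpos : (0:ℝ) < Q := by exact_mod_cast (by omega : 0 < Q)
    have h5 : s * h' ≤ Real.log (4 * Q) := by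
      rw [Real.le_log_iff_exp_le (by positivity)]
      exact hcardU.trans h4
    rw [Real.log_mul (by norm_num) hQpos.ne'] at h5
    linarith
  -- choice of ε
  set ε := min (δ * p a / 2) (min (δ * p b / 4) (κ / (6 * s ^ 2))) with hεdef
  have hε : 0 < ε := by
    refine lt_min (by positivity) (lt_min (by positivity) (by positivity))
  have hεa : ε ≤ δ * p a / 2 := min_le_left _ _
  have hεb : ε ≤ δ * p b / 4 := (min_le_right _ _).trans (min_le_left _ _)
  have hεκ : ε ≤ κ / (6 * s ^ 2) := (min_le_right _ _).trans (min_le_right _ _)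
  have hδa : δ * p a ≤ δ := mul_le_of_le_one_right hδ0.le hpa
  obtain ⟨K, J, n, M, N, hM, hN, hMν, hM0, hMε, hVε, hNε, hNV, hH, hT1, hT2⟩ :=
    core_geom hp he hg hg0 (ε := ε) (t := 1 / s) (c := c) hε (by linarith) (by positivity) hc
  set V := spread g K M with hV
  have hVm : MeasurableSet V := spread_meas hp.inv g K hM
  set T0 := spread g n M \ V with hT0
  have hT0m : MeasurableSet T0 := (spread_meas hp.inv g n hM).diff hVm
  have hTV : Disjoint T0 V := disjoint_sdiff_left
  have hBm : MeasurableSet (Vᶜ \ T0) := hVm.compl.diff hT0m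
  -- room for slots
  have hroom : ℓ * ν T0 ≤ ν (Vᶜ \ T0) := by
    have h1 : (1:ℝ≥0∞) ≤ ENNReal.ofReal ε + (ENNReal.ofReal (1 / s) + ν (Vᶜ \ T0)) := by
      rw [← measure_univ (μ := ν)]
      refine (measure_mono (?_ : univ ⊆ V ∪ (T0 ∪ (Vᶜ \ T0)))).trans
        ((measure_union_le _ _).trans (add_le_add hVε
          ((measure_union_le _ _).trans (add_le_add hT1 le_rfl))))
      intro x _
      by_cases hx : x ∈ V
      · exact Or.inl hx
      by_cases hx' : x ∈ T0
      · exact Or.inr (Or.inl hx')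
      · exact Or.inr (Or.inr ⟨hx, hx'⟩)
    rw [← ENNReal.ofReal_toReal (measure_ne_top ν (Vᶜ \ T0))] at h1 ⊢
    set r := (ν (Vᶜ \ T0)).toReal
    have hr0 : 0 ≤ r := ENNReal.toReal_nonneg
    rw [← ENNReal.ofReal_add (by positivity) hr0, ← ENNReal.ofReal_add hε.le (by positivity),
      ← ENNReal.ofReal_one, ENNReal.ofReal_le_ofReal_iff (by positivity)] at h1
    calc (ℓ:ℝ≥0∞) * ν T0 ≤ ℓ * ENNReal.ofReal (1 / s) := by gcongr
      _ = ENNReal.ofReal (ℓ * (1 / s)) := by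
          rw [ENNReal.ofReal_mul (by positivity), ENNReal.ofReal_natCast]
      _ ≤ ENNReal.ofReal r := by
          refine ENNReal.ofReal_le_ofReal ?_
          have : (ℓ:ℝ) * (1 / s) ≤ 1 - δ := by
            rw [mul_one_div, div_le_iff₀ hs0]; exact hℓ
          linarith
  have hTg := headG_measure hp he hg hT0m hBm hN ℓ hroom
  set Tg := headG g T0 (Vᶜ \ T0) N ℓ with hTgdef
  have hTgm : MeasurableSet Tg := headG_meas hp.inv hT0m hBm hN ℓ
  have hTm : ν M + h / ENNReal.ofReal (Real.log Q) ≤ ν Tg := by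
    have hlogpos : 0 < Real.log Q := lt_of_lt_of_le (by positivity) hlogQ
    have h1 : ENNReal.ofReal (1 / s) ≤ ν Tg +
        (ℓ + 1 : ℕ) * ENNReal.ofReal (2 * ε) + ENNReal.ofReal ε := by
      refine hT2.trans (add_le_add (hTg.trans ?_) le_rfl)
      gcongr
    rw [← ENNReal.ofReal_toReal (measure_ne_top ν Tg)] at h1 ⊢
    set r := (ν Tg).toReal
    have hr0 : 0 ≤ r := ENNReal.toReal_nonneg
    rw [← ENNReal.ofReal_natCast, ← ENNReal.ofReal_mul (by positivity),
      ← ENNReal.ofReal_add hr0 (by positivity), ← ENNReal.ofReal_add (by positivity) hε.le,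
      ENNReal.ofReal_le_ofReal_iff (by positivity)] at h1
    refine (add_le_add hMε le_rfl).trans ?_
    rw [hhe, ← ENNReal.ofReal_div_of_pos hlogpos, ← ENNReal.ofReal_add hε.le (by positivity)]
    refine ENNReal.ofReal_le_ofReal ?_
    have h3 : hr / Real.log Q ≤ hr / (s * h2) := by gcongr
    have h4 : hr / (s * h2) = (1 - κ) / s := by
      rw [hκ]; field_simp; ring
    have h5 : ((ℓ + 1 : ℕ) : ℝ) ≤ 2 * s := by
      push_cast
      have : (1:ℝ) ≤ s := by exact_mod_cast hs1
      nlinarith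
    have h6 : 6 * s * ε ≤ κ / s := by
      rw [le_div_iff₀ hs0]
      rw [le_div_iff₀ (by positivity)] at hεκ
      nlinarith
    have h7 : (1 - κ) / s = 1 / s - κ / s := by ring
    have hs1' : (1:ℝ) ≤ s := by exact_mod_cast hs1
    have h8 : ((ℓ + 1 : ℕ) : ℝ) * (2 * ε) ≤ 2 * s * (2 * ε) :=
      mul_le_mul_of_nonneg_right h5 (by linarith)
    have h9 : ε ≤ s * ε := le_mul_of_one_le_left hε.le hs1'
    have h10 : 2 * s * (2 * ε) = 4 * (s * ε) := by ring
    have h11 : 6 * s * ε = 6 * (s * ε) := by ring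
    linarith
  obtain ⟨sym, hsm, hslt, hdec⟩ := enc hp he hg hM hM0 hF hqF hq0 hq1 hqpos hβ hQ2
    (by rw [hqJ]; exact hfin) hTgm (by rw [hqJ]; exact hTm)
  obtain ⟨α, hα, hαν, hαV, hαN, hαm⟩ := core_code (g := g) hp hp0 hp1 hab hδ1 hs1 hU hVm hN hT0m
    hNV hTV hVε hNε hT1 hε (by linarith) (by linarith) hQle hsm hslt
  obtain ⟨hc1, hc2⟩ := hH _ hαV hαN
  refine ⟨α, hα, hαν, ⟨K, J, by rw [hc1, hMν], hc2⟩, ?_⟩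
  intro m hmi hFm hcomp hαmeas
  have hMm : MeasurableSet[m] M := by
    rw [← hc1]; exact coreS_meas hmi g K (hαmeas a)
  have hVm' : MeasurableSet[m] V := spread_meas hmi g K hMm
  have hT0m' : MeasurableSet[m] T0 := (spread_meas hmi g n hMm).diff hVm'
  obtain ⟨h1, h2⟩ := hαm m hmi hVm' hT0m' hαmeas
  exact hdec m hmi hFm hcomp hMm h1 h2

end CoreThm

open MeasureTheory Set Function Filter Topology
open scoped ENNReal symmDiff

section Univ

lemma exists_univ_set (Y : Type*) [MeasurableSpace Y] [MeasurableSpace.CountablyGenerated Y] :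
    ∃ U : Set ((ℕ → ℕ) × Y), MeasurableSet U ∧ ∀ (ν : Measure Y) [IsFiniteMeasure ν] (D : Set Y),
      MeasurableSet D → ∃ z, D =ᵐ[ν] {y | (z, y) ∈ U} := by
  classical
  set 𝒞 := MeasurableSpace.countableGeneratingSet Y with h𝒞
  have h𝒞c : 𝒞.Countable := MeasurableSpace.countable_countableGeneratingSet
  have hgen : MeasurableSpace.generateFrom 𝒞 = ‹MeasurableSpace Y› :=
    MeasurableSpace.generateFrom_countableGeneratingSet
  set 𝒜 := generateSetAlgebra 𝒞 with h𝒜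
  have h𝒜c : 𝒜.Countable := countable_generateSetAlgebra h𝒞c
  have h𝒜alg : IsSetAlgebra 𝒜 := isSetAlgebra_generateSetAlgebra
  have hgen' : ‹MeasurableSpace Y› = MeasurableSpace.generateFrom 𝒜 := by
    rw [h𝒜, generateFrom_generateSetAlgebra_eq, hgen]
  obtain ⟨A, hA⟩ := h𝒜c.exists_eq_range ⟨∅, h𝒜alg.empty_mem⟩
  have hAm : ∀ n, MeasurableSet (A n) := by
    intro n
    rw [hgen']
    exact MeasurableSpace.measurableSet_generateFrom (hA ▸ mem_range_self n)
  refine ⟨⋂ n, ⋃ m, {w | n ≤ m ∧ w.2 ∈ A (w.1 m)}, ?_, ?_⟩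
  · refine MeasurableSet.iInter fun n => MeasurableSet.iUnion fun m => ?_
    have : {w : (ℕ → ℕ) × Y | n ≤ m ∧ w.2 ∈ A (w.1 m)} =
        ⋃ k, {_w | n ≤ m} ∩ ({w | w.1 m = k} ∩ {w | w.2 ∈ A k}) := by
      ext w; simp
    rw [this]
    refine MeasurableSet.iUnion fun k => (MeasurableSet.const _).inter (MeasurableSet.inter ?_ ?_)
    · have hh : Measurable fun w : (ℕ → ℕ) × Y => w.1 m :=
        (measurable_pi_apply m).comp measurable_fst
      exact hh (measurableSet_singleton k)
    · exact measurable_snd (hAm k)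
  · intro ν _ D hD
    have hdense := Measure.MeasureDense.of_generateFrom_isSetAlgebra_finite (μ := ν) h𝒜alg hgen'
    have hch : ∀ n : ℕ, ∃ k, ν (D ∆ A k) < ENNReal.ofReal ((1/2) ^ n) := by
      intro n
      obtain ⟨t, ht, ht'⟩ := hdense.approx D hD (measure_ne_top _ _) ((1/2)^n) (by positivity)
      rw [hA] at ht
      obtain ⟨k, rfl⟩ := ht
      exact ⟨k, ht'⟩
    choose z hz using hch
    refine ⟨z, eventuallyEq_set.2 ?_⟩
    have hBC : ∀ᵐ y ∂ν, {n | y ∈ D ∆ A (z n)}.Finite := by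
      refine ae_finite_setOf_mem ?_
      refine ne_top_of_le_ne_top ?_ (ENNReal.tsum_le_tsum fun n => (hz n).le)
      rw [← ENNReal.ofReal_tsum_of_nonneg (fun n => by positivity) summable_geometric_two]
      exact ENNReal.ofReal_ne_top
    filter_upwards [hBC] with y hy
    obtain ⟨N, hN⟩ := hy.bddAbove
    have hN' : ∀ n, N < n → (y ∈ D ↔ y ∈ A (z n)) := by
      intro n hn
      by_contra h
      have : y ∈ D ∆ A (z n) := by
        rw [mem_symmDiff]; tauto
      exact absurd (hN this) (not_le.2 hn)
    simp only [mem_ofPred_eq, mem_iInter, mem_iUnion]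
    constructor
    · intro h n
      exact ⟨max n (N + 1), le_max_left _ _,
        (hN' _ (lt_of_lt_of_le (Nat.lt_succ_self N) (le_max_right _ _))).1 h⟩
    · intro h
      obtain ⟨m, hm, hm'⟩ := h (N + 1)
      exact (hN' m hm).2 hm'

lemma exists_univ_fun (Y : Type*) [MeasurableSpace Y] [MeasurableSpace.CountablyGenerated Y] :
    ∃ f : (ℕ → ℕ → ℕ) × Y → ℕ, Measurable f ∧ ∀ (ν : Measure Y) [IsFiniteMeasure ν] (α : Y → ℕ),
      Measurable α → ∃ z, ∀ᵐ y ∂ν, α y = f (z, y) := by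
  classical
  obtain ⟨U, hU, hUz⟩ := exists_univ_set Y
  let p : ℕ → (ℕ → ℕ → ℕ) × Y → Prop := fun i w => (w.1 i, w.2) ∈ U ∨ ∀ k, (w.1 k, w.2) ∉ U
  have hp : ∀ w, ∃ i, p i w := by
    intro w
    by_cases h : ∃ k, (w.1 k, w.2) ∈ U
    · obtain ⟨k, hk⟩ := h; exact ⟨k, Or.inl hk⟩
    · push Not at h; exact ⟨0, Or.inr h⟩
  have hUi : ∀ i, MeasurableSet {w : (ℕ → ℕ → ℕ) × Y | (w.1 i, w.2) ∈ U} := fun i =>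
    (((measurable_pi_apply i).comp measurable_fst).prodMk measurable_snd) hU
  refine ⟨fun w => Nat.find (hp w), measurable_find hp fun i => ?_, ?_⟩
  · have : {w | p i w} = {w | (w.1 i, w.2) ∈ U} ∪ ⋂ k, {w | (w.1 k, w.2) ∈ U}ᶜ := by
      ext w; simp [p]
    rw [this]
    exact (hUi i).union (MeasurableSet.iInter fun k => (hUi k).compl)
  · intro ν _ α hα
    choose z hz using fun i => hUz ν (α ⁻¹' {i}) (hα (measurableSet_singleton i))
    refine ⟨z, ?_⟩
    have : ∀ᵐ y ∂ν, ∀ i, y ∈ α ⁻¹' {i} ↔ (z i, y) ∈ U := by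
      rw [ae_all_iff]; intro i
      exact eventuallyEq_set.1 (hz i)
    filter_upwards [this] with y hy
    have h1 : ∀ i, (z i, y) ∈ U → α y = i := fun i hi => (hy i).2 hi
    rcases Nat.find_spec (hp (z, y)) with h | h
    · exact h1 _ h
    · exact absurd ((hy (α y)).1 rfl) (h _)

end Univ

open MeasureTheory Set Function Filter Topology
open scoped ENNReal symmDiff

section Sect

lemma find_sel {W : Type*} [MeasurableSpace W] (E : ℕ → Set W) (hE : ∀ k, MeasurableSet (E k)) :
    ∃ c : W → ℕ, Measurable c ∧ ∀ w, (∃ k, w ∈ E k) → w ∈ E (c w) := by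
  classical
  have hp : ∀ w, ∃ i, w ∈ E i ∨ ∀ k, w ∉ E k := by
    intro w
    by_cases h : ∃ k, w ∈ E k
    · obtain ⟨k, hk⟩ := h; exact ⟨k, Or.inl hk⟩
    · push Not at h; exact ⟨0, Or.inr h⟩
  refine ⟨fun w => Nat.find (hp w), measurable_find hp fun i => ?_, ?_⟩
  · have : {w | w ∈ E i ∨ ∀ k, w ∉ E k} = E i ∪ ⋂ k, (E k)ᶜ := by
      ext w; simp
    rw [this]
    exact (hE i).union (MeasurableSet.iInter fun k => (hE k).compl)
  · rintro w ⟨k, hk⟩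
    rcases Nat.find_spec (hp w) with h | h
    · exact h
    · exact absurd hk (h k)

lemma isClosed_cyl (n : ℕ) (l : List ℕ) :
    IsClosed {z : ℕ → ℕ | (List.range n).map z = l} := by
  induction n generalizing l with
  | zero =>
    by_cases hl : l = []
    · subst hl; simp
    · have : {z : ℕ → ℕ | (List.range 0).map z = l} = ∅ := by
        ext z; simp [hl]
      rw [this]; exact isClosed_empty
  | succ n ih =>
    rcases List.eq_nil_or_concat' l with rfl | ⟨l', k, rfl⟩
    · simp [List.range_succ]
    · have : {z : ℕ → ℕ | (List.range (n+1)).map z = l' ++ [k]} =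
          {z | (List.range n).map z = l'} ∩ {z | z n = k} := by
        ext z
        simp only [List.range_succ, List.map_append, List.map_cons, List.map_nil, mem_setOf_eq,
          mem_inter_iff]
        constructor
        · intro h
          have := List.append_inj' h rfl
          simpa using this
        · rintro ⟨h, h'⟩
          rw [h, h']
      rw [this]
      refine (ih l').inter ?_
      exact isClosed_eq (continuous_apply n) continuous_const

lemma compact_section {h : (ℕ → ℕ) → ℝ} (hh : Continuous h) {K : Set (ℕ → ℕ)} (hK : IsCompact K) :
    ∃ σ : ℝ → ℕ → ℕ, Measurable σ ∧ ∀ r ∈ h '' K, h (σ r) = r := by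
  classical
  let E : List ℕ → Set ℝ := fun l => h '' (K ∩ {z | (List.range l.length).map z = l})
  have hE : ∀ l, MeasurableSet (E l) := fun l =>
    ((hK.inter_right (isClosed_cyl _ l)).image hh).isClosed.measurableSet
  choose c hc hc' using fun l : List ℕ => find_sel (fun k => E (l ++ [k])) (fun k => hE _)
  let L : ℝ → ℕ → List ℕ := fun r n => Nat.rec [] (fun _ l => l ++ [c l r]) n
  have L0 : ∀ r, L r 0 = [] := fun r => rfl
  have LS : ∀ r n, L r (n+1) = L r n ++ [c (L r n) r] := fun r n => rfl
  let b : ℝ → ℕ → ℕ := fun r n => c (L r n) r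
  have hLb : ∀ r n, L r n = (List.range n).map (b r) := by
    intro r n
    induction n with
    | zero => rfl
    | succ n ih => rw [LS, List.range_succ, List.map_append, ← ih]; rfl
  have hlen : ∀ r n, (L r n).length = n := by
    intro r n; rw [hLb]; simp
  have hLm : ∀ n l, MeasurableSet {r | L r n = l} := by
    intro n
    induction n with
    | zero =>
      intro l
      have : {r | L r 0 = l} = {_r | [] = l} := rfl
      rw [this]; exact MeasurableSet.const _
    | succ n ih =>
      intro l
      have : {r | L r (n+1) = l} = ⋃ l', {r | L r n = l'} ∩ {r | l' ++ [c l' r] = l} := by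
        ext r; simp [LS]
      rw [this]
      refine MeasurableSet.iUnion fun l' => (ih l').inter ?_
      have : {r | l' ++ [c l' r] = l} = c l' ⁻¹' {k | l' ++ [k] = l} := rfl
      rw [this]
      exact hc l' (MeasurableSet.of_discrete)
  refine ⟨b, ?_, ?_⟩
  · refine measurable_pi_iff.2 fun n => measurable_to_countable' fun k => ?_
    have : (fun r => b r n) ⁻¹' {k} = ⋃ l', {r | L r n = l'} ∩ c l' ⁻¹' {k} := by
      ext r; simp [b]
    rw [this]
    exact MeasurableSet.iUnion fun l' => (hLm n l').inter (hc l' (measurableSet_singleton k))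
  · intro r hr
    have hind : ∀ n, r ∈ E (L r n) := by
      intro n
      induction n with
      | zero => rw [L0]; simpa [E] using hr
      | succ n ih =>
        rw [LS]
        apply hc' (L r n) r
        obtain ⟨z, ⟨hzK, hz⟩, hzr⟩ := ih
        refine ⟨z n, z, ⟨hzK, ?_⟩, hzr⟩
        simp only [mem_setOf_eq, hlen] at hz
        simp only [mem_setOf_eq, List.length_append, hlen, List.length_singleton,
          List.range_succ, List.map_append, hz, List.map_cons, List.map_nil]
    choose z hz hzr using hind
    have hzb : ∀ n, ∀ i < n, z n i = b r i := by
      intro n i hi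
      have := (hz n).2
      simp only [mem_setOf_eq, hlen] at this
      rw [hLb r n, List.map_inj_left] at this
      exact this i (List.mem_range.2 hi)
    have hlim : Tendsto z atTop (𝓝 (b r)) := by
      rw [tendsto_pi_nhds]
      intro i
      refine tendsto_const_nhds.congr' ?_
      filter_upwards [eventually_gt_atTop i] with n hn
      exact (hzb n i hn).symm
    have h1 := (hh.tendsto (b r)).comp hlim
    have h2 : h ∘ z = fun _ => r := funext hzr
    rw [h2] at h1
    exact (tendsto_nhds_unique h1 tendsto_const_nhds)

lemma exists_compact_mass {h : (ℕ → ℕ) → ℝ} (hh : Continuous h) (ρ : Measure ℝ)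
    [IsFiniteMeasure ρ] {t : ℝ≥0∞} (ht : t < ρ (range h)) :
    ∃ K : Set (ℕ → ℕ), IsCompact K ∧ t ≤ ρ (h '' K) := by
  classical
  have step : ∀ (S : {S : Set (ℕ → ℕ) // t < ρ (h '' S)}) (n : ℕ),
      ∃ m : ℕ, t < ρ (h '' (S.1 ∩ {z | z n ≤ m})) := by
    rintro ⟨S, hS⟩ n
    have hmono : Monotone fun m : ℕ => h '' (S ∩ {z | z n ≤ m}) := by
      intro m m' hm
      exact image_mono (inter_subset_inter_right _ fun z (hz : z n ≤ m) => hz.trans hm)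
    have hU : ⋃ m : ℕ, h '' (S ∩ {z | z n ≤ m}) = h '' S := by
      rw [← image_iUnion, ← inter_iUnion]
      congr 1
      refine inter_eq_left.2 fun z _ => mem_iUnion.2 ⟨z n, le_refl (z n)⟩
    have h1 := hmono.measure_iUnion (μ := ρ)
    rw [hU] at h1
    rw [h1] at hS
    exact lt_iSup_iff.1 hS
  choose m hm using step
  let T : ℕ → {S : Set (ℕ → ℕ) // t < ρ (h '' S)} := fun n =>
    Nat.rec ⟨univ, by rwa [image_univ]⟩ (fun n S => ⟨S.1 ∩ {z | z n ≤ m S n}, hm S n⟩) n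
  let M : ℕ → ℕ := fun n => m (T n) n
  have hT0 : (T 0).1 = univ := rfl
  have hTS : ∀ n, (T (n+1)).1 = (T n).1 ∩ {z | z n ≤ M n} := fun n => rfl
  have hT : ∀ n, (T n).1 = {z | ∀ i < n, z i ≤ M i} := by
    intro n
    induction n with
    | zero => rw [hT0]; simp
    | succ n ih =>
      rw [hTS, ih]; ext z
      simp only [mem_inter_iff, mem_setOf_eq, Nat.lt_succ_iff_lt_or_eq]
      constructor
      · rintro ⟨h1, h2⟩ i (hi | rfl)
        · exact h1 i hi
        · exact h2
      · intro h1
        exact ⟨fun i hi => h1 i (Or.inl hi), h1 n (Or.inr rfl)⟩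
  have hanti : Antitone fun n => (T n).1 := by
    refine antitone_nat_of_succ_le fun n => ?_
    rw [hTS]; exact inter_subset_left
  set K : Set (ℕ → ℕ) := Set.pi univ fun i => Iic (M i) with hKdef
  have hK : IsCompact K := isCompact_univ_pi fun i => (finite_Iic (M i)).isCompact
  refine ⟨K, hK, ?_⟩
  have hsub : ⋂ n, closure (h '' (T n).1) ⊆ h '' K := by
    intro r hr
    rw [mem_iInter] at hr
    have : ∀ n : ℕ, ∃ z ∈ (T n).1, dist r (h z) < 1 / ((n : ℝ) + 1) := by
      intro n
      obtain ⟨y, ⟨z, hz, rfl⟩, hy⟩ := Metric.mem_closure_iff.1 (hr n) (1 / ((n : ℝ) + 1))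
        (by positivity)
      exact ⟨z, hz, hy⟩
    choose z hz hzr using this
    let z' : ℕ → ℕ → ℕ := fun n i => min (z n i) (M i)
    have hz' : ∀ n, z' n ∈ K := fun n i _ => mem_Iic.2 (min_le_right (z n i) (M i))
    obtain ⟨w, hw, φ, hφ, hlim⟩ := hK.tendsto_subseq hz'
    have hlim2 : Tendsto (z ∘ φ) atTop (𝓝 w) := by
      rw [tendsto_pi_nhds] at hlim ⊢
      intro i
      refine (hlim i).congr' ?_
      filter_upwards [hφ.tendsto_atTop.eventually (eventually_gt_atTop i)] with n hn
      have := hz (φ n)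
      rw [hT] at this
      exact min_eq_left (this i hn)
    have h1 : Tendsto (fun n => h (z (φ n))) atTop (𝓝 (h w)) := (hh.tendsto w).comp hlim2
    have h2 : Tendsto (fun n => h (z n)) atTop (𝓝 r) := by
      rw [tendsto_iff_dist_tendsto_zero]
      refine squeeze_zero (fun _ => dist_nonneg) (fun n => ?_) tendsto_one_div_add_atTop_nhds_zero_nat
      rw [dist_comm]; exact (hzr n).le
    exact ⟨w, hw, tendsto_nhds_unique h1 (h2.comp hφ.tendsto_atTop)⟩
  refine le_trans ?_ (measure_mono hsub)
  rw [Antitone.measure_iInter (fun n n' hn => closure_mono (image_mono (hanti hn)))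
    (fun n => isClosed_closure.measurableSet.nullMeasurableSet) ⟨0, measure_ne_top _ _⟩]
  exact le_iInf fun n => ((T n).2.le.trans (measure_mono subset_closure))

theorem exists_section {Z : Type*} [mZ : MeasurableSpace Z] [StandardBorelSpace Z] [Nonempty Z]
    {f : Z → ℝ} (hf : Measurable f) (ρ : Measure ℝ) [IsProbabilityMeasure ρ]
    (hρ : ρ (range f) = 1) :
    ∃ σ : ℝ → Z, Measurable σ ∧ ∀ᵐ r ∂ρ, f (σ r) = r := by
  classical
  letI := upgradeStandardBorel Z
  have hpol0 : PolishSpace Z := inferInstance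
  have hb0 : mZ = borel Z := BorelSpace.measurable_eq
  obtain ⟨t', hle, hcont, hpol⟩ := hf.exists_continuous
  have hborel : @BorelSpace Z t' mZ := by
    refine @BorelSpace.mk Z t' mZ ?_
    rw [hb0, borel_eq_borel_of_le hpol hpol0 hle]
  have hne : Nonempty Z := inferInstance
  have : ∃ θ : (ℕ → ℕ) → Z, Measurable θ ∧ Surjective θ ∧ Continuous (f ∘ θ) := by
    clear hle
    obtain ⟨θ, hθ, hθs⟩ := @PolishSpace.exists_nat_nat_continuous_surjective Z t' hpol hne
    refine ⟨θ, ?_, hθs, ?_⟩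
    · exact @Continuous.measurable _ _ _ _ _ t' mZ hborel θ hθ
    · exact @Continuous.comp _ _ _ _ t' _ _ _ hcont hθ
  obtain ⟨θ, hθm, hθs, hh⟩ := this
  set h := f ∘ θ
  have hr : ρ (range h) = 1 := by rw [hθs.range_comp, hρ]
  obtain ⟨t, -, ht1, htlim⟩ := exists_seq_strictMono_tendsto' (zero_lt_one (α := ℝ≥0∞))
  have := fun n => exists_compact_mass hh ρ (t := t n) (by rw [hr]; exact (ht1 n).2)
  choose K hK hKt using this
  choose σ hσ hσ' using fun n => compact_section hh (hK n)
  have hKm : ∀ n, MeasurableSet (h '' K n) := fun n => ((hK n).image hh).isClosed.measurableSet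
  obtain ⟨c, hc, hc'⟩ := find_sel (fun n => h '' K n) hKm
  refine ⟨fun r => θ (σ (c r) r), ?_, ?_⟩
  · refine hθm.comp ?_
    have : Measurable fun q : ℕ × ℝ => σ q.1 q.2 := measurable_from_prod_countable_right hσ
    exact this.comp (hc.prodMk measurable_id)
  · have hU : ρ (⋃ n, h '' K n) = 1 := by
      refine le_antisymm prob_le_one ?_
      exact le_of_tendsto' htlim fun n => (hKt n).trans (measure_mono (subset_iUnion (fun n => h '' K n) n))
    have : ∀ᵐ r ∂ρ, r ∈ ⋃ n, h '' K n := by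
      exact (mem_ae_iff_prob_eq_one (MeasurableSet.iUnion hKm)).2 hU
    filter_upwards [this] with r hr
    exact hσ' (c r) r (hc' r (mem_iUnion.1 hr))

end Sect

open MeasureTheory Set Function Filter Topology
open scoped ENNReal symmDiff

section Rec
variable {G X : Type*} [Group G] [MulAction G X]

lemma exists_code (X : Type*) [mX : MeasurableSpace X] [StandardBorelSpace X] :
    ∃ c : Measure X → ℝ, Measurable c ∧ (∀ ν, 1 < c ν ∧ c ν < 2) ∧
      ∀ ν ν' : Measure X, IsProbabilityMeasure ν → IsProbabilityMeasure ν' → c ν = c ν' → ν = ν' := by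
  classical
  set 𝒞 := MeasurableSpace.countableGeneratingSet X with h𝒞
  have h𝒞c : 𝒞.Countable := MeasurableSpace.countable_countableGeneratingSet
  have hgen : MeasurableSpace.generateFrom 𝒞 = mX :=
    MeasurableSpace.generateFrom_countableGeneratingSet
  set 𝒜 := generateSetAlgebra 𝒞 with h𝒜
  have h𝒜c : 𝒜.Countable := countable_generateSetAlgebra h𝒞c
  have h𝒜alg : IsSetAlgebra 𝒜 := isSetAlgebra_generateSetAlgebra
  have hgen' : mX = MeasurableSpace.generateFrom 𝒜 := by
    rw [h𝒜, generateFrom_generateSetAlgebra_eq, hgen]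
  obtain ⟨A, hA⟩ := h𝒜c.exists_eq_range ⟨∅, h𝒜alg.empty_mem⟩
  have hAm : ∀ n, MeasurableSet (A n) := by
    intro n
    rw [hgen']
    exact MeasurableSpace.measurableSet_generateFrom (hA ▸ mem_range_self n)
  let e : (ℕ → ℝ≥0∞) → ℝ := embeddingReal (ℕ → ℝ≥0∞)
  have he : MeasurableEmbedding e := measurableEmbedding_embeddingReal _
  have hπ := Real.pi_pos
  refine ⟨fun ν => 1 + (Real.arctan (e fun m => ν (A m)) / Real.pi + 1/2), ?_, ?_, ?_⟩
  · refine measurable_const.add (((Real.measurable_arctan.comp ?_).div_const _).add_const _)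
    refine he.measurable.comp ?_
    exact measurable_pi_iff.2 fun m => Measure.measurable_coe (hAm m)
  · intro ν
    set t := e fun m => ν (A m)
    have h1 := Real.neg_pi_div_two_lt_arctan t
    have h2 := Real.arctan_lt_pi_div_two t
    have h3 : -(1/2) < Real.arctan t / Real.pi := by rw [lt_div_iff₀ hπ]; linarith
    have h4 : Real.arctan t / Real.pi < 1/2 := by rw [div_lt_iff₀ hπ]; linarith
    constructor <;> linarith
  · intro ν ν' _ _ h
    have h1 : Real.arctan (e fun m => ν (A m)) / Real.pi
      = Real.arctan (e fun m => ν' (A m)) / Real.pi := by simpa using h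
    have h2 := Real.arctan_injective ((div_left_inj' hπ.ne').1 h1)
    have h3 := he.injective h2
    refine ext_of_generate_finite 𝒜 hgen' h𝒜alg.isSetRing.isSetSemiring.isPiSystem ?_ (by simp)
    intro s hs
    rw [hA] at hs
    obtain ⟨m, rfl⟩ := hs
    exact congrFun h3 m

variable [mX : MeasurableSpace X] [StandardBorelSpace X] {μ : Measure X} [IsProbabilityMeasure μ]
  {π : X → Measure X}

lemma erg_ae_eq (hπ : IsErgDecomp G μ π) (x : X) : ∀ᵐ y ∂(π x), π y = π x := by
  obtain ⟨c, hc, -, hci⟩ := exists_code X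
  obtain ⟨h1, h2, h3⟩ := hπ.2.1 x
  have h4 := hπ.2.2.2.1 (π x) h1 h2 h3
  have hm : MeasurableSet {y | π y = π x} := by
    have : {y | π y = π x} = (fun y => c (π y)) ⁻¹' {c (π x)} := by
      ext y
      constructor
      · intro h; exact congrArg c h
      · intro h; exact hci _ _ (hπ.2.1 y).1 h1 h
    rw [this]
    exact (hc.comp hπ.1) (measurableSet_singleton _)
  exact (mem_ae_iff_prob_eq_one hm).2 h4

lemma erg_meas (hπ : IsErgDecomp G μ π) {A : Set X} (hA : MeasurableSet A) :
    Measurable fun x => π x A := (Measure.measurable_coe hA).comp hπ.1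

/-- null sets are null for almost every component -/
lemma erg_null (hπ : IsErgDecomp G μ π) {p : X → Prop} (h : ∀ᵐ x ∂μ, p x) :
    ∀ᵐ x ∂μ, ∀ᵐ y ∂(π x), p y := by
  have h0 : μ (toMeasurable μ {x | ¬ p x}) = 0 := by rw [measure_toMeasurable]; exact h
  rw [hπ.2.2.2.2 _ (measurableSet_toMeasurable _ _),
    lintegral_eq_zero_iff (erg_meas hπ (measurableSet_toMeasurable _ _))] at h0
  filter_upwards [h0] with x hx
  exact measure_mono_null (subset_toMeasurable _ _) hx

lemma erg_null' (hπ : IsErgDecomp G μ π) {A : Set X} (hA : MeasurableSet A)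
    (h : ∀ᵐ x ∂μ, π x A = 0) : μ A = 0 := by
  rw [hπ.2.2.2.2 _ hA, lintegral_eq_zero_iff (erg_meas hπ hA)]
  exact h

lemma invSigma_measurable {Y : Type*} [MeasurableSpace Y] {f : X → Y} (hf : Measurable f)
    (hi : ∀ (k : G) x, f (k • x) = f x) : Measurable[invSigma G X] f := by
  intro S hS
  refine MeasurableSpace.measurableSet_generateFrom ⟨hf hS, fun k => ?_⟩
  ext x; simp [hi]

lemma invSigma_inv {A : Set X} (hA : MeasurableSet[invSigma G X] A) (k : G) :
    (fun x => k • x) ⁻¹' A = A := by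
  induction A, hA using MeasurableSpace.generateFrom_induction with
  | hC t ht => exact ht.2 k
  | empty => rfl
  | compl t _ ih => rw [preimage_compl, ih]
  | iUnion s _ ih => rw [preimage_iUnion]; exact iUnion_congr ih

lemma erg_condExp (hπ : IsErgDecomp G μ π) {A : Set X} (hA : MeasurableSet A) :
    (fun x => (π x A).toReal) =ᵐ[μ] μ[A.indicator (fun _ => (1:ℝ)) | invSigma G X] := by
  have hprob := fun x => (hπ.2.1 x).1
  have hfm := erg_meas hπ hA
  have hfi : Integrable (fun x => (π x A).toReal) μ := by
    refine Integrable.of_bound hfm.ennreal_toReal.aestronglyMeasurable 1 (ae_of_all _ fun x => ?_)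
    rw [Real.norm_of_nonneg ENNReal.toReal_nonneg]
    exact measureReal_le_one
  refine ae_eq_condExp_of_forall_setIntegral_eq invSigma_le
    ((integrable_const _).indicator hA) (fun s _ _ => hfi.integrableOn) ?_ ?_
  · intro B hB _
    have hBm : MeasurableSet B := invSigma_le B hB
    have hBi := fun k : G => invSigma_inv hB k
    set C := {x | π x B = 1} with hC
    have hCm : MeasurableSet C := (erg_meas hπ hBm) (measurableSet_singleton 1)
    have hae : B =ᵐ[μ] C := by
      rw [← measure_symmDiff_eq_zero_iff]
      refine erg_null' hπ (hBm.symmDiff hCm) (ae_of_all _ fun x => ?_)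
      have := hprob x
      rw [measure_symmDiff_eq_zero_iff, eventuallyEq_set]
      rcases (hπ.2.1 x).2.2 B hBm hBi with h | h
      · filter_upwards [erg_ae_eq hπ x, measure_eq_zero_iff_ae_notMem.1 h] with y hy hy'
        simp only [hy', hC, mem_setOf_eq, hy, h]
        simp
      · filter_upwards [erg_ae_eq hπ x, (mem_ae_iff_prob_eq_one hBm).2 h] with y hy hy'
        simp only [hy', hC, mem_setOf_eq, hy, h]
    rw [setIntegral_congr_set hae, setIntegral_congr_set hae, setIntegral_indicator hA]
    rw [integral_toReal hfm.aemeasurable (ae_of_all _ fun x => measure_lt_top _ _)]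
    rw [setIntegral_const, smul_eq_mul, mul_one, measureReal_def]
    congr 1
    rw [hπ.2.2.2.2 _ (hCm.inter hA), ← lintegral_indicator hCm]
    refine lintegral_congr fun x => ?_
    have hx := erg_ae_eq hπ x
    by_cases hxC : x ∈ C
    · rw [indicator_of_mem hxC]
      refine measure_congr (eventuallyEq_set.2 ?_)
      filter_upwards [hx] with y hy
      have : y ∈ C := by simp only [hC, mem_setOf_eq, hy]; exact hxC
      simp [this]
    · rw [indicator_of_notMem hxC]
      symm
      rw [measure_eq_zero_iff_ae_notMem]
      filter_upwards [hx] with y hy hh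
      apply hxC
      have := hh.1
      simpa only [hC, mem_setOf_eq, hy] using this
  · have : Measurable[invSigma G X] fun x => (π x A).toReal :=
      invSigma_measurable hfm.ennreal_toReal fun k x => by rw [hπ.2.2.1]
    exact this.stronglyMeasurable.aestronglyMeasurable

end Rec

open MeasureTheory Set Function Filter Topology
open scoped ENNReal symmDiff

section Rec2
variable {G X : Type*} [Group G] [MulAction G X] [Countable G]

lemma condExp_inv {m : MeasurableSpace X} [mX : MeasurableSpace X] {μ : Measure X}
    [IsProbabilityMeasure μ] (hp : IsPmp G μ) (hm : m ≤ mX) (hmi : InvariantAlg G m) {f : X → ℝ}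
    (hf : Integrable f μ) (hfi : ∀ (k : G) x, f (k • x) = f x) (k : G) :
    (fun x => (μ[f | m]) (k • x)) =ᵐ[μ] μ[f | m] := by
  have hmeas := hp.meas k
  refine ae_eq_condExp_of_forall_setIntegral_eq hm hf ?_ ?_ ?_
  · intro s _ _
    exact ((hp k).integrable_comp_of_integrable integrable_condExp).integrableOn
  · intro B hB _
    set B' := (fun x : X => k⁻¹ • x) ⁻¹' B
    have hB' : MeasurableSet[m] B' := hmi.pre _ hB
    have hBB : (fun x : X => k • x) ⁻¹' B' = B := by ext x; simp [B']
    have h1 := setIntegral_map (μ := μ) (g := fun x : X => k • x) (f := μ[f|m]) (s := B') (hm _ hB')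
      (by rw [(hp k).map_eq]; exact integrable_condExp.aestronglyMeasurable) hmeas.aemeasurable
    have h2 := setIntegral_map (μ := μ) (g := fun x : X => k • x) (f := f) (s := B') (hm _ hB')
      (by rw [(hp k).map_eq]; exact hf.aestronglyMeasurable) hmeas.aemeasurable
    rw [(hp k).map_eq, hBB] at h1 h2
    rw [← h1, setIntegral_condExp hm hf hB', h2]
    simp [hfi]
  · have : Measurable[m] fun x => (μ[f | m]) (k • x) :=
      (stronglyMeasurable_condExp.measurable).comp (hmi.measurable_smul k)
    exact this.stronglyMeasurable.aestronglyMeasurable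

theorem erg_rec {m : MeasurableSpace X} [mX : MeasurableSpace X] [StandardBorelSpace X]
    {μ : Measure X}
    [IsProbabilityMeasure μ] {π : X → Measure X} (hp : IsPmp G μ) (hπ : IsErgDecomp G μ π)
    (hm : m ≤ mX) (hmi : InvariantAlg G m) {A : Set X} (hA : MeasurableSet[m] A) :
    ∃ h : X → ℝ, Measurable[m] h ∧ (fun x => (π x A).toReal) =ᵐ[μ] h := by
  classical
  have hAm := hm A hA
  have hprob := fun x => (hπ.2.1 x).1
  set f : X → ℝ := fun x => (π x A).toReal with hf
  set a : X → ℝ := A.indicator (fun _ => (1:ℝ)) with ha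
  have hfm : Measurable f := (erg_meas hπ hAm).ennreal_toReal
  have hfinv : ∀ (k : G) x, f (k • x) = f x := fun k x => by simp only [hf]; rw [hπ.2.2.1]
  have hfb : ∀ x, ‖f x‖ ≤ 1 := fun x => by
    rw [Real.norm_of_nonneg ENNReal.toReal_nonneg]
    exact measureReal_le_one
  have hfint : Integrable f μ :=
    Integrable.of_bound hfm.aestronglyMeasurable 1 (ae_of_all _ hfb)
  have haint : Integrable a μ := (integrable_const _).indicator hAm
  set h := μ[f | m] with hh
  have hhm : Measurable[m] h := stronglyMeasurable_condExp.measurable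
  have hhmX : Measurable h := hhm.mono hm le_rfl
  have hhInteg : Integrable h μ := integrable_condExp
  have hhb : ∀ᵐ x ∂μ, ‖h x‖ ≤ 1 := by
    have := ae_bdd_abs_condExp_of_ae_bdd_abs (m := m) (μ := μ) (R := (1:ℝ)) (f := f)
      (ae_of_all _ hfb)
    exact this
  refine ⟨h, hhm, ?_⟩
  -- invariant version
  let h' : X → ℝ := fun x => if ∀ k : G, h (k • x) = h x then h x else 0
  have hset : MeasurableSet {x : X | ∀ k : G, h (k • x) = h x} := by
    rw [setOf_forall]
    exact MeasurableSet.iInter fun k => measurableSet_eq_fun (hhmX.comp (hp.meas k)) hhmX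
  have hh'm : Measurable h' := Measurable.ite hset hhmX measurable_const
  have hh'i : ∀ (k : G) x, h' (k • x) = h' x := by
    intro k x
    by_cases hx : ∀ k : G, h (k • x) = h x
    · have : ∀ j : G, h (j • k • x) = h (k • x) := fun j => by rw [smul_smul, hx, hx]
      simp only [h', if_pos hx, if_pos this, hx]
    · have : ¬ ∀ j : G, h (j • k • x) = h (k • x) := by
        intro hc
        apply hx
        intro j
        have h1 := hc (j * k⁻¹)
        have h2 := hc k⁻¹
        simp only [smul_smul, inv_mul_cancel_right, inv_mul_cancel, one_smul] at h1 h2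
        rw [h1, h2]
      simp only [h', if_neg hx, if_neg this]
  have hhh' : h' =ᵐ[μ] h := by
    have : ∀ᵐ x ∂μ, ∀ k : G, h (k • x) = h x := by
      rw [ae_all_iff]; intro k
      exact condExp_inv hp hm hmi hfint hfinv k
    filter_upwards [this] with x hx
    simp only [h', if_pos hx]
  have hfI : StronglyMeasurable[invSigma G X] f :=
    (invSigma_measurable hfm hfinv).stronglyMeasurable
  have hh'I : StronglyMeasurable[invSigma G X] h' :=
    (invSigma_measurable hh'm hh'i).stronglyMeasurable
  have hce : f =ᵐ[μ] μ[a | invSigma G X] := erg_condExp hπ hAm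
  have hh'b : ∀ᵐ x ∂μ, ‖h' x‖ ≤ 1 := by
    filter_upwards [hhb, hhh'] with x h1 h2; rwa [h2]
  have hab : ∀ x, ‖a x‖ ≤ 1 := fun x => by
    simp only [ha, indicator]; split_ifs <;> simp
  -- integrals
  have key1 : ∀ u : X → ℝ, StronglyMeasurable[invSigma G X] u → (∀ᵐ x ∂μ, ‖u x‖ ≤ 1) →
      ∫ x, u x * a x ∂μ = ∫ x, u x * f x ∂μ := by
    intro u hu hub
    have hi : Integrable (u * a) μ :=
      haint.bdd_mul (hu.mono invSigma_le).aestronglyMeasurable hub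
    have h1 := condExp_mul_of_stronglyMeasurable_left hu hi haint
    have h2 := integral_condExp (μ := μ) (f := u * a) (invSigma_le (G := G))
    have h3 : ∫ x, (u * a) x ∂μ = ∫ x, u x * f x ∂μ := by
      rw [← h2]
      refine integral_congr_ae ?_
      filter_upwards [h1, hce] with x hx1 hx2
      rw [hx1, Pi.mul_apply, hx2]
    exact h3
  have key2 : ∀ u : X → ℝ, StronglyMeasurable[m] u → (∀ᵐ x ∂μ, ‖u x‖ ≤ 1) →
      ∫ x, u x * f x ∂μ = ∫ x, u x * h x ∂μ := by
    intro u hu hub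
    have hi : Integrable (u * f) μ :=
      hfint.bdd_mul (hu.mono hm).aestronglyMeasurable hub
    have h1 := condExp_mul_of_stronglyMeasurable_left hu hi hfint
    have h2 := integral_condExp (μ := μ) (f := u * f) hm
    have h3 : ∫ x, (u * f) x ∂μ = ∫ x, u x * h x ∂μ := by
      rw [← h2]
      refine integral_congr_ae ?_
      filter_upwards [h1] with x hx1
      rw [hx1, Pi.mul_apply]
    exact h3
  have ham : StronglyMeasurable[m] a :=
    (Measurable.indicator (mβ := inferInstance) (@measurable_const _ _ _ m (1:ℝ)) hA).stronglyMeasurable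
  have e1 := key1 f hfI (ae_of_all _ hfb)
  have e2 := key1 h' hh'I hh'b
  have e3 := key2 h hhm.stronglyMeasurable hhb
  have e4 := key2 a ham (ae_of_all _ hab)
  have e5 : ∫ x, h' x * a x ∂μ = ∫ x, h x * a x ∂μ :=
    integral_congr_ae (by filter_upwards [hhh'] with x hx; rw [hx])
  have e6 : ∫ x, h' x * f x ∂μ = ∫ x, h x * f x ∂μ :=
    integral_congr_ae (by filter_upwards [hhh'] with x hx; rw [hx])
  have e7 : ∫ x, a x * f x ∂μ = ∫ x, f x * a x ∂μ := by simp only [mul_comm]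
  have e8 : ∫ x, a x * h x ∂μ = ∫ x, h x * a x ∂μ := by simp only [mul_comm]
  have iffi : Integrable (fun x => f x * f x) μ := hfint.bdd_mul hfm.aestronglyMeasurable (ae_of_all _ hfb)
  have ihf : Integrable (fun x => h x * f x) μ := hfint.bdd_mul hhmX.aestronglyMeasurable hhb
  have ihh : Integrable (fun x => h x * h x) μ := hhInteg.bdd_mul hhmX.aestronglyMeasurable hhb
  have hz : ∫ x, (f x - h x) ^ 2 ∂μ = 0 := by
    have : ∀ x, (f x - h x) ^ 2 = f x * f x - h x * f x - (h x * f x - h x * h x) := fun x => by ring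
    simp only [this]
    have i1 : Integrable (fun x => f x * f x - h x * f x) μ := iffi.sub ihf
    have i2 : Integrable (fun x => h x * f x - h x * h x) μ := ihf.sub ihh
    rw [integral_sub i1 i2, integral_sub iffi ihf, integral_sub ihf ihh]
    linarith
  have hInteg : Integrable (fun x => (f x - h x) ^ 2) μ := by
    have : (fun x => (f x - h x) ^ 2) = fun x => f x * f x - h x * f x - (h x * f x - h x * h x) := by
      funext x; ring
    rw [this]
    exact (iffi.sub ihf).sub (ihf.sub ihh)
  rw [integral_eq_zero_iff_of_nonneg (fun x => sq_nonneg _) hInteg] at hz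
  filter_upwards [hz] with x hx
  have : (f x - h x) ^ 2 = 0 := hx
  exact sub_eq_zero.1 (pow_eq_zero_iff (two_ne_zero)|>.1 this)

end Rec2

open MeasureTheory Set Function Filter Topology
open scoped ENNReal symmDiff

section Comp
variable {G X : Type*} [Group G] [MulAction G X]

lemma partition_fun [mX : MeasurableSpace X] {α : ℕ → Set X} (h : IsPartition α) :
    ∃ β : X → ℕ, Measurable β ∧ ∀ i, β ⁻¹' {i} = α i := by
  classical
  obtain ⟨h1, h2, h3⟩ := h
  have hex : ∀ x, ∃ i, x ∈ α i := fun x => mem_iUnion.1 (h3 ▸ mem_univ x)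
  choose β hβ using hex
  have hpre : ∀ i, β ⁻¹' {i} = α i := by
    intro i; ext x
    constructor
    · rintro h; rw [← (h : β x = i)]; exact hβ x
    · intro hx
      by_contra hne
      exact disjoint_left.1 (h2 (show β x ≠ i from hne)) (hβ x) hx
  refine ⟨β, measurable_to_countable' fun i => ?_, hpre⟩
  rw [hpre]; exact h1 i

lemma component {F : MeasurableSpace X} [mX : MeasurableSpace X] [StandardBorelSpace X]
    {ν : Measure X} [IsProbabilityMeasure ν] [NullSingletonClass ν]
    (hpmp : IsPmp G ν) (he : IsErgodicInv G ν) {g : ℕ → G} (hg : Surjective g) (hg0 : g 0 = 1)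
    (hF : F ≤ mX) (hFi : InvariantAlg G F) {ξ : Set (Set X)} {p : ℕ → ℝ} (hp0 : ∀ i, 0 ≤ p i)
    (hp1 : ∑' i, p i = 1)
    (hent : outerRokhlin G ξ F ν < ∑' i, ENNReal.ofReal (Real.negMulLog (p i)))
    {c : ℝ} (hc : 0 < c) :
    ∃ α : X → ℕ, Measurable α ∧ (∀ i, ν (α ⁻¹' {i}) = ENNReal.ofReal (p i)) ∧
      (∃ a K J : ℕ, (∀ i < a, p i = 0) ∧ 0 < p a ∧
        ν (coreS g K (α ⁻¹' {a})) = ENNReal.ofReal (c / 2 ^ J) ∧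
        ν (coreS g (K + 1) (α ⁻¹' {a})) = 0) ∧
      SubsetMod (sigmaG G (Set.range fun i => α ⁻¹' {i}) ⊔ F) ν ξ := by
  classical
  unfold outerRokhlin at hent
  obtain ⟨_, ⟨γ, hγ, hγξ, rfl⟩, hlt⟩ := sInf_lt_iff.1 hent
  obtain ⟨β, hβ, hβγ⟩ := partition_fun hγ
  have hex : ∃ i, 0 < p i := by
    by_contra h
    push Not at h
    have : ∀ i, p i = 0 := fun i => le_antisymm (h i) (hp0 i)
    simp [this] at hp1
  set a := Nat.find hex with ha
  have hpa : 0 < p a := Nat.find_spec hex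
  have hmin : ∀ i < a, p i = 0 := fun i hi =>
    le_antisymm (not_lt.1 (Nat.find_min hex hi)) (hp0 i)
  have hexb : ∃ b, a ≠ b ∧ 0 < p b := by
    by_contra h
    push Not at h
    have h0 : ∀ i, i ≠ a → p i = 0 := fun i hi => le_antisymm (h i hi.symm) (hp0 i)
    rw [tsum_eq_single a h0] at hp1
    have : ∑' i, ENNReal.ofReal (Real.negMulLog (p i)) = 0 := by
      rw [ENNReal.tsum_eq_zero]
      intro i
      by_cases hi : i = a
      · rw [hi, hp1]; simp
      · rw [h0 i hi]; simp
    rw [this] at hent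
    exact not_lt_zero hent
  obtain ⟨b, hab, hpb⟩ := hexb
  have hF' : F ⊔ invSigma G X ≤ mX := sup_le hF invSigma_le
  have hγ' : γ = fun i => β ⁻¹' {i} := funext fun i => (hβγ i).symm
  rw [hγ'] at hlt
  obtain ⟨α, hα, hαp, ⟨K, J, hK, hK'⟩, hgen⟩ := core hpmp he hg hg0 hF' hβ hp0 hp1 hab hpa hpb hlt hc
  refine ⟨α, hα, hαp, ⟨a, K, J, hmin, hpa, hK, hK'⟩, ?_⟩
  have hm0i : InvariantAlg G (sigmaG G (Set.range fun i => α ⁻¹' {i}) ⊔ F) := (InvariantAlg.sigmaG _).sup hFi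
  have hmi : InvariantAlg G (eventuallyMeasurableSpace (sigmaG G (Set.range fun i => α ⁻¹' {i}) ⊔ F) (ae ν)) := InvariantAlg.ev hpmp hm0i
  have hle : (sigmaG G (Set.range fun i => α ⁻¹' {i}) ⊔ F) ≤ (eventuallyMeasurableSpace (sigmaG G (Set.range fun i => α ⁻¹' {i}) ⊔ F) (ae ν)) := le_eventuallyMeasurableSpace
  have hI : invSigma G X ≤ (eventuallyMeasurableSpace (sigmaG G (Set.range fun i => α ⁻¹' {i}) ⊔ F) (ae ν)) := by
    refine MeasurableSpace.generateFrom_le ?_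
    rintro B ⟨hB, hBi⟩
    rcases he B hB hBi with h | h
    · exact ⟨∅, MeasurableSpace.measurableSet_empty (sigmaG G (Set.range fun i => α ⁻¹' {i}) ⊔ F), ae_eq_empty.2 h⟩
    · refine ⟨univ, @MeasurableSet.univ _ (sigmaG G (Set.range fun i => α ⁻¹' {i}) ⊔ F), ?_⟩
      exact eventuallyEq_univ.2 ((mem_ae_iff_prob_eq_one hB).2 h)
  have hFm : F ⊔ invSigma G X ≤ (eventuallyMeasurableSpace (sigmaG G (Set.range fun i => α ⁻¹' {i}) ⊔ F) (ae ν)) := sup_le (le_sup_right.trans hle) hI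
  have hβm := hgen (eventuallyMeasurableSpace (sigmaG G (Set.range fun i => α ⁻¹' {i}) ⊔ F) (ae ν)) hmi hFm (by
      intro A B hAB hB
      obtain ⟨C, hC, hBC⟩ := hB
      exact ⟨C, hC, hAB.trans hBC⟩)
    (fun i => hle _ (le_sup_left (a := sigmaG G (Set.range fun i => α ⁻¹' {i})) (b := F) _
      (MeasurableSpace.measurableSet_generateFrom ⟨1, _, ⟨i, rfl⟩, by ext; simp⟩)))
  have hsig : sigmaG G (range γ) ⊔ F ⊔ invSigma G X ≤ (eventuallyMeasurableSpace (sigmaG G (Set.range fun i => α ⁻¹' {i}) ⊔ F) (ae ν)) := by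
    rw [sup_assoc]
    refine sup_le (MeasurableSpace.generateFrom_le ?_) hFm
    rintro B ⟨k, _, ⟨i, rfl⟩, rfl⟩
    rw [← hβγ]
    exact hmi.pre k (hβm i)
  intro A hA
  obtain ⟨B, hB, hAB⟩ := hγξ A hA
  obtain ⟨C, hC, hBC⟩ := hsig _ hB
  exact ⟨C, hC, measure_symmDiff_eq_zero_iff.2 ((measure_symmDiff_eq_zero_iff.1 hAB).trans hBC)⟩

/-- almost every component is non-atomic -/
lemma comp_noAtoms [Countable G] [mX : MeasurableSpace X] [StandardBorelSpace X] {μ : Measure X}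
    [IsProbabilityMeasure μ] {π : X → Measure X} (hπ : IsErgDecomp G μ π) (hap : Aperiodic G μ) :
    ∀ᵐ x ∂μ, NullSingletonClass (π x) := by
  filter_upwards [erg_null hπ hap] with x hx
  obtain ⟨h1, h2, h3⟩ := hπ.2.1 x
  refine ⟨fun y => ?_⟩
  by_contra hy
  have hinf : (MulAction.orbit G y).Infinite := by
    by_contra h
    exact hy (measure_mono_null (by rintro _ rfl; exact h) hx)
  have hsame : ∀ z ∈ MulAction.orbit G y, π x {z} = π x {y} := by
    rintro _ ⟨k, rfl⟩
    have := h2.measure_pre k (A := {k • y}) (measurableSet_singleton _)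
    rw [← this]
    congr 1
    ext w; simp
  have htop : π x (MulAction.orbit G y) = ⊤ := by
    refine Set.Infinite.meas_eq_top hinf ⟨π x {y}, hy, fun z hz => (hsame z hz).ge⟩
  exact measure_ne_top _ _ htop

end Comp

open MeasureTheory Set Function Filter Topology
open scoped ENNReal symmDiff

section Theta
variable {G X : Type*} [Group G] [MulAction G X]

open Classical in
/-- the itinerary of a point -/
noncomputable def theta (g : ℕ → G) (gF : ℕ → Set X) (α : X → ℕ) (y : X) : (ℕ → ℕ) × (ℕ → ℕ) :=
  (fun l => α (g l • y), fun n => if y ∈ gF n then 1 else 0)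

lemma theta_meas_aux {g : ℕ → G} {gF : ℕ → Set X} {α : X → ℕ} [m : MeasurableSpace X]
    (h1 : ∀ l, Measurable fun y => α (g l • y)) (h2 : ∀ n, MeasurableSet (gF n)) :
    Measurable (theta g gF α) := by
  classical
  refine Measurable.prodMk (measurable_pi_iff.2 h1) (measurable_pi_iff.2 fun n => ?_)
  exact Measurable.ite (h2 n) measurable_const measurable_const

lemma theta_meas {F : MeasurableSpace X} (g : ℕ → G) {gF : ℕ → Set X}
    (hgF : F = MeasurableSpace.generateFrom (range gF)) (α : X → ℕ) :
    Measurable[sigmaG G (range fun i => α ⁻¹' {i}) ⊔ F] (theta g gF α) := by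
  classical
  have h1 : ∀ l, Measurable[sigmaG G (range fun i => α ⁻¹' {i}) ⊔ F] fun y => α (g l • y) := by
    intro l
    refine @measurable_to_countable' _ _ _ _ (_) _ fun i => ?_
    refine le_sup_left (a := sigmaG G (range fun i => α ⁻¹' {i})) (b := F) _ ?_
    exact MeasurableSpace.measurableSet_generateFrom ⟨g l, _, ⟨i, rfl⟩, rfl⟩
  have h2 : ∀ n, MeasurableSet[sigmaG G (range fun i => α ⁻¹' {i}) ⊔ F] (gF n) := by
    intro n
    refine le_sup_right (a := sigmaG G (range fun i => α ⁻¹' {i})) (b := F) _ ?_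
    rw [hgF]
    exact MeasurableSpace.measurableSet_generateFrom ⟨n, rfl⟩
  exact theta_meas_aux (m := _) h1 h2

lemma theta_comap {F : MeasurableSpace X} {g : ℕ → G} (hg : Surjective g) {gF : ℕ → Set X}
    (hgF : F = MeasurableSpace.generateFrom (range gF)) (α : X → ℕ) :
    sigmaG G (range fun i => α ⁻¹' {i}) ⊔ F ≤ MeasurableSpace.comap (theta g gF α) inferInstance := by
  classical
  refine sup_le (MeasurableSpace.generateFrom_le ?_) ?_
  · rintro _ ⟨k, _, ⟨i, rfl⟩, rfl⟩
    obtain ⟨l, rfl⟩ := hg k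
    refine ⟨{w | w.1 l = i}, ?_, rfl⟩
    exact ((measurable_pi_apply l).comp measurable_fst : Measurable
      fun w : (ℕ → ℕ) × (ℕ → ℕ) => w.1 l) (measurableSet_singleton i)
  · rw [hgF]
    refine MeasurableSpace.generateFrom_le ?_
    rintro _ ⟨n, rfl⟩
    refine ⟨{w | w.2 n = 1}, ?_, ?_⟩
    · exact ((measurable_pi_apply n).comp measurable_snd : Measurable
        fun w : (ℕ → ℕ) × (ℕ → ℕ) => w.2 n) (measurableSet_singleton 1)
    · ext y; simp [theta]

/-- decoding the component from the core measures -/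
lemma exists_decode : ∃ Ψ : (ℕ → ℕ → ℝ) → ℝ, Measurable Ψ ∧ ∀ (D : ℕ → ℕ → ℝ) (c : ℝ) (a K J : ℕ),
    (∀ i < a, D i 1 = 0) → D a 1 ≠ 0 → (∀ i, Antitone (D i)) → (∀ i k, 0 ≤ D i k) → 1 < c → c < 2 →
    D a K = c / 2 ^ J → D a (K + 1) = 0 → Ψ D = c := by
  classical
  let Q : ℕ → ℕ → ℕ → Set (ℕ → ℕ → ℝ) := fun i K J =>
    {D | (∀ i' < i, D i' 1 = 0) ∧ D i 1 ≠ 0 ∧ D i K ≠ 0 ∧ D i (K+1) = 0 ∧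
      1 < 2 ^ J * D i K ∧ 2 ^ J * D i K < 2}
  have hap : ∀ i k, Measurable fun D : ℕ → ℕ → ℝ => D i k := fun i k =>
    (measurable_pi_apply k).comp (measurable_pi_apply i)
  have hQ : ∀ i K J, MeasurableSet (Q i K J) := by
    intro i K J
    have : Q i K J = (⋂ i' : Fin i, {D | D i' 1 = 0}) ∩ ({D | D i 1 = 0}ᶜ ∩ ({D | D i K = 0}ᶜ ∩
      ({D | D i (K+1) = 0} ∩ ({D | 1 < 2 ^ J * D i K} ∩ {D | 2 ^ J * D i K < 2})))) := by
      ext D; simp [Q, Fin.forall_iff]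
    rw [this]
    have he : ∀ i k, MeasurableSet {D : ℕ → ℕ → ℝ | D i k = 0} := fun i k =>
      hap i k (measurableSet_singleton 0)
    refine (MeasurableSet.iInter fun i' => he _ _).inter ((he _ _).compl.inter
      ((he _ _).compl.inter ((he _ _).inter (MeasurableSet.inter ?_ ?_))))
    · exact measurableSet_lt measurable_const ((hap i K).const_mul _)
    · exact measurableSet_lt ((hap i K).const_mul _) measurable_const
  obtain ⟨s, hs, hs'⟩ := find_sel (fun n : ℕ => Q n.unpair.1 n.unpair.2.unpair.1 n.unpair.2.unpair.2)
    (fun n => hQ _ _ _)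
  obtain ⟨W, hWd⟩ : ∃ W : ℕ → (ℕ → ℕ → ℝ) → ℝ, ∀ n D, W n D =
      (2:ℝ) ^ n.unpair.2.unpair.2 * D n.unpair.1 n.unpair.2.unpair.1 := ⟨_, fun _ _ => rfl⟩
  have hW : ∀ n, Measurable (W n) := by
    intro n
    have : W n = fun D => (2:ℝ) ^ n.unpair.2.unpair.2 * D n.unpair.1 n.unpair.2.unpair.1 :=
      funext (hWd n)
    rw [this]; exact (hap _ _).const_mul _
  refine ⟨fun D => W (s D) D, ?_, ?_⟩
  · have : Measurable fun q : ℕ × (ℕ → ℕ → ℝ) => W q.1 q.2 :=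
      measurable_from_prod_countable_right hW
    exact this.comp (hs.prodMk measurable_id)
  · intro D c a K J h1 h2 h3 h4 hc1 hc2 hK hK'
    have h2J : (0:ℝ) < 2 ^ J := by positivity
    have hKc : 2 ^ J * D a K = c := by rw [hK]; field_simp
    have hin : D ∈ Q a K J := by
      refine ⟨h1, h2, ?_, hK', ?_, ?_⟩
      · intro h; rw [h] at hKc; linarith
      · rw [hKc]; exact hc1
      · rw [hKc]; exact hc2
    have := hs' D ⟨Nat.pair a (Nat.pair K J), by simpa using hin⟩
    obtain ⟨q1, q2, q3, q4, q5, q6⟩ := this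
    simp only [hWd]
    generalize (s D).unpair.1 = i at *
    generalize (s D).unpair.2.unpair.1 = K' at *
    generalize (s D).unpair.2.unpair.2 = J' at *
    have hi : i = a := by
      rcases lt_trichotomy i a with h | h | h
      · exact absurd (h1 i h) q2
      · exact h
      · exact absurd (q1 a h) h2
    subst hi
    have hKK : K' = K := by
      rcases lt_trichotomy K' K with h | h | h
      · have := h3 i (show K' + 1 ≤ K from h)
        have h5 := h4 i K
        have : D i K = 0 := by linarith
        exact absurd this hin.2.2.1
      · exact h
      · have := h3 i (show K + 1 ≤ K' from h)
        have h5 := h4 i K'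
        have : D i K' = 0 := by linarith
        exact absurd this q3
    subst hKK
    have hD := h4 i K'
    have hJJ : J' = J := by
      rcases lt_trichotomy J' J with h | h | h
      · have h6 : (2:ℝ) ^ (J' + 1) ≤ 2 ^ J := pow_le_pow_right₀ (by norm_num) h
        have h7 := mul_le_mul_of_nonneg_right h6 hD
        rw [pow_succ] at h7
        linarith
      · exact h
      · have h6 : (2:ℝ) ^ (J + 1) ≤ 2 ^ J' := pow_le_pow_right₀ (by norm_num) h
        have h7 := mul_le_mul_of_nonneg_right h6 hD
        rw [pow_succ] at h7
        linarith
    subst hJJ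
    exact hKc

end Theta

section Sel
variable {X Z : Type*} [MeasurableSpace X] [MeasurableSpace Z]

lemma meas_slice {π : X → Measure X} (hπ : Measurable π) (hprob : ∀ x, IsProbabilityMeasure (π x))
    {S : Set (Z × X)} (hS : MeasurableSet S) :
    Measurable fun q : X × Z => π q.1 {y | (q.2, y) ∈ S} := by
  let κ : ProbabilityTheory.Kernel (X × Z) X := ⟨fun q => π q.1, hπ.comp measurable_fst⟩
  have : ProbabilityTheory.IsMarkovKernel κ := ⟨fun q => hprob q.1⟩
  have hSpre : MeasurableSet ((fun w : (X × Z) × X => (w.1.2, w.2)) ⁻¹' S) :=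
    (((measurable_snd.comp measurable_fst).prodMk measurable_snd)) hS
  exact ProbabilityTheory.Kernel.measurable_kernel_prodMk_left (κ := κ) hSpre

/-- measurable selection over a coded family of measures -/
lemma exists_selection [StandardBorelSpace X] [StandardBorelSpace Z] {μ : Measure X}
    [IsProbabilityMeasure μ] {π : X → Measure X} (hπ : Measurable π)
    (hprob : ∀ x, IsProbabilityMeasure (π x)) {c : Measure X → ℝ} (hc : Measurable c)
    (hci : ∀ ν ν' : Measure X, IsProbabilityMeasure ν → IsProbabilityMeasure ν' →
      c ν = c ν' → ν = ν') {Good : Measure X → Z → Prop}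
    (hG : MeasurableSet {q : X × Z | Good (π q.1) q.2}) (hex : ∀ᵐ x ∂μ, ∃ z, Good (π x) z) :
    ∃ zs : ℝ → Z, Measurable zs ∧ ∀ᵐ x ∂μ, Good (π x) (zs (c (π x))) := by
  have hcπ : Measurable fun x => c (π x) := hc.comp hπ
  have : StandardBorelSpace {q : X × Z | Good (π q.1) q.2} := hG.standardBorel
  obtain ⟨x0, z0, h0⟩ := hex.exists
  have : Nonempty {q : X × Z | Good (π q.1) q.2} := ⟨⟨(x0, z0), h0⟩⟩
  have : IsProbabilityMeasure (μ.map fun x => c (π x)) :=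
    Measure.isProbabilityMeasure_map hcπ.aemeasurable
  obtain ⟨σ, hσ, hσ'⟩ := exists_section
    (f := fun q : {q : X × Z | Good (π q.1) q.2} => c (π q.1.1))
    (hcπ.comp (measurable_fst.comp measurable_subtype_coe)) (μ.map fun x => c (π x)) (by
      refine le_antisymm prob_le_one ?_
      refine le_trans ?_ (Measure.le_map_apply hcπ.aemeasurable _)
      have h1 : {x | ∃ z, Good (π x) z} ∈ ae μ := hex
      rw [← measure_univ (μ := μ), ← measure_congr (eventuallyEq_univ.2 h1)]
      refine measure_mono ?_
      rintro x ⟨z, hz⟩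
      exact ⟨⟨(x, z), hz⟩, rfl⟩)
  refine ⟨fun r => (σ r).1.2, measurable_snd.comp (measurable_subtype_coe.comp hσ), ?_⟩
  have := ae_of_ae_map hcπ.aemeasurable hσ'
  filter_upwards [this] with x hx
  have h1 := hci _ _ (hprob _) (hprob _) hx
  have h2 := (σ (c (π x))).2
  simp only [mem_setOf_eq] at h2
  rwa [h1] at h2

end Sel

open MeasureTheory Set Function Filter Topology
open scoped ENNReal symmDiff

section Final
variable {G X : Type*} [Group G] [MulAction G X]

lemma theta_congr {g : ℕ → G} {gF : ℕ → Set X} {α α' : X → ℕ} {y : X}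
    (h : ∀ l, α (g l • y) = α' (g l • y)) : theta g gF α y = theta g gF α' y := by
  simp [theta, h]

lemma coreS_congr {g : ℕ → G} {α α' : X → ℕ} {y : X}
    (h : ∀ l, α (g l • y) = α' (g l • y)) (K a : ℕ) :
    y ∈ coreS g K (α ⁻¹' {a}) ↔ y ∈ coreS g K (α' ⁻¹' {a}) := by
  simp [coreS, h]

/-- properties required of a partition on a component -/
def GoodP [MeasurableSpace X] (g : ℕ → G) (gF : ℕ → Set X) (A : ℕ → Set X)
    (U : Set ((ℕ → ℕ) × ((ℕ → ℕ) × (ℕ → ℕ)))) (c : ℝ) (p : ℕ → ℝ) (ν : Measure X)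
    (α : X → ℕ) (z : ℕ → ℕ → ℕ) : Prop :=
  (∀ i, ν (α ⁻¹' {i}) = ENNReal.ofReal (p i)) ∧
  (∀ k, ν (A k ∆ {y | (z k, theta g gF α y) ∈ U}) = 0) ∧
  ∃ a K J : ℕ, (∀ i < a, p i = 0) ∧ 0 < p a ∧
        ν (coreS g K (α ⁻¹' {a})) = ENNReal.ofReal (c / 2 ^ J) ∧
        ν (coreS g (K + 1) (α ⁻¹' {a})) = 0

lemma GoodP.congr [MeasurableSpace X] {g : ℕ → G} (hg0 : g 0 = 1) {gF : ℕ → Set X} {A : ℕ → Set X}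
    {U : Set ((ℕ → ℕ) × ((ℕ → ℕ) × (ℕ → ℕ)))} {c : ℝ} {p : ℕ → ℝ} {ν : Measure X}
    {α α' : X → ℕ} {z : ℕ → ℕ → ℕ} (h : GoodP g gF A U c p ν α z)
    (hae : ∀ᵐ y ∂ν, ∀ l, α (g l • y) = α' (g l • y)) : GoodP g gF A U c p ν α' z := by
  obtain ⟨h1, h2, a, K, J, h3, h4, h5, h6⟩ := h
  have hcore : ∀ K a, ν (coreS g K (α' ⁻¹' {a})) = ν (coreS g K (α ⁻¹' {a})) := by
    intro K a
    refine measure_congr (eventuallyEq_set.2 ?_)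
    filter_upwards [hae] with y hy
    exact (coreS_congr hy K a).symm
  refine ⟨fun i => ?_, fun k => ?_, a, K, J, h3, h4, ?_, ?_⟩
  · rw [← h1 i]
    refine measure_congr (eventuallyEq_set.2 ?_)
    filter_upwards [hae] with y hy
    have := hy 0
    rw [hg0, one_smul] at this
    simp [this]
  · rw [← h2 k]
    refine measure_congr (eventuallyEq_set.2 ?_)
    filter_upwards [hae] with y hy
    simp only [mem_symmDiff, mem_setOf_eq, theta_congr hy]
  · rw [hcore, h5]
  · rw [hcore, h6]

lemma ae_smul [MeasurableSpace X] {ν : Measure X} (hp : IsPmp G ν) {P : X → Prop}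
    (h : ∀ᵐ y ∂ν, P y) (g : ℕ → G) : ∀ᵐ y ∂ν, ∀ l, P (g l • y) := by
  rw [ae_all_iff]; intro l
  exact (hp (g l)).quasiMeasurePreserving.ae h

lemma GoodP_exists {F : MeasurableSpace X} [mX : MeasurableSpace X] [StandardBorelSpace X]
    {ν : Measure X} [IsProbabilityMeasure ν] [NullSingletonClass ν]
    (hpmp : IsPmp G ν) (he : IsErgodicInv G ν) {g : ℕ → G} (hg : Surjective g) (hg0 : g 0 = 1)
    (hF : F ≤ mX) (hFi : InvariantAlg G F) {gF : ℕ → Set X}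
    (hgF : F = MeasurableSpace.generateFrom (range gF))
    {ξ : Set (Set X)} {A : ℕ → Set X} (hA : range A = insert ∅ ξ) {p : ℕ → ℝ} (hp0 : ∀ i, 0 ≤ p i)
    (hp1 : ∑' i, p i = 1)
    (hent : outerRokhlin G ξ F ν < ∑' i, ENNReal.ofReal (Real.negMulLog (p i)))
    {c : ℝ} (hc : 0 < c) {U : Set ((ℕ → ℕ) × ((ℕ → ℕ) × (ℕ → ℕ)))}
    (hUz : ∀ (ν : Measure ((ℕ → ℕ) × (ℕ → ℕ))) [IsFiniteMeasure ν] (D : Set ((ℕ → ℕ) × (ℕ → ℕ))),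
      MeasurableSet D → ∃ z, D =ᵐ[ν] {y | (z, y) ∈ U})
    {f : (ℕ → ℕ → ℕ) × X → ℕ}
    (hf : ∀ (ν : Measure X) [IsFiniteMeasure ν] (α : X → ℕ),
      Measurable α → ∃ z, ∀ᵐ y ∂ν, α y = f (z, y)) :
    ∃ z : (ℕ → ℕ → ℕ) × (ℕ → ℕ → ℕ), GoodP g gF A U c p ν (fun y => f (z.1, y)) z.2 := by
  obtain ⟨α, hα, h1, h3, h2⟩ := component hpmp he hg hg0 hF hFi hp0 hp1 hent hc
  obtain ⟨z1, hz1⟩ := hf ν α hα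
  have hgFm : ∀ n, MeasurableSet (gF n) := fun n => hF _ (by
    rw [hgF]; exact MeasurableSpace.measurableSet_generateFrom ⟨n, rfl⟩)
  have hθ : Measurable (theta g gF α) :=
    theta_meas_aux (fun l => hα.comp (hpmp.meas (g l))) hgFm
  have hz2 : ∀ k, ∃ z, ν (A k ∆ {y | (z, theta g gF α y) ∈ U}) = 0 := by
    intro k
    have : ∃ B, MeasurableSet[sigmaG G (Set.range fun i => α ⁻¹' {i}) ⊔ F] B ∧ ν (A k ∆ B) = 0 := by
      have hk : A k ∈ insert ∅ ξ := hA ▸ mem_range_self k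
      rcases hk with hk | hk
      · exact ⟨∅, @MeasurableSet.empty _ (_), by simp [hk]⟩
      · exact h2 _ hk
    obtain ⟨B, hB, hAB⟩ := this
    obtain ⟨D, hD, rfl⟩ := theta_comap hg hgF α _ hB
    obtain ⟨z, hz⟩ := hUz (ν.map (theta g gF α)) D hD
    refine ⟨z, ?_⟩
    rw [measure_symmDiff_eq_zero_iff] at hAB ⊢
    refine hAB.trans ?_
    exact ae_eq_comp hθ.aemeasurable hz
  choose z2 hz2 using hz2
  refine ⟨(z1, z2), ?_⟩
  have : GoodP g gF A U c p ν α z2 := ⟨h1, hz2, h3⟩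
  exact this.congr hg0 (ae_smul hpmp hz1 g)

lemma GoodP_meas [mX : MeasurableSpace X]
    {π : X → Measure X} (hπ : Measurable π) (hprob : ∀ x, IsProbabilityMeasure (π x))
    {g : ℕ → G} (hsm : ∀ k : G, Measurable fun x : X => k • x)
    {gF : ℕ → Set X} (hgF : ∀ n, MeasurableSet (gF n))
    {A : ℕ → Set X} (hA : ∀ n, MeasurableSet (A n)) {p : Measure X → ℕ → ℝ}
    (hp : ∀ i, Measurable fun ν : Measure X => p ν i)
    {c : Measure X → ℝ} (hc : Measurable c) {U : Set ((ℕ → ℕ) × ((ℕ → ℕ) × (ℕ → ℕ)))}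
    (hU : MeasurableSet U)
    {f : (ℕ → ℕ → ℕ) × X → ℕ} (hf : Measurable f) :
    MeasurableSet {q : X × ((ℕ → ℕ → ℕ) × (ℕ → ℕ → ℕ)) |
      GoodP g gF A U (c (π q.1)) (p (π q.1)) (π q.1) (fun y => f (q.2.1, y)) q.2.2} := by
  classical
  have hπ1 : Measurable fun q : X × ((ℕ → ℕ → ℕ) × (ℕ → ℕ → ℕ)) => π q.1 := hπ.comp measurable_fst
  have hpq : ∀ i, Measurable fun q : X × ((ℕ → ℕ → ℕ) × (ℕ → ℕ → ℕ)) => p (π q.1) i :=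
    fun i => (hp i).comp hπ1
  have hfl : ∀ l, Measurable fun w : ((ℕ → ℕ → ℕ) × (ℕ → ℕ → ℕ)) × X => f (w.1.1, g l • w.2) :=
    fun l => hf.comp ((measurable_fst.comp measurable_fst).prodMk ((hsm (g l)).comp measurable_snd))
  have hf1 : Measurable fun w : ((ℕ → ℕ → ℕ) × (ℕ → ℕ → ℕ)) × X => f (w.1.1, w.2) :=
    hf.comp ((measurable_fst.comp measurable_fst).prodMk measurable_snd)
  have hθ : Measurable fun w : ((ℕ → ℕ → ℕ) × (ℕ → ℕ → ℕ)) × X =>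
      theta g gF (fun y => f (w.1.1, y)) w.2 := by
    refine Measurable.prodMk (measurable_pi_iff.2 hfl) (measurable_pi_iff.2 fun n => ?_)
    exact Measurable.ite (measurable_snd (hgF n)) measurable_const measurable_const
  have hcore : ∀ K a, Measurable fun q : X × ((ℕ → ℕ → ℕ) × (ℕ → ℕ → ℕ)) =>
      π q.1 (coreS g K ((fun y => f (q.2.1, y)) ⁻¹' {a})) := by
    intro K a
    have hS : MeasurableSet {w : ((ℕ → ℕ → ℕ) × (ℕ → ℕ → ℕ)) × X |
        ∀ l < K, f (w.1.1, g l • w.2) = a} := by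
      have : {w : ((ℕ → ℕ → ℕ) × (ℕ → ℕ → ℕ)) × X | ∀ l < K, f (w.1.1, g l • w.2) = a} =
          ⋂ l : Fin K, (fun w : ((ℕ → ℕ → ℕ) × (ℕ → ℕ → ℕ)) × X => f (w.1.1, g l • w.2)) ⁻¹' {a} := by
        ext w; simp [Fin.forall_iff]
      rw [this]
      exact MeasurableSet.iInter fun l => hfl l (measurableSet_singleton a)
    exact meas_slice hπ hprob hS
  have heq : {q : X × ((ℕ → ℕ → ℕ) × (ℕ → ℕ → ℕ)) |
      GoodP g gF A U (c (π q.1)) (p (π q.1)) (π q.1) (fun y => f (q.2.1, y)) q.2.2} =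
      (⋂ i, {q | π q.1 {y | f (q.2.1, y) = i} = ENNReal.ofReal (p (π q.1) i)}) ∩
      ((⋂ k, {q | π q.1 {y | (q.2, y) ∈ (Prod.snd ⁻¹' (A k)) ∆ ((fun w : ((ℕ → ℕ → ℕ) × (ℕ → ℕ → ℕ)) × X =>
        (w.1.2 k, theta g gF (fun y => f (w.1.1, y)) w.2)) ⁻¹' U)} = 0}) ∩
      ⋃ a : ℕ, ⋃ K : ℕ, ⋃ J : ℕ, (⋂ i : Fin a, {q | p (π q.1) i = 0}) ∩ ({q | 0 < p (π q.1) a} ∩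
        ({q | π q.1 (coreS g K ((fun y => f (q.2.1, y)) ⁻¹' {a})) = ENNReal.ofReal (c (π q.1) / 2 ^ J)} ∩
        {q | π q.1 (coreS g (K+1) ((fun y => f (q.2.1, y)) ⁻¹' {a})) = 0}))) := by
    ext q
    simp only [mem_inter_iff, mem_iInter, mem_iUnion, Fin.forall_iff]
    rfl
  rw [heq]
  refine (MeasurableSet.iInter fun i => ?_).inter ((MeasurableSet.iInter fun k => ?_).inter
    (MeasurableSet.iUnion fun a => MeasurableSet.iUnion fun K => MeasurableSet.iUnion fun J =>
      (MeasurableSet.iInter fun i => ?_).inter (MeasurableSet.inter ?_ (MeasurableSet.inter ?_ ?_))))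
  · refine measurableSet_eq_fun (meas_slice hπ hprob (S := {w : ((ℕ → ℕ → ℕ) × (ℕ → ℕ → ℕ)) × X | f (w.1.1, w.2) = i})
      (hf1 (measurableSet_singleton i))) (hpq i).ennreal_ofReal
  · refine (meas_slice hπ hprob ?_) (measurableSet_singleton 0)
    refine (measurable_snd (hA k)).symmDiff ?_
    have hk : Measurable fun w : ((ℕ → ℕ → ℕ) × (ℕ → ℕ → ℕ)) × X => w.1.2 k :=
      (measurable_pi_apply k).comp (measurable_snd.comp measurable_fst)
    exact (hk.prodMk hθ) hU
  · exact hpq i (measurableSet_singleton 0)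
  · exact measurableSet_lt measurable_const (hpq a)
  · exact measurableSet_eq_fun (hcore K a) ((hc.comp hπ1).div_const _).ennreal_ofReal
  · exact hcore (K+1) a (measurableSet_singleton 0)

end Final

open MeasureTheory Set Function Filter Topology
open scoped ENNReal symmDiff

lemma meas_pi2 {X : Type*} [m : MeasurableSpace X] {D : ℕ → ℕ → X → ℝ}
    (hD : ∀ i k, Measurable (D i k)) {Ψ : (ℕ → ℕ → ℝ) → ℝ} (hΨ : Measurable Ψ) :
    Measurable fun x => Ψ fun i k => D i k x :=
  hΨ.comp (measurable_pi_iff.2 fun i => measurable_pi_iff.2 fun k => hD i k)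

lemma meas_final {X : Type*} [m : MeasurableSpace X] {c' : X → ℝ} (hc' : Measurable c')
    {zs : ℝ → (ℕ → ℕ → ℕ) × (ℕ → ℕ → ℕ)} (hzs : Measurable zs) (k : ℕ)
    {θ : X → (ℕ → ℕ) × (ℕ → ℕ)} (hθ : Measurable θ)
    {U : Set ((ℕ → ℕ) × ((ℕ → ℕ) × (ℕ → ℕ)))} (hU : MeasurableSet U) :
    MeasurableSet {y | ((zs (c' y)).2 k, θ y) ∈ U} := by
  have h1 : Measurable fun y => (zs (c' y)).2 k :=
    (measurable_pi_apply k).comp (measurable_snd.comp (hzs.comp hc'))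
  exact (h1.prodMk hθ) hU

/-- Theorem 4.2, non-ergodic finite generator theorem: given a Borel
assignment of probability vectors to the ergodic components with entropy exceeding the
outer Rokhlin entropy, there is a single partition realizing these distributions on
almost-every ergodic component and generating `ξ` over `F`. -/
theorem statement7 {G X : Type*} (F : MeasurableSpace X) [Group G] [Countable G]
    [mX : MeasurableSpace X] [StandardBorelSpace X] [MulAction G X]
    (μ : Measure X) [IsProbabilityMeasure μ] (hpmp : IsPmp G μ) (hap : Aperiodic G μ)
    (ξ : Set (Set X)) (hξc : ξ.Countable) (hξm : ∀ A ∈ ξ, MeasurableSet A)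
    (hF : F ≤ mX) (hFinv : InvariantAlg G F) (hFcg : CountablyGen F)
    (π : X → Measure X) (hπ : IsErgDecomp G μ π)
    (p : Measure X → ℕ → ℝ) (hpmeas : ∀ i, Measurable fun ν : Measure X => p ν i)
    (hp : ∀ ν : Measure X, IsProbabilityMeasure ν → IsPmp G ν → IsErgodicInv G ν →
      (∀ i, 0 ≤ p ν i) ∧ (∑' i, p ν i = 1) ∧
        outerRokhlin G ξ F ν < ∑' i, ENNReal.ofReal (Real.negMulLog (p ν i))) :
    ∃ α : ℕ → Set X, IsPartition α ∧
      SubsetMod (sigmaG G (Set.range α) ⊔ F) μ ξ ∧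
      ∀ᵐ ν ∂(μ.map π), ∀ i, ν (α i) = ENNReal.ofReal (p ν i) := by
  classical
  -- enumeration of the group
  obtain ⟨g, hg, hg0⟩ : ∃ g : ℕ → G, Surjective g ∧ g 0 = 1 := by
    obtain ⟨g', hg'⟩ := exists_surjective_nat G
    refine ⟨fun n => Nat.casesOn n 1 g', fun k => ?_, rfl⟩
    obtain ⟨n, rfl⟩ := hg' k
    exact ⟨n + 1, rfl⟩
  -- generators of F
  obtain ⟨gF, hgF⟩ : ∃ gF : ℕ → Set X, F = MeasurableSpace.generateFrom (range gF) := by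
    obtain ⟨S, hS, hSF⟩ := hFcg
    obtain ⟨gF, hgF⟩ := (hS.insert ∅).exists_eq_range ⟨∅, mem_insert _ _⟩
    exact ⟨gF, by rw [← hgF, MeasurableSpace.generateFrom_insert_empty, hSF]⟩
  have hgFm : ∀ n, MeasurableSet (gF n) := fun n => hF _ (by
    rw [hgF]; exact MeasurableSpace.measurableSet_generateFrom ⟨n, rfl⟩)
  obtain ⟨A, hA⟩ := (hξc.insert ∅).exists_eq_range ⟨∅, mem_insert _ _⟩
  have hAm : ∀ k, MeasurableSet (A k) := by
    intro k
    have : A k ∈ insert ∅ ξ := hA ▸ mem_range_self k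
    rcases this with h | h
    · rw [h]; exact MeasurableSet.empty
    · exact hξm _ h
  obtain ⟨c, hc, hc12, hci⟩ := exists_code X
  obtain ⟨U, hU, hUz⟩ := exists_univ_set ((ℕ → ℕ) × (ℕ → ℕ))
  obtain ⟨f, hf, hfz⟩ := exists_univ_fun X
  have hprob := fun x => (hπ.2.1 x).1
  have hcπ : Measurable fun x => c (π x) := hc.comp hπ.1
  -- selection
  obtain ⟨zs, hzs, hgood⟩ := exists_selection (μ := μ) hπ.1 hprob hc hci
    (Good := fun ν (z : (ℕ → ℕ → ℕ) × (ℕ → ℕ → ℕ)) =>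
      GoodP g gF A U (c ν) (p ν) ν (fun y => f (z.1, y)) z.2)
    (GoodP_meas hπ.1 hprob hpmp.meas hgFm hAm hpmeas hc hU hf) (by
      filter_upwards [comp_noAtoms hπ hap] with x hx
      obtain ⟨h1, h2, h3⟩ := hπ.2.1 x
      obtain ⟨q1, q2, q3⟩ := hp (π x) h1 h2 h3
      exact GoodP_exists h2 h3 hg hg0 hF hFinv hgF hA.symm q1 q2 q3
        (by linarith [(hc12 (π x)).1]) hUz hfz)
  let α : X → ℕ := fun x => f ((zs (c (π x))).1, x)
  have hα : Measurable α :=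
    hf.comp ((measurable_fst.comp (hzs.comp hcπ)).prodMk measurable_id)
  have hαi : ∀ i, MeasurableSet (α ⁻¹' {i}) := fun i => hα (measurableSet_singleton i)
  have hgoodα : ∀ᵐ x ∂μ, GoodP g gF A U (c (π x)) (p (π x)) (π x) α (zs (c (π x))).2 := by
    filter_upwards [hgood] with x hx
    refine hx.congr hg0 ?_
    filter_upwards [erg_ae_eq hπ x] with y hy l
    simp only [α, hπ.2.2.1, hy]
  refine ⟨fun i => α ⁻¹' {i}, ⟨hαi, ?_, ?_⟩, ?_, ?_⟩
  · intro i j hij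
    refine disjoint_left.2 fun x hi hj => hij ?_
    have h1 : α x = i := hi
    have h2 : α x = j := hj
    rw [← h1, ← h2]
  · exact eq_univ_of_forall fun x => mem_iUnion.2 ⟨α x, rfl⟩
  · have hσle : sigmaG G (range fun i => α ⁻¹' {i}) ≤ mX := by
      refine MeasurableSpace.generateFrom_le ?_
      rintro _ ⟨k, _, ⟨i, rfl⟩, rfl⟩
      exact hpmp.inv.pre k (hαi i)
    have hσi : InvariantAlg G (sigmaG G (range fun i => α ⁻¹' {i})) := InvariantAlg.sigmaG _
    have hrec : ∀ i k, ∃ h : X → ℝ, Measurable[sigmaG G (range fun i => α ⁻¹' {i})] h ∧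
        (fun x => (π x (coreS g k (α ⁻¹' {i}))).toReal) =ᵐ[μ] h := by
      intro i k
      refine erg_rec hpmp hπ hσle hσi (coreS_meas hσi g k ?_)
      exact MeasurableSpace.measurableSet_generateFrom ⟨1, _, ⟨i, rfl⟩, by ext; simp⟩
    choose D hD hDae using hrec
    obtain ⟨Ψ, hΨ, hΨ'⟩ := exists_decode
    have hc' := meas_pi2 (m := sigmaG G (range fun i => α ⁻¹' {i})) hD hΨ
    have hcc : ∀ᵐ x ∂μ, (Ψ fun i k => D i k x) = c (π x) := by
      have hall : ∀ᵐ x ∂μ, ∀ i k, (π x (coreS g k (α ⁻¹' {i}))).toReal = D i k x := by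
        rw [ae_all_iff]; intro i; rw [ae_all_iff]; exact hDae i
      filter_upwards [hall, hgoodα] with x hx hgx
      obtain ⟨h1, -, a, K, J, h3, h4, h5, h6⟩ := hgx
      have hpr := hprob x
      have h1' : ∀ i, D i 1 x = (ENNReal.ofReal (p (π x) i)).toReal := by
        intro i
        rw [← hx, ← h1]
        congr 2
        ext y; simp [coreS, hg0]
      have hcp : 0 < c (π x) := by linarith [(hc12 (π x)).1]
      refine hΨ' _ (c (π x)) a K J ?_ ?_ ?_ ?_ (hc12 _).1 (hc12 _).2 ?_ ?_
      · intro i hi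
        simp [h1', h3 i hi]
      · simp only [h1']
        rw [ENNReal.toReal_ofReal h4.le]; exact h4.ne'
      · intro i k k' hk
        simp only [← hx]
        exact ENNReal.toReal_mono (measure_ne_top _ _) (measure_mono (coreS_anti g hk _))
      · intro i k
        simp only [← hx]; exact ENNReal.toReal_nonneg
      · simp only [← hx]
        rw [h5, ENNReal.toReal_ofReal (by positivity)]
      · simp only [← hx]
        rw [h6]; simp
    intro B hB
    obtain ⟨k, rfl⟩ : B ∈ range A := hA ▸ mem_insert_of_mem _ hB
    refine ⟨{y | ((zs (Ψ fun i k => D i k y)).2 k, theta g gF α y) ∈ U}, ?_, ?_⟩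
    · exact meas_final (m := sigmaG G (range fun i => α ⁻¹' {i}) ⊔ F)
        (hc'.mono le_sup_left le_rfl) hzs k (theta_meas g hgF α) hU
    · have hθ : Measurable (theta g gF α) :=
        theta_meas_aux (fun l => hα.comp (hpmp.meas (g l))) hgFm
      have h0 : μ (A k ∆ {y | ((zs (c (π y))).2 k, theta g gF α y) ∈ U}) = 0 := by
        refine erg_null' hπ ((hAm k).symmDiff (meas_final hcπ hzs k hθ hU)) ?_
        filter_upwards [hgoodα] with x hx
        rw [← hx.2.1 k]
        refine measure_congr (eventuallyEq_set.2 ?_)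
        filter_upwards [erg_ae_eq hπ x] with y hy
        simp only [mem_symmDiff, mem_setOf_eq, hy]
      rw [← h0]
      refine measure_congr (eventuallyEq_set.2 ?_)
      filter_upwards [hcc] with y hy
      simp only [mem_symmDiff, mem_setOf_eq, hy]
  · have hm : MeasurableSet {ν : Measure X | ∀ i, ν (α ⁻¹' {i}) = ENNReal.ofReal (p ν i)} := by
      rw [setOf_forall]
      exact MeasurableSet.iInter fun i => measurableSet_eq_fun (Measure.measurable_coe (hαi i))
        (hpmeas i).ennreal_ofReal
    rw [ae_map_iff hπ.1.aemeasurable hm]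
    filter_upwards [hgoodα] with x hx
    exact hx.1
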